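/- arXiv:2401.16358 — 4 statements merged into one kernel-verified Lean document; each statement's English description precedes it below -/
import Mathlib

section
/- Assume ℒ_{(n,*)} ≠ 0 for all sufficiently large n, and let δ := min{j : y_j ∉ √(Ann_T ℒ)}. Then there exists b₂ ∈ ℤ such that v(ℒ_{(n,*)}) = d_δ · n + b₂ for all sufficiently large n; in particular, the v-number function v(ℒ_{(n,*)}) is eventually linear in n with the same leading coefficient d_δ as the function indeg(ℒ_{(n,*)}). -/
open DirectSum

theorem vnr_prime_aux {ι T : Type*} [CommRing T] [AddCommMonoid ι] [LinearOrder ι]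
    [IsOrderedCancelAddMonoid ι] (h1 : DecidableEq ι) (𝒯 : ι → AddSubgroup T)
    (G : GradedRing 𝒯)
    (I : Ideal T) (hI : ∀ t ∈ I, ∀ i, (decompose 𝒯 t i : T) ∈ I) (hne : I ≠ ⊤)
    (h : ∀ i j : ι, ∀ a ∈ 𝒯 i, ∀ b ∈ 𝒯 j, a * b ∈ I → a ∈ I ∨ b ∈ I) : I.IsPrime := by
  have hd : h1 = LinearOrder.toDecidableEq := Subsingleton.elim _ _
  subst hd
  refine Ideal.IsHomogeneous.isPrime_of_homogeneous_mem_or_mem (𝒜 := 𝒯) ?_ hne ?_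
  · intro i t ht
    exact hI t ht i
  · rintro a b ⟨i, ha⟩ ⟨j, hb⟩ hab
    exact h i j a ha b hb hab

theorem vnr_prime {T : Type*} [CommRing T] (𝒯 : ℤ × ℤ → AddSubgroup T) [G : GradedRing 𝒯]
    (I : Ideal T) (hI : ∀ t ∈ I, ∀ i, (decompose 𝒯 t i : T) ∈ I) (hne : I ≠ ⊤)
    (h : ∀ i j : ℤ × ℤ, ∀ a ∈ 𝒯 i, ∀ b ∈ 𝒯 j, a * b ∈ I → a ∈ I ∨ b ∈ I) : I.IsPrime :=
  vnr_prime_aux (ι := ℤ ×ₗ ℤ) (fun a b => instDecidableEqProd a b) 𝒯 G I hI hne h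

theorem vnr_comb (A : ℤ → ℤ → Prop) (D u0 C n1 : ℤ)
    (hdesc : ∀ n ≥ n1, ∀ u, A (n+1) u → ∃ D' ≥ D, A n (u - D'))
    (hlow : ∀ n u, A n u → u0 ≤ u)
    (hup : ∀ n ≥ n1, ∃ u, A n u ∧ u ≤ D * n + C) :
    ∃ b n0 : ℤ, ∀ n ≥ n0, sInf {u | A n u} = D * n + b := by
  have hbdd : ∀ n, BddBelow {u | A n u} := fun n => ⟨u0, fun u hu => hlow n u hu⟩
  have hmem : ∀ n ≥ n1, A n (sInf {u | A n u}) := fun n hn => by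
    obtain ⟨u, hu, -⟩ := hup n hn
    exact Int.csInf_mem (s := {u | A n u}) ⟨u, hu⟩ (hbdd n)
  let g : ℕ → ℤ := fun k => sInf {u | A (n1 + k) u} - D * (n1 + k)
  have hmono : Monotone g := by
    refine monotone_nat_of_le_succ fun k => ?_
    obtain ⟨D', hD', h⟩ := hdesc (n1 + k) (by omega) _ (by
      have := hmem (n1 + k + 1) (by omega)
      exact this)
    have := csInf_le (hbdd _) h
    simp only [g]
    push_cast
    rw [← add_assoc]
    linarith
  have hle : ∀ k, g k ≤ C := fun k => by
    obtain ⟨u, hu, h⟩ := hup (n1 + k) (by omega)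
    have := csInf_le (hbdd _) hu
    simp only [g]
    linarith
  obtain ⟨b, hb, hmax⟩ : ∃ b, (∃ k, g k = b) ∧ ∀ z, (∃ k, g k = z) → z ≤ b :=
    Int.exists_greatest_of_bdd ⟨C, by rintro z ⟨k, rfl⟩; exact hle k⟩ ⟨g 0, 0, rfl⟩
  obtain ⟨k, hk⟩ := hb
  refine ⟨b, n1 + k, fun n hn => ?_⟩
  have h1 : g (n - n1).toNat = b :=
    le_antisymm (hmax _ ⟨_, rfl⟩) (hk ▸ hmono (by omega))
  simp only [g] at h1
  rw [show n1 + ((n - n1).toNat : ℤ) = n by omega] at h1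
  linarith

section
variable {T L : Type*} [CommRing T] [AddCommGroup L] [Module T L]
    (𝒯 : ℤ × ℤ → AddSubgroup T) [GradedRing 𝒯]
    (ℒ : ℤ × ℤ → AddSubgroup L) [DirectSum.Decomposition ℒ]

theorem vnr_dec_add (a b : L) (i : ℤ × ℤ) :
    (decompose ℒ (a + b) i : L) = decompose ℒ a i + decompose ℒ b i := by
  rw [decompose_add]; rfl

theorem vnr_dec_sum {ι : Type*} (s : Finset ι) (f : ι → L) (i : ℤ × ℤ) :
    (decompose ℒ (∑ j ∈ s, f j) i : L) = ∑ j ∈ s, (decompose ℒ (f j) i : L) := by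
  classical
  induction s using Finset.induction_on with
  | empty => simp
  | insert a s ha ih => rw [Finset.sum_insert ha, Finset.sum_insert ha, vnr_dec_add, ih]

/-- homogeneous component of a product lies in S if all the relevant products do -/
theorem vnr_dec_smul (hsmul : ∀ (i j : ℤ × ℤ), ∀ t ∈ 𝒯 i, ∀ m ∈ ℒ j, t • m ∈ ℒ (i + j))
    (S : AddSubgroup L) (t : T) (m : L) (i : ℤ × ℤ)
    (h : ∀ a b, a + b = i → (decompose 𝒯 t a : T) • (decompose ℒ m b : L) ∈ S) :
    (decompose ℒ (t • m) i : L) ∈ S := by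
  classical
  have : t • m = ∑ a ∈ (decompose 𝒯 t).support, ∑ b ∈ (decompose ℒ m).support,
      (decompose 𝒯 t a : T) • (decompose ℒ m b : L) := by
    conv_lhs => rw [← sum_support_decompose 𝒯 t, ← sum_support_decompose ℒ m]
    rw [Finset.sum_smul]
    simp_rw [Finset.smul_sum]
  rw [this, vnr_dec_sum]
  refine S.sum_mem fun a _ => ?_
  rw [vnr_dec_sum]
  refine S.sum_mem fun b _ => ?_
  have hm := hsmul a b _ (decompose 𝒯 t a).2 _ (decompose ℒ m b).2
  by_cases hab : a + b = i
  · subst hab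
    rw [decompose_of_mem_same ℒ hm]
    exact h a b rfl
  · rw [decompose_of_mem_ne ℒ hm hab]
    exact S.zero_mem

/-- component of homogeneous scalar times element -/
theorem vnr_dec_hsmul (hsmul : ∀ (i j : ℤ × ℤ), ∀ t ∈ 𝒯 i, ∀ m ∈ ℒ j, t • m ∈ ℒ (i + j))
    (t : T) (a : ℤ × ℤ) (ht : t ∈ 𝒯 a) (m : L) (i : ℤ × ℤ) :
    (decompose ℒ (t • m) (a + i) : L) = t • (decompose ℒ m i : L) := by
  classical
  conv_lhs => rw [← sum_support_decompose ℒ m]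
  rw [Finset.smul_sum, vnr_dec_sum]
  have key : ∀ b, (decompose ℒ (t • (decompose ℒ m b : L)) (a + i) : L)
      = if b = i then t • (decompose ℒ m i : L) else 0 := by
    intro b
    have hm := hsmul a b _ ht _ (decompose ℒ m b).2
    split_ifs with hb
    · subst hb
      exact decompose_of_mem_same ℒ hm
    · exact decompose_of_mem_ne ℒ hm (fun h => hb (add_left_cancel h))
  simp_rw [key]
  rw [Finset.sum_ite_eq']
  split_ifs with h
  · rfl
  · rw [DFinsupp.notMem_support_iff] at h
    rw [h]; simp

/-- component of scalar times homogeneous element -/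
theorem vnr_dec_smulh (hsmul : ∀ (i j : ℤ × ℤ), ∀ t ∈ 𝒯 i, ∀ m ∈ ℒ j, t • m ∈ ℒ (i + j))
    (t : T) (a : ℤ × ℤ) (m : L) (i : ℤ × ℤ) (hm : m ∈ ℒ i) :
    (decompose ℒ (t • m) (a + i) : L) = (decompose 𝒯 t a : T) • m := by
  classical
  conv_lhs => rw [← sum_support_decompose 𝒯 t]
  rw [Finset.sum_smul, vnr_dec_sum]
  have key : ∀ b, (decompose ℒ ((decompose 𝒯 t b : T) • m) (a + i) : L)
      = if b = a then (decompose 𝒯 t a : T) • m else 0 := by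
    intro b
    have hm := hsmul b i _ (decompose 𝒯 t b).2 _ hm
    split_ifs with hb
    · subst hb
      exact decompose_of_mem_same ℒ hm
    · exact decompose_of_mem_ne ℒ hm (fun h => hb (add_right_cancel h))
  simp_rw [key]
  rw [Finset.sum_ite_eq']
  split_ifs with h
  · rfl
  · rw [DFinsupp.notMem_support_iff] at h
    rw [h]; simp

/-- Generators bound. -/
theorem vnr_gen_bound (N : Submodule T L) (hN : N.FG) (φ : ℤ × ℤ → ℤ) :
    ∃ G : Finset L, Submodule.span T (G : Set L) = N ∧
      ∃ D : ℤ, ∀ g ∈ G, ∀ i, (decompose ℒ g i : L) ≠ 0 → φ i ≤ D := by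
  classical
  obtain ⟨G, hG⟩ := hN
  refine ⟨G, hG, ?_⟩
  obtain ⟨D, hD⟩ := ((G.biUnion fun g => (decompose ℒ g).support).image φ).bddAbove
  refine ⟨D, fun g hg i hi => hD ?_⟩
  simp only [Finset.coe_image, Finset.coe_biUnion, Set.mem_image, Set.mem_iUnion]
  refine ⟨i, ⟨g, hg, ?_⟩, rfl⟩
  simp only [Finset.mem_coe, DFinsupp.mem_support_iff]
  intro h; apply hi; rw [h]; rfl

theorem vnr_low (hsmul : ∀ (i j : ℤ × ℤ), ∀ t ∈ 𝒯 i, ∀ m ∈ ℒ j, t • m ∈ ℒ (i + j))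
    (hTnn : ∀ i : ℤ × ℤ, i.1 < 0 ∨ i.2 < 0 → 𝒯 i = ⊥) [Module.Finite T L] :
    ∃ u0 : ℤ, ∀ n u : ℤ, ∀ m ∈ ℒ (n, u), m ≠ 0 → u0 ≤ u := by
  obtain ⟨G, hG, D, hD⟩ := vnr_gen_bound (T := T) ℒ ⊤ Module.Finite.fg_top (fun i => - i.2)
  have key : ∀ m ∈ Submodule.span T (G : Set L), ∀ i : ℤ × ℤ, i.2 < -D →
      (decompose ℒ m i : L) = 0 := by
    intro m hm
    induction hm using Submodule.span_induction with
    | mem g hg =>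
      intro i hi
      by_contra h
      have := hD g hg i h
      linarith
    | zero => intro i _; simp
    | add a b _ _ ha hb => intro i hi; rw [vnr_dec_add, ha i hi, hb i hi, add_zero]
    | smul t m _ ih =>
      intro i hi
      have := vnr_dec_smul 𝒯 ℒ hsmul ⊥ t m i (fun a b hab => by
        by_cases hb : b.2 < -D
        · rw [ih b hb]; simp
        · have h2 : a.2 < 0 := by
            have : a.2 + b.2 = i.2 := by rw [← hab]; rfl
            omega
          have h3 : ∀ z ∈ 𝒯 a, z = 0 := by
            rw [hTnn a (Or.inr h2)]; intro z hz; exact AddSubgroup.mem_bot.1 hz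
          rw [h3 _ (decompose 𝒯 t a).2]; simp)
      simpa using this
  refine ⟨-D, fun n u m hm hne => ?_⟩
  by_contra hlt
  apply hne
  rw [← decompose_of_mem_same ℒ hm]
  exact key m (by rw [hG]; trivial) _ (by simpa using hlt)

/-- components of ring elements lie in powers of the ideal generated by `y`. -/
theorem vnr_Tpow {R₀ : Type*} [CommRing R₀] [Algebra R₀ T] 
    (halg : ∀ r : R₀, algebraMap R₀ T r ∈ 𝒯 (0, 0))
    {dd c : ℕ} (x : Fin dd → T) (y : Fin c → T)
    (f : Fin dd → ℤ) (d : Fin c → ℤ)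
    (hx : ∀ i, x i ∈ 𝒯 (0, f i)) (hy : ∀ j, y j ∈ 𝒯 (1, d j))
    (hgen : Algebra.adjoin R₀ (Set.range x ∪ Set.range y) = ⊤) (t : T) :
    ∀ i : ℤ × ℤ, (decompose 𝒯 t i : T) ∈ (Ideal.span (Set.range y)) ^ i.1.toNat := by
  have ht : t ∈ Algebra.adjoin R₀ (Set.range x ∪ Set.range y) := by rw [hgen]; trivial
  have zero_case : ∀ (s : T) (l : ℤ), s ∈ 𝒯 (0, l) → ∀ i : ℤ × ℤ,
      (decompose 𝒯 s i : T) ∈ (Ideal.span (Set.range y)) ^ i.1.toNat := by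
    intro s l hs i
    by_cases h : (0, l) = i
    · subst h; simp
    · rw [decompose_of_mem_ne 𝒯 hs h]; exact Ideal.zero_mem _
  induction ht using Algebra.adjoin_induction with
  | mem s hs =>
    rcases hs with ⟨j, rfl⟩ | ⟨j, rfl⟩
    · exact zero_case _ _ (hx j)
    · intro i
      by_cases h : (1, d j) = i
      · subst h
        rw [decompose_of_mem_same 𝒯 (hy j)]
        simpa using Ideal.subset_span (Set.mem_range_self j)
      · rw [decompose_of_mem_ne 𝒯 (hy j) h]; exact Ideal.zero_mem _
  | algebraMap r => exact zero_case _ _ (halg r)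
  | add a b _ _ ha hb => intro i; rw [vnr_dec_add]; exact Ideal.add_mem _ (ha i) (hb i)
  | mul s t _ _ hs ht =>
    intro i
    refine vnr_dec_smul 𝒯 𝒯 (fun i j t ht m hm => SetLike.GradedMul.mul_mem ht hm)
      ((Ideal.span (Set.range y)) ^ i.1.toNat).toAddSubgroup s t i (fun a b hab => ?_)
    have h1 := Ideal.mul_mem_mul (hs a) (ht b)
    rw [← pow_add] at h1
    refine Ideal.pow_le_pow_right ?_ h1
    have : a.1 + b.1 = i.1 := by rw [← hab]; rfl
    omega

/-- components of a graded submodule -/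
theorem vnr_Npow (hsmul : ∀ (i j : ℤ × ℤ), ∀ t ∈ 𝒯 i, ∀ m ∈ ℒ j, t • m ∈ ℒ (i + j))
    (Y : Ideal T) (hY : ∀ t : T, ∀ i : ℤ × ℤ, (decompose 𝒯 t i : T) ∈ Y ^ i.1.toNat)
    (N : Submodule T L) (hN : N.FG) (hgr : ∀ m ∈ N, ∀ i, (decompose ℒ m i : L) ∈ N) :
    ∃ D : ℤ, ∀ m ∈ N, ∀ i : ℤ × ℤ, (decompose ℒ m i : L) ∈ Y ^ (i.1 - D).toNat • N := by
  obtain ⟨G, hG, D, hD⟩ := vnr_gen_bound (T := T) ℒ N hN (fun i => i.1)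
  refine ⟨D, fun m hm => ?_⟩
  rw [← hG] at hm
  induction hm using Submodule.span_induction with
  | mem g hg =>
    intro i
    by_cases h : (decompose ℒ g i : L) = 0
    · rw [h]; exact Submodule.zero_mem _
    · have h1 := hD g hg i h
      rw [show (i.1 - D).toNat = 0 by omega]
      simpa using hgr g (by rw [← hG]; exact Submodule.subset_span hg) i
  | zero => intro i; simp
  | add a b _ _ ha hb => intro i; rw [vnr_dec_add]; exact Submodule.add_mem _ (ha i) (hb i)
  | smul t m _ ih =>
    intro i
    refine vnr_dec_smul 𝒯 ℒ hsmul (Y ^ (i.1 - D).toNat • N).toAddSubgroup t m i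
      (fun a b hab => ?_)
    have h1 := Submodule.smul_mem_smul (hY t a) (ih b)
    rw [← Submodule.mul_smul, ← pow_add] at h1
    refine Submodule.smul_mono_left (Ideal.pow_le_pow_right ?_) h1
    have : a.1 + b.1 = i.1 := by rw [← hab]; rfl
    omega



/-- descent: homogeneous elements in large degree are combinations of `y j`, `j ≥ δ`. -/
theorem vnr_desc (hsmul : ∀ (i j : ℤ × ℤ), ∀ t ∈ 𝒯 i, ∀ m ∈ ℒ j, t • m ∈ ℒ (i + j))
    [IsNoetherianRing T] [Module.Finite T L]
    {c : ℕ} (y : Fin c → T) (d : Fin c → ℤ) (hy : ∀ j, y j ∈ 𝒯 (1, d j))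
    (hY : ∀ t : T, ∀ i : ℤ × ℤ,
      (decompose 𝒯 t i : T) ∈ (Ideal.span (Set.range y)) ^ i.1.toNat)
    (δ : Fin c)
    (hδmin : ∀ j : Fin c, j < δ → y j ∈ ((⊤ : Submodule T L).annihilator).radical)
    (N : Submodule T L) (hgr : ∀ m ∈ N, ∀ i, (decompose ℒ m i : L) ∈ N) :
    ∃ n1 : ℤ, ∀ n ≥ n1, ∀ u : ℤ, ∀ m ∈ ℒ (n + 1, u), m ∈ N →
      ∃ g : Fin c → L, (∀ j, g j ∈ N ∧ g j ∈ ℒ (n, u - d j)) ∧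
        m = ∑ j ∈ Finset.univ.filter (fun j => δ ≤ j), y j • g j := by
  classical
  obtain ⟨D, hD⟩ := vnr_Npow 𝒯 ℒ hsmul _ hY N (IsNoetherian.noetherian N) hgr
  set J : Ideal T := Ideal.span (y '' {j | j < δ}) with hJ
  set I : Ideal T := Ideal.span (y '' {j | δ ≤ j}) with hI
  have hIJ : Ideal.span (Set.range y) = I ⊔ J := by
    rw [hI, hJ, ← Ideal.span_union, ← Set.image_union, ← Set.image_univ]
    congr 2
    ext j
    simp [le_or_gt]
  have hJr : J ≤ ((⊤ : Submodule T L).annihilator).radical := by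
    rw [hJ, Ideal.span_le]
    rintro _ ⟨j, hj, rfl⟩
    exact hδmin j hj
  obtain ⟨s, hs⟩ := Ideal.exists_pow_le_of_le_radical_of_fg hJr
    (IsNoetherian.noetherian J)
  refine ⟨D + s, fun n hn u m hm hmN => ?_⟩
  have h1 := hD m hmN (n + 1, u)
  rw [decompose_of_mem_same ℒ hm, hIJ] at h1
  have h2 : m ∈ I • N := by
    have hle : (I ⊔ J) ^ ((n + 1 - D).toNat) ≤ I ⊔ J ^ s := by
      refine (Ideal.pow_le_pow_right (show 1 + s ≤ _ by omega)).trans ?_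
      simpa using Ideal.sup_pow_add_le_pow_sup_pow (I := I) (J := J) (n := 1) (m := s)
    have h3 := Submodule.smul_mono_left (N := N) hle h1
    rw [Submodule.sup_smul] at h3
    have h4 : J ^ s • N = ⊥ := by
      rw [eq_bot_iff, Submodule.smul_le]
      intro r hr z _
      have := Submodule.mem_annihilator.1 (hs hr) z trivial
      simp [this]
    rwa [h4, sup_bot_eq] at h3
  have h5 : ∀ z ∈ I • N, ∃ g : Fin c → L, (∀ j, g j ∈ N) ∧
      z = ∑ j ∈ Finset.univ.filter (fun j => δ ≤ j), y j • g j := by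
    intro z hz
    rw [hI] at hz
    refine Submodule.smul_induction_on hz ?_ ?_
    · intro r hr w hw
      induction hr using Submodule.span_induction with
      | mem r hr =>
        obtain ⟨j, hj, rfl⟩ := hr
        refine ⟨fun k => if k = j then w else 0, fun k => ?_, ?_⟩
        · dsimp only; split_ifs
          · exact hw
          · exact N.zero_mem
        · have hj' : δ ≤ j := hj
          simp [Finset.sum_ite_eq', hj']
      | zero => exact ⟨0, fun _ => N.zero_mem, by simp⟩
      | add a b _ _ ha hb =>
        obtain ⟨g, hg, e⟩ := ha
        obtain ⟨g', hg', e'⟩ := hb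
        exact ⟨g + g', fun j => N.add_mem (hg j) (hg' j), by
          rw [add_smul, e, e', ← Finset.sum_add_distrib]; simp⟩
      | smul a b _ ha =>
        obtain ⟨g, hg, e⟩ := ha
        exact ⟨a • g, fun j => N.smul_mem _ (hg j), by
          rw [smul_assoc, e, Finset.smul_sum]
          exact Finset.sum_congr rfl fun j _ => smul_comm _ _ _⟩
    · rintro a b ⟨g, hg, e⟩ ⟨g', hg', e'⟩
      exact ⟨g + g', fun j => N.add_mem (hg j) (hg' j), by
          rw [e, e', ← Finset.sum_add_distrib]; simp⟩
  obtain ⟨g, hg, e⟩ := h5 m h2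
  refine ⟨fun j => decompose ℒ (g j) (n, u - d j),
    fun j => ⟨hgr _ (hg j) _, (decompose ℒ (g j) (n, u - d j)).2⟩, ?_⟩
  conv_lhs => rw [← decompose_of_mem_same ℒ hm, e, vnr_dec_sum]
  refine Finset.sum_congr rfl fun j _ => ?_
  have := vnr_dec_hsmul 𝒯 ℒ hsmul (y j) _ (hy j) (g j) (n, u - d j)
  rw [← this]
  rw [Prod.mk_add_mk, add_comm 1 n, add_sub_cancel]

/-- finiteness of primes that are annihilators over a subring -/
theorem vnr_finite [IsNoetherianRing T] [Module.Finite T L] (R : Subring T) :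
    {p : Ideal R | p.IsPrime ∧ ∃ m : L, ∀ r : R, r ∈ p ↔ (r : T) • m = 0}.Finite := by
  refine ((associatedPrimes.finite T L).image (fun q => q.comap R.subtype)).subset ?_
  rintro p ⟨hp, m, hm⟩
  let S : Set (Ideal T) := {q | ∃ m' : L, (∀ t : T, t ∈ q ↔ t • m' = 0) ∧
    ∀ r : R, r ∈ p ↔ (r : T) • m' = 0}
  have hS : S.Nonempty := ⟨LinearMap.ker (LinearMap.toSpanSingleton T L m), m,
    fun t => by simp, hm⟩
  obtain ⟨q, ⟨m', hq, hm'⟩, hmax⟩ := set_has_maximal_iff_noetherian.2 ‹IsNoetherianRing T› S hS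
  have hmul : ∀ b : T, (∀ r : R, r ∈ p ↔ (r : T) • b • m' = 0) → 
      ∀ a, a * b ∈ q → a ∈ q := by
    intro b hb a hab
    have hS' : LinearMap.ker (LinearMap.toSpanSingleton T L (b • m')) ∈ S :=
      ⟨b • m', fun t => by simp, hb⟩
    have hle : q ≤ LinearMap.ker (LinearMap.toSpanSingleton T L (b • m')) := by
      intro t ht
      simp only [LinearMap.mem_ker, LinearMap.toSpanSingleton_apply]
      rw [smul_comm, (hq t).1 ht, smul_zero]
    have heq := eq_of_le_of_not_lt hle (hmax _ hS')
    rw [heq]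
    simp only [LinearMap.mem_ker, LinearMap.toSpanSingleton_apply]
    rw [← mul_smul]; exact (hq _).1 hab
  have hprime : Ideal.IsPrime q := by
    refine ⟨fun h => ?_, fun {a b} hab => ?_⟩
    · apply hp.ne_top
      rw [Ideal.eq_top_iff_one, hm']
      have : (1 : T) ∈ q := by rw [h]; trivial
      simpa using (hq 1).1 this
    · by_contra! hcon
      obtain ⟨ha, hb⟩ := hcon
      by_cases h : ∀ r : R, r ∈ p ↔ (r : T) • b • m' = 0
      · exact ha (hmul b h a hab)
      · push Not at h
        obtain ⟨r, h | h⟩ := h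
        · apply h.2
          rw [smul_comm, (hm' r).1 h.1, smul_zero]
        · apply hb
          refine hmul (r : T) (fun r' => ?_) b ?_
          · rw [← mul_smul]
            have := hm' (r' * r)
            rw [Subring.coe_mul] at this
            rw [← this]
            exact ⟨fun h' => p.mul_mem_right _ h', fun h' => (hp.mem_or_mem h').resolve_right h.1⟩
          · rw [hq, mul_comm, mul_smul]; exact h.2
  refine ⟨q, ⟨hprime, m', ?_⟩, ?_⟩
  · rw [show (⊥ : Submodule T L).colon {m'} = q by
      ext t
      rw [hq, Submodule.mem_colon_singleton]; simp]
    exact hprime.radical.symm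
  · ext r
    rw [hm', Ideal.mem_comap, hq]; rfl

theorem vnr_desc_v (hsmul : ∀ (i j : ℤ × ℤ), ∀ t ∈ 𝒯 i, ∀ m ∈ ℒ j, t • m ∈ ℒ (i + j))
    [IsNoetherianRing T] [Module.Finite T L]
    {c : ℕ} (y : Fin c → T) (d : Fin c → ℤ) (hy : ∀ j, y j ∈ 𝒯 (1, d j))
    (hdmono : Monotone d)
    (hY : ∀ t : T, ∀ i : ℤ × ℤ,
      (decompose 𝒯 t i : T) ∈ (Ideal.span (Set.range y)) ^ i.1.toNat)
    (δ : Fin c)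
    (hδmin : ∀ j : Fin c, j < δ → y j ∈ ((⊤ : Submodule T L).annihilator).radical)
    (R : Subring T) (hR : ∀ r ∈ R, ∀ i, (decompose 𝒯 r i : T) ∈ R) :
    ∃ n1 : ℤ, ∀ n ≥ n1, ∀ u : ℤ,
      (∃ m ∈ ℒ (n + 1, u), ∃ p : Ideal R, p.IsPrime ∧ ∀ r : R, r ∈ p ↔ (r : T) • m = 0) →
      ∃ D' ≥ d δ, ∃ m ∈ ℒ (n, u - D'), ∃ p : Ideal R, p.IsPrime ∧
        ∀ r : R, r ∈ p ↔ (r : T) • m = 0 := by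
  classical
  set F : Set (Ideal R) := {p : Ideal R | p.IsPrime ∧ ∃ i, ∃ m ∈ ℒ i,
    ∀ r : R, r ∈ p ↔ (r : T) • m = 0} with hF
  have hfin : F.Finite := (vnr_finite (L := L) R).subset (by
    rintro p ⟨hp, i, m, -, h⟩; exact ⟨hp, m, h⟩)
  have hex : ∀ p : Ideal R, ∃ n1 : ℤ, p ∈ F → ∀ n ≥ n1, ∀ u : ℤ, ∀ m ∈ ℒ (n + 1, u),
      (∀ r : R, r ∈ p ↔ (r : T) • m = 0) → ∃ D' ≥ d δ, ∃ m ∈ ℒ (n, u - D'),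
        ∀ r : R, r ∈ p ↔ (r : T) • m = 0 := by
    intro p
    by_cases hp : p ∈ F
    swap
    · exact ⟨0, fun h => absurd h hp⟩
    obtain ⟨hprime, i0, m0, hm0, hpm0⟩ := hp
    let N : Submodule T L :=
      { carrier := {m | ∀ r : R, r ∈ p → (r : T) • m = 0}
        add_mem' := fun {a b} ha hb r hr => by rw [smul_add, ha r hr, hb r hr, add_zero]
        zero_mem' := fun r _ => smul_zero _
        smul_mem' := fun t m hm r hr => by rw [smul_comm, hm r hr, smul_zero] }
    have hgr : ∀ m ∈ N, ∀ i, (decompose ℒ m i : L) ∈ N := by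
      intro m hm i r hr
      have hcomp : ∀ a, (⟨decompose 𝒯 (r : T) a, hR r r.2 a⟩ : R) ∈ p := by
        intro a
        rw [hpm0]
        simp only
        rw [← vnr_dec_smulh 𝒯 ℒ hsmul (r : T) a m0 i0 hm0, (hpm0 r).1 hr]
        simp
      rw [← sum_support_decompose 𝒯 (r : T), Finset.sum_smul]
      refine Finset.sum_eq_zero fun a _ => ?_
      rw [← vnr_dec_hsmul 𝒯 ℒ hsmul _ a (decompose 𝒯 (r : T) a).2 m i]
      have := hm _ (hcomp a)
      simp only at this
      rw [this]; simp
    obtain ⟨n1, hn1⟩ := vnr_desc 𝒯 ℒ hsmul y d hy hY δ hδmin N hgr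
    refine ⟨n1, fun _ n hn u m hm hpm => ?_⟩
    obtain ⟨g, hg, e⟩ := hn1 n hn u m hm (fun r hr => (hpm r).1 hr)
    by_cases hall : ∀ j, δ ≤ j → ∃ s : R, s ∉ p ∧ (s : T) • g j = 0
    · exfalso
      choose! s hs1 hs2 using hall
      set P : R := ∏ j ∈ Finset.univ.filter (fun j => δ ≤ j), s j with hP
      have h1 : P ∈ p := by
        rw [hpm, e, Finset.smul_sum]
        refine Finset.sum_eq_zero fun j hj => ?_
        rw [smul_comm]
        obtain ⟨w, hw⟩ := Finset.dvd_prod_of_mem s hj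
        rw [hP, hw, mul_comm, Subring.coe_mul, mul_smul, hs2 j (Finset.mem_filter.1 hj).2]
        simp
      rw [hP, hprime.prod_mem_iff] at h1
      obtain ⟨j, hj, h⟩ := h1
      exact hs1 j (Finset.mem_filter.1 hj).2 h
    · push Not at hall
      obtain ⟨j, hj, h⟩ := hall
      exact ⟨d j, hdmono hj, g j, (hg j).2, fun r => ⟨fun hr => (hg j).1 r hr, fun hr => by
        by_contra hc; exact h r hc hr⟩⟩
  choose n1 hn1 using hex
  obtain ⟨B, hB⟩ := (hfin.image n1).bddAbove
  refine ⟨B, fun n hn u ⟨m, hm, p, hp, hpm⟩ => ?_⟩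
  have hpF : p ∈ F := ⟨hp, _, m, hm, hpm⟩
  obtain ⟨D', hD', m', hm', h⟩ := hn1 p hpF n ((hB ⟨p, hpF, rfl⟩).trans hn) u m hm hpm
  exact ⟨D', hD', m', hm', p, hp, h⟩

theorem vnr_up (hsmul : ∀ (i j : ℤ × ℤ), ∀ t ∈ 𝒯 i, ∀ m ∈ ℒ j, t • m ∈ ℒ (i + j))
    [IsNoetherianRing T] [Module.Finite T L] (z : T) (e : ℤ) (hz : z ∈ 𝒯 (1, e))
    (hzr : z ∉ ((⊤ : Submodule T L).annihilator).radical) (R : Subring T) :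
    ∃ C n1 : ℤ, ∀ n ≥ n1, ∃ m ∈ ℒ (n, e * n + C), ∃ p : Ideal R, p.IsPrime ∧
        ∀ r : R, r ∈ p ↔ (r : T) • m = 0 := by
  classical
  -- a homogeneous element not killed by powers of z
  obtain ⟨i0, m0, hm0, hne⟩ : ∃ i0, ∃ m0 ∈ ℒ i0, ∀ k : ℕ, z ^ k • m0 ≠ 0 := by
    by_contra! hcon
    have h1 : ∀ m : L, ∃ k : ℕ, z ^ k • m = 0 := by
      intro m
      choose k hk using fun i => hcon i _ (decompose ℒ m i).2
      refine ⟨(decompose ℒ m).support.sup k, ?_⟩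
      generalize hK : (decompose ℒ m).support.sup k = K
      rw [← sum_support_decompose ℒ m, Finset.smul_sum]
      refine Finset.sum_eq_zero fun i hi => ?_
      obtain ⟨w, hw⟩ := pow_dvd_pow z (Finset.le_sup (f := k) hi)
      rw [← hK, hw, mul_comm, mul_smul, hk, smul_zero]
    obtain ⟨G, hG⟩ := (Module.Finite.fg_top : (⊤ : Submodule T L).FG)
    choose k hk using h1
    apply hzr
    refine ⟨G.sup k, ?_⟩
    rw [← hG, Submodule.mem_annihilator_span]
    rintro ⟨g, hg⟩
    obtain ⟨w, hw⟩ := pow_dvd_pow z (Finset.le_sup (f := k) hg)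
    simp only
    rw [hw, mul_comm, mul_smul, hk, smul_zero]
  have hzk : ∀ k : ℕ, z ^ k ∈ 𝒯 (k, e * k) := by
    intro k
    have := SetLike.pow_mem_graded k hz
    convert this using 2
    simp [mul_comm]
  -- the stable annihilator
  let I : ℕ →o Ideal T :=
    ⟨fun k => LinearMap.ker (LinearMap.toSpanSingleton T L (z ^ k • m0)), by
      refine monotone_nat_of_le_succ fun k t ht => ?_
      simp only [LinearMap.mem_ker, LinearMap.toSpanSingleton_apply] at ht ⊢
      rw [pow_succ', mul_smul, smul_comm, ht, smul_zero]⟩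
  have hI : ∀ k t, t ∈ I k ↔ t • z ^ k • m0 = 0 := fun k t => by
    simp [I]
  obtain ⟨k0, hk0⟩ := monotone_stabilizes_iff_noetherian.2 ‹IsNoetherianRing T› I
  let S : Set (Ideal T) := {q | ∃ i, ∃ t ∈ 𝒯 i, t ∉ I k0 ∧ ∀ s, s ∈ q ↔ s * t ∈ I k0}
  have hcol : ∀ t : T, ∀ s, s ∈ LinearMap.ker (LinearMap.toSpanSingleton T L (t • z ^ k0 • m0)) ↔
      s * t ∈ I k0 := fun t s => by
    rw [hI, mul_smul]; simp
  have hS : S.Nonempty := ⟨_, 0, 1, SetLike.GradedOne.one_mem, by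
    rw [hI, one_smul]; exact hne k0, hcol 1⟩
  obtain ⟨q, ⟨i1, t, ht, htI, hq⟩, hmax⟩ :=
    set_has_maximal_iff_noetherian.2 ‹IsNoetherianRing T› S hS
  have hq' : ∀ s, s ∈ q ↔ s • t • z ^ k0 • m0 = 0 := fun s => by
    rw [hq, hI, mul_smul]
  have hhom : t • z ^ k0 • m0 ∈ ℒ (i1 + (((k0 : ℤ), e * (k0 : ℤ)) + i0)) :=
    hsmul _ _ _ ht _ (hsmul _ _ _ (hzk k0) _ hm0)
  have hprime : Ideal.IsPrime q := by
    refine vnr_prime 𝒯 q ?_ ?_ ?_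
    · intro s hs i
      rw [hq', ← vnr_dec_smulh 𝒯 ℒ hsmul s i _ _ hhom, (hq' s).1 hs]
      simp
    · intro h
      apply htI
      have : (1 : T) ∈ q := by rw [h]; trivial
      simpa using (hq 1).1 this
    · intro i j a ha b hb hab
      by_contra! hcon
      obtain ⟨h1, h2⟩ := hcon
      have hmem : LinearMap.ker (LinearMap.toSpanSingleton T L ((b * t) • z ^ k0 • m0)) ∈ S :=
        ⟨_, b * t, SetLike.GradedMul.mul_mem hb ht, fun h => h2 ((hq b).2 h), hcol _⟩
      have hle : q ≤ LinearMap.ker (LinearMap.toSpanSingleton T L ((b * t) • z ^ k0 • m0)) := by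
        intro s hs
        rw [hcol, mul_left_comm]
        exact Ideal.mul_mem_left _ _ ((hq s).1 hs)
      have heq := eq_of_le_of_not_lt hle (hmax _ hmem)
      apply h1
      rw [heq, hcol, ← mul_assoc]
      exact (hq _).1 hab
  refine ⟨i1.2 + i0.2 - e * (i1.1 + i0.1), i1.1 + i0.1 + k0, fun n hn => ?_⟩
  obtain ⟨k, hk⟩ : ∃ k : ℕ, n = i1.1 + i0.1 + k := ⟨(n - i1.1 - i0.1).toNat, by omega⟩
  refine ⟨t • z ^ k • m0, ?_, Ideal.comap R.subtype q, Ideal.IsPrime.comap _, fun r => ?_⟩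
  · have := hsmul _ _ _ ht _ (hsmul _ _ _ (hzk k) _ hm0)
    convert this using 2
    ext
    · simp [hk]; ring
    · simp [hk]; ring
  · rw [Ideal.mem_comap, hq, hk0 k (by omega), hI, mul_smul]
    rfl

theorem vnr_R (R : Subring T) (hRsub : R = Subring.closure {t : T | ∃ l : ℤ, t ∈ 𝒯 (0, l)}) :
    ∀ r ∈ R, ∀ i, (decompose 𝒯 r i : T) ∈ R := by
  intro r hr
  have hhom : ∀ s ∈ R, ∀ j, s ∈ 𝒯 j → ∀ i, (decompose 𝒯 s i : T) ∈ R := by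
    intro s hs j hj i
    by_cases h : j = i
    · subst h; rwa [decompose_of_mem_same 𝒯 hj]
    · rw [decompose_of_mem_ne 𝒯 hj h]; exact R.zero_mem
  have hr' := hr
  rw [hRsub] at hr'
  induction hr' using Subring.closure_induction with
  | mem s hs =>
    obtain ⟨l, hl⟩ := hs
    exact hhom s hr _ hl
  | zero => exact hhom 0 hr 0 (AddSubgroup.zero_mem _)
  | one => exact hhom 1 hr 0 SetLike.GradedOne.one_mem
  | add a b h1 h2 ha hb =>
    intro i; rw [vnr_dec_add]
    exact R.add_mem (ha (hRsub ▸ h1) i) (hb (hRsub ▸ h2) i)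
  | neg a h1 ha =>
    intro i
    rw [decompose_neg]
    exact R.neg_mem (ha (hRsub ▸ h1) i)
  | mul a b h1 h2 ha hb =>
    intro i
    exact vnr_dec_smul 𝒯 𝒯 (fun i j t ht m hm => SetLike.GradedMul.mul_mem ht hm)
      R.toAddSubgroup a b i
      (fun a' b' _ => R.mul_mem (ha (hRsub ▸ h1) a') (hb (hRsub ▸ h2) b'))

end

/-- In the bigraded setup (Noetherian (ℕ×ℕ)-graded ring `T`, generated over
`R₀` by `x i` of degrees `(0, f i)` and `y j` of degrees `(1, d j)`, `d` monotone, and a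
finitely generated (ℤ×ℤ)-graded `T`-module `ℒ`), assume `ℒ_{(n,*)} ≠ 0` for all sufficiently
large `n`, let `δ` be the least index with `y δ ∉ √(Ann_T ℒ)`, and let `R := ⨁_l T_{(0,l)}`
(as a subring of `T`).  Then there is `b₂ ∈ ℤ` with `v(ℒ_{(n,*)}) = d δ * n + b₂` for all
sufficiently large `n`; in particular `v(ℒ_{(n,*)})` is eventually linear in `n` with the
same leading coefficient `d δ` as `indeg(ℒ_{(n,*)})`.  Here
`v(ℒ_{(n,*)})` is the least `u` such that some homogeneous `m ∈ ℒ_{(n,u)}` has `(0 :_R m)`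
a prime ideal of `R`, and `indeg(ℒ_{(n,*)}) = inf{u | ℒ_{(n,u)} ≠ 0}`. -/
theorem v_number_row_eventually_linear
    {R₀ T L : Type*} [CommRing R₀] [IsNoetherianRing R₀] [CommRing T] [Algebra R₀ T]
    [IsNoetherianRing T] [AddCommGroup L] [Module T L] [Module.Finite T L]
    (𝒯 : ℤ × ℤ → AddSubgroup T) [GradedRing 𝒯]
    (ℒ : ℤ × ℤ → AddSubgroup L) [DirectSum.Decomposition ℒ]
    (hsmul : ∀ (i j : ℤ × ℤ), ∀ t ∈ 𝒯 i, ∀ m ∈ ℒ j, t • m ∈ ℒ (i + j))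
    (hTnn : ∀ i : ℤ × ℤ, i.1 < 0 ∨ i.2 < 0 → 𝒯 i = ⊥)
    (halg : ∀ r : R₀, algebraMap R₀ T r ∈ 𝒯 (0, 0))
    (dd c : ℕ) (x : Fin dd → T) (y : Fin c → T)
    (f : Fin dd → ℤ) (d : Fin c → ℤ) (hdmono : Monotone d)
    (hx : ∀ i, x i ∈ 𝒯 (0, f i)) (hy : ∀ j, y j ∈ 𝒯 (1, d j))
    (hgen : Algebra.adjoin R₀ (Set.range x ∪ Set.range y) = ⊤)
    (hnz : ∃ n₀ : ℤ, ∀ n ≥ n₀, ∃ l : ℤ, ℒ (n, l) ≠ ⊥)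
    (δ : Fin c) (hδ : y δ ∉ ((⊤ : Submodule T L).annihilator).radical)
    (hδmin : ∀ j : Fin c, j < δ → y j ∈ ((⊤ : Submodule T L).annihilator).radical)
    (Rsub : Subring T) (hRsub : Rsub = Subring.closure {t : T | ∃ l : ℤ, t ∈ 𝒯 (0, l)}) :
    ∃ b₁ b₂ : ℤ, ∃ n₀ : ℤ, ∀ n ≥ n₀,
      sInf {u : ℤ | ℒ (n, u) ≠ ⊥} = d δ * n + b₁ ∧
      sInf {u : ℤ | ∃ m ∈ ℒ (n, u), ∃ p : Ideal Rsub, p.IsPrime ∧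
          ∀ r : Rsub, r ∈ p ↔ (r : T) • m = 0} = d δ * n + b₂ := by
  have hY := vnr_Tpow 𝒯 halg x y f d hx hy hgen
  obtain ⟨u0, hu0⟩ := vnr_low 𝒯 ℒ hsmul hTnn
  obtain ⟨C, n1, hup⟩ := vnr_up 𝒯 ℒ hsmul (y δ) (d δ) (hy δ) hδ Rsub
  obtain ⟨n2, hdv⟩ := vnr_desc_v 𝒯 ℒ hsmul y d hy hdmono hY δ hδmin Rsub
    (vnr_R 𝒯 Rsub hRsub)
  obtain ⟨n3, hd⟩ := vnr_desc 𝒯 ℒ hsmul y d hy hY δ hδmin ⊤ (fun _ _ _ => trivial)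
  have hne0 : ∀ m : L, (∃ p : Ideal Rsub, p.IsPrime ∧ ∀ r : Rsub, r ∈ p ↔ (r : T) • m = 0) →
      m ≠ 0 := by
    rintro _ ⟨p, hp, h⟩ rfl
    exact hp.ne_top ((Ideal.eq_top_iff_one p).2 ((h 1).2 (smul_zero _)))
  obtain ⟨b₁, N₁, h₁⟩ := vnr_comb (fun n u => ℒ (n, u) ≠ ⊥) (d δ) u0 C (max n1 n3)
    (by
      intro n hn u h
      obtain ⟨m, hm, hm0⟩ := AddSubgroup.ne_bot_iff_exists_ne_zero.1 h |>.elim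
        (fun a ha => (⟨a.1, a.2, fun h0 => ha (Subtype.ext h0)⟩ :
          ∃ m, m ∈ ℒ (n + 1, u) ∧ m ≠ 0))
      obtain ⟨g, hg, e⟩ := hd n (le_trans (le_max_right _ _) hn) u m hm trivial
      obtain ⟨j, hj, hj0⟩ := Finset.exists_ne_zero_of_sum_ne_zero (e ▸ hm0)
      refine ⟨d j, hdmono (Finset.mem_filter.1 hj).2, fun hbot => hj0 ?_⟩
      have := (hg j).2
      rw [hbot, AddSubgroup.mem_bot] at this
      rw [this, smul_zero])
    (by
      intro n u h
      by_contra hlt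
      apply h
      rw [eq_bot_iff]
      intro m hm
      by_contra hm0
      exact hlt (hu0 n u m hm (fun h0 => hm0 (AddSubgroup.mem_bot.2 h0))))
    (by
      intro n hn
      obtain ⟨m, hm, hp⟩ := hup n (le_trans (le_max_left _ _) hn)
      refine ⟨_, fun hbot => hne0 m hp ?_, le_rfl⟩
      rw [hbot] at hm
      exact AddSubgroup.mem_bot.1 hm)
  obtain ⟨b₂, N₂, h₂⟩ := vnr_comb (fun n u => ∃ m ∈ ℒ (n, u), ∃ p : Ideal Rsub, p.IsPrime ∧
          ∀ r : Rsub, r ∈ p ↔ (r : T) • m = 0) (d δ) u0 C (max n1 n2)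
    (fun n hn u h => hdv n (le_trans (le_max_right _ _) hn) u h)
    (fun n u ⟨m, hm, hp⟩ => hu0 n u m hm (hne0 m hp))
    (fun n hn => ⟨_, hup n (le_trans (le_max_left _ _) hn), le_rfl⟩)
  exact ⟨b₁, b₂, max N₁ N₂, fun n hn =>
    ⟨h₁ n (le_trans (le_max_left _ _) hn), h₂ n (le_trans (le_max_right _ _) hn)⟩⟩
end

section
/- Let p be a prime ideal of R such that p ∈ Ass_R(I^n M / I^n N) for all sufficiently large n. Then there exist a ∈ {d_1, …, d_c} and b ∈ ℤ such that v_p(I^n M / I^n N) = a·n + b for all sufficiently large n. -/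
namespace VNum

open DirectSum

/-- Strong induction on integers for predicates true far to the left. -/
lemma int_strong (P : ℤ → Prop) (t0 : ℤ) (h0 : ∀ t < t0, P t)
    (h1 : ∀ t, (∀ t' < t, P t') → P t) : ∀ t, P t := by
  have key : ∀ n : ℕ, ∀ t < t0 + n, P t := by
    intro n
    induction n with
    | zero => intro t ht; exact h0 t (by simpa using ht)
    | succ n ih =>
      intro t ht
      refine h1 t (fun t' ht' => ih t' ?_)
      push_cast at ht
      omega
  intro t
  exact key (t - t0 + 1).toNat t (by omega)

section Graded

variable {R M : Type*} [CommRing R] [AddCommGroup M] [Module R M]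
    (𝒜 : ℤ → AddSubgroup R) (ℳ : ℤ → AddSubgroup M)
    [GradedRing 𝒜] [DirectSum.Decomposition ℳ]

/-- Elements killed modulo `W` by something outside `p`. -/
def KK (p : Ideal R) (hp : p.IsPrime) (W : Submodule R M) : Submodule R M where
  carrier := {x | ∃ s, s ∉ p ∧ s • x ∈ W}
  zero_mem' := ⟨1, fun h => hp.ne_top ((Ideal.eq_top_iff_one p).2 h), by simp⟩
  add_mem' := by
    rintro a b ⟨s, hs, hsa⟩ ⟨t, ht, htb⟩
    refine ⟨s * t, fun h => (hp.mem_or_mem h).elim hs ht, ?_⟩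
    rw [smul_add]
    refine W.add_mem ?_ ?_
    · rw [mul_comm, mul_smul]; exact W.smul_mem _ hsa
    · rw [mul_smul]; exact W.smul_mem _ htb
  smul_mem' := by
    rintro r a ⟨s, hs, hsa⟩
    exact ⟨s, hs, by rw [smul_comm]; exact W.smul_mem _ hsa⟩

lemma mem_KK {p : Ideal R} {hp : p.IsPrime} {W : Submodule R M} {x : M} :
    x ∈ KK p hp W ↔ ∃ s, s ∉ p ∧ s • x ∈ W := Iff.rfl

lemma good_iff (p : Ideal R) (hp : p.IsPrime) (W : Submodule R M) (x : M) :
    (∀ r : R, r ∈ p ↔ r • x ∈ W) ↔ (∀ r ∈ p, r • x ∈ W) ∧ x ∉ KK p hp W := by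
  constructor
  · intro h
    refine ⟨fun r hr => (h r).1 hr, ?_⟩
    rintro ⟨s, hs, hsx⟩
    exact hs ((h s).2 hsx)
  · rintro ⟨h1, h2⟩ r
    refine ⟨h1 r, fun hr => ?_⟩
    by_contra hrp
    exact h2 ⟨r, hrp, hr⟩

/-- Elements killed modulo `W` by a power of `f`. -/
def PW (f : R) (W : Submodule R M) : Submodule R M where
  carrier := {x | ∃ k : ℕ, f ^ k • x ∈ W}
  zero_mem' := ⟨0, by simp⟩
  add_mem' := by
    rintro a b ⟨s, hsa⟩ ⟨t, htb⟩
    refine ⟨s + t, ?_⟩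
    rw [smul_add, pow_add]
    refine W.add_mem ?_ ?_
    · rw [mul_comm, mul_smul]; exact W.smul_mem _ hsa
    · rw [mul_smul]; exact W.smul_mem _ htb
  smul_mem' := by
    rintro r a ⟨s, hsa⟩
    exact ⟨s, by rw [smul_comm]; exact W.smul_mem _ hsa⟩

/-- The degree `u` component. -/
def cmp (x : M) (u : ℤ) : M := (decompose ℳ x u : M)

lemma cmp_mem (x : M) (u : ℤ) : cmp ℳ x u ∈ ℳ u := (decompose ℳ x u).2

lemma cmp_zero (u : ℤ) : cmp ℳ (0 : M) u = 0 := by simp [cmp]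

lemma cmp_add (x z : M) (u : ℤ) : cmp ℳ (x + z) u = cmp ℳ x u + cmp ℳ z u := by
  simp [cmp]

lemma cmp_sum {ι : Type*} (s : Finset ι) (f : ι → M) (u : ℤ) :
    cmp ℳ (∑ i ∈ s, f i) u = ∑ i ∈ s, cmp ℳ (f i) u := by
  classical
  induction s using Finset.induction_on with
  | empty => simp [cmp_zero]
  | insert a s ha ih => rw [Finset.sum_insert ha, Finset.sum_insert ha, cmp_add, ih]

lemma cmp_same {x : M} {u : ℤ} (h : x ∈ ℳ u) : cmp ℳ x u = x :=
  decompose_of_mem_same ℳ h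

lemma cmp_ne {x : M} {u v : ℤ} (h : x ∈ ℳ u) (huv : u ≠ v) : cmp ℳ x v = 0 :=
  decompose_of_mem_ne ℳ h huv

lemma exists_sum (x : M) : ∃ s : Finset ℤ, (∀ u ∉ s, cmp ℳ x u = 0) ∧
    x = ∑ u ∈ s, cmp ℳ x u := by
  classical
  refine ⟨(decompose ℳ x).support, ?_, (sum_support_decompose ℳ x).symm⟩
  intro u hu
  simpa [cmp] using hu

lemma exists_lower (x : M) : ∃ t0 : ℤ, ∀ t < t0, cmp ℳ x t = 0 := by
  obtain ⟨s, hs, -⟩ := exists_sum ℳ x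
  obtain ⟨b, hb⟩ := s.bddBelow
  refine ⟨b, fun t ht => hs t fun h => ?_⟩
  exact absurd (hb h) (not_le.2 ht)

variable {ℳ} in
lemma mem_of_cmp (W : Submodule R M) (x : M) (h : ∀ u, cmp ℳ x u ∈ W) : x ∈ W := by
  obtain ⟨s, -, hs⟩ := exists_sum ℳ x
  rw [hs]
  exact W.sum_mem fun u _ => h u

lemma cmp_smul
    (hsmul : ∀ (i j : ℤ), ∀ r ∈ 𝒜 i, ∀ x ∈ ℳ j, r • x ∈ ℳ (i + j))
    {i : ℤ} {r : R} (hr : r ∈ 𝒜 i) (x : M) (u : ℤ) :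
    cmp ℳ (r • x) u = r • cmp ℳ x (u - i) := by
  obtain ⟨s, hs0, hs⟩ := exists_sum ℳ x
  have h1 : r • x = ∑ v ∈ s, r • cmp ℳ x v := by
    rw [← Finset.smul_sum, ← hs]
  rw [h1, cmp_sum]
  by_cases hm : u - i ∈ s
  · rw [Finset.sum_eq_single_of_mem _ hm]
    · apply cmp_same
      have := hsmul i (u - i) r hr _ (cmp_mem ℳ x (u - i))
      simpa using this
    · intro v _ hv
      exact cmp_ne ℳ (hsmul i v r hr _ (cmp_mem ℳ x v)) (by omega)
  · rw [hs0 _ hm, smul_zero]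
    refine Finset.sum_eq_zero fun v hv => ?_
    refine cmp_ne ℳ (hsmul i v r hr _ (cmp_mem ℳ x v)) ?_
    rintro rfl
    apply hm
    simpa using hv

lemma cmp_smul_sum
    (hsmul : ∀ (i j : ℤ), ∀ r ∈ 𝒜 i, ∀ x ∈ ℳ j, r • x ∈ ℳ (i + j))
    (r : R) : ∃ s : Finset ℤ, (∀ i ∉ s, cmp 𝒜 r i = 0) ∧ ∀ (x : M) (u : ℤ),
    cmp ℳ (r • x) u = ∑ i ∈ s, cmp 𝒜 r i • cmp ℳ x (u - i) := by
  obtain ⟨s, hs0, hs⟩ := exists_sum 𝒜 r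
  refine ⟨s, hs0, fun x u => ?_⟩
  conv_lhs => rw [hs, Finset.sum_smul, cmp_sum]
  refine Finset.sum_congr rfl fun i _ => ?_
  exact cmp_smul 𝒜 ℳ hsmul (cmp_mem 𝒜 r i) x u

lemma smul_homog
    (hsmul : ∀ (i j : ℤ), ∀ r ∈ 𝒜 i, ∀ x ∈ ℳ j, r • x ∈ ℳ (i + j))
    (I : Ideal R) (hI : ∀ r ∈ I, ∀ i, cmp 𝒜 r i ∈ I) (W : Submodule R M)
    (hW : ∀ x ∈ W, ∀ u, cmp ℳ x u ∈ W) :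
    ∀ x ∈ I • W, ∀ u, cmp ℳ x u ∈ I • W := by
  intro x hx u
  refine Submodule.smul_induction_on hx (fun r hr w hw => ?_) (fun a b ha hb => ?_)
  · obtain ⟨s, -, hs⟩ := cmp_smul_sum 𝒜 ℳ hsmul r
    rw [hs]
    exact Submodule.sum_mem _ fun i _ => Submodule.smul_mem_smul (hI r hr i) (hW w hw _)
  · rw [cmp_add]; exact Submodule.add_mem _ ha hb

lemma pow_smul_homog
    (hsmul : ∀ (i j : ℤ), ∀ r ∈ 𝒜 i, ∀ x ∈ ℳ j, r • x ∈ ℳ (i + j))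
    (I : Ideal R) (hI : ∀ r ∈ I, ∀ i, cmp 𝒜 r i ∈ I) (W : Submodule R M)
    (hW : ∀ x ∈ W, ∀ u, cmp ℳ x u ∈ W) (n : ℕ) :
    ∀ x ∈ I ^ n • W, ∀ u, cmp ℳ x u ∈ I ^ n • W := by
  induction n with
  | zero => simpa using hW
  | succ n ih =>
    have : I ^ (n + 1) • W = I • (I ^ n • W) := by rw [pow_succ', ← smul_smul]
    rw [this]
    exact smul_homog 𝒜 ℳ hsmul I hI _ ih

/-- The annihilating prime is homogeneous. -/
lemma prime_homog
    (hsmul : ∀ (i j : ℤ), ∀ r ∈ 𝒜 i, ∀ x ∈ ℳ j, r • x ∈ ℳ (i + j))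
    (p : Ideal R) (hp : p.IsPrime) (W : Submodule R M)
    (hW : ∀ x ∈ W, ∀ u, cmp ℳ x u ∈ W) (x : M) (hx : ∀ r : R, r ∈ p ↔ r • x ∈ W)
    (r : R) (hr : r ∈ p) : ∀ i, cmp 𝒜 r i ∈ p := by
  obtain ⟨i0, hi0⟩ := exists_lower 𝒜 r
  refine int_strong _ i0 (fun i hi => by rw [hi0 i hi]; exact p.zero_mem) ?_
  intro i ih
  have hall : ∀ t, cmp ℳ x t ∈ PW (cmp 𝒜 r i) W := by
    obtain ⟨t0, ht0⟩ := exists_lower ℳ x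
    refine int_strong _ t0 (fun t ht => by rw [ht0 t ht]; exact Submodule.zero_mem _) ?_
    intro t iht
    obtain ⟨s, hs0, hs⟩ := cmp_smul_sum 𝒜 ℳ hsmul r
    by_cases his : i ∈ s
    · have h1 : cmp ℳ (r • x) (i + t) ∈ W := hW _ ((hx r).1 hr) _
      rw [hs x, ← Finset.add_sum_erase s _ his] at h1
      have h2 : ∑ j ∈ s.erase i, cmp 𝒜 r j • cmp ℳ x (i + t - j) ∈ PW (cmp 𝒜 r i) W := by
        refine Submodule.sum_mem _ fun j hj => ?_
        rcases lt_or_gt_of_ne (Finset.ne_of_mem_erase hj) with h | h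
        · refine ⟨0, ?_⟩
          rw [pow_zero, one_smul]
          have := hW _ ((hx _).1 (ih j h)) (i + t)
          rwa [cmp_smul 𝒜 ℳ hsmul (cmp_mem 𝒜 r j)] at this
        · exact Submodule.smul_mem _ _ (iht _ (by omega))
      have h3 : cmp 𝒜 r i • cmp ℳ x (i + t - i) ∈ PW (cmp 𝒜 r i) W := by
        refine (Submodule.add_mem_iff_left _ h2).1 ⟨0, ?_⟩
        simpa using h1
      obtain ⟨k, hk⟩ := h3
      refine ⟨k + 1, ?_⟩
      rw [pow_succ, mul_smul]
      simpa using hk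
    · refine ⟨1, ?_⟩
      rw [hs0 i his]; simp
  obtain ⟨k, hk⟩ := mem_of_cmp _ x hall
  exact hp.mem_of_pow_mem k ((hx _).2 hk)

lemma exists_homog
    (hsmul : ∀ (i j : ℤ), ∀ r ∈ 𝒜 i, ∀ x ∈ ℳ j, r • x ∈ ℳ (i + j))
    (p : Ideal R) (hp : p.IsPrime) (W : Submodule R M)
    (hW : ∀ x ∈ W, ∀ u, cmp ℳ x u ∈ W) (V : Submodule R M)
    (hV : ∀ x ∈ V, ∀ u, cmp ℳ x u ∈ V)
    (x : M) (hxV : x ∈ V) (hx : ∀ r : R, r ∈ p ↔ r • x ∈ W) :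
    ∃ u, ∃ z ∈ ℳ u, z ∈ V ∧ (∀ r ∈ p, r • z ∈ W) ∧ z ∉ KK p hp W := by
  have h1 : ¬ ∀ t, cmp ℳ x t ∈ KK p hp W := fun h =>
    ((good_iff p hp W x).1 hx).2 (mem_of_cmp _ x h)
  push Not at h1
  obtain ⟨t, ht⟩ := h1
  refine ⟨t, cmp ℳ x t, cmp_mem ℳ x t, hV x hxV t, ?_, ht⟩
  intro r hr
  obtain ⟨s, -, hs⟩ := exists_sum 𝒜 r
  rw [hs, Finset.sum_smul]
  refine W.sum_mem fun i _ => ?_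
  have := hW _ ((hx _).1 (prime_homog 𝒜 ℳ hsmul p hp W hW x hx r hr i)) (i + t)
  rw [cmp_smul 𝒜 ℳ hsmul (cmp_mem 𝒜 r i)] at this
  simpa using this

lemma span_homog
    (hsmul : ∀ (i j : ℤ), ∀ r ∈ 𝒜 i, ∀ x ∈ ℳ j, r • x ∈ ℳ (i + j))
    (hA : ∀ i : ℤ, i < 0 → 𝒜 i = ⊥) (K : Submodule R M) (Z : Set M)
    (hZ : ∀ z ∈ Z, ∃ v, z ∈ ℳ v) (u : ℤ) (x : M) (hxu : x ∈ ℳ u)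
    (hxZ : x ∈ Submodule.span R Z) (hxK : x ∉ K) :
    ∃ z ∈ Z, z ∉ K ∧ ∃ v ≤ u, z ∈ ℳ v := by
  by_contra hcon
  push Not at hcon
  apply hxK
  have key : ∀ w ∈ Submodule.span R Z, ∀ v ≤ u, cmp ℳ w v ∈ K := by
    intro w hw
    induction hw using Submodule.span_induction with
    | mem z hz =>
      intro v hv
      by_cases hzK : z ∈ K
      · obtain ⟨v', hv'⟩ := hZ z hz
        by_cases h : v' = v
        · subst h; rwa [cmp_same ℳ hv']
        · rw [cmp_ne ℳ hv' h]; exact K.zero_mem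
      · obtain ⟨v', hv'⟩ := hZ z hz
        rw [cmp_ne ℳ hv']
        · exact K.zero_mem
        · rintro rfl
          exact hcon z hz hzK v' hv hv'
    | zero => intro v _; rw [cmp_zero]; exact K.zero_mem
    | add a b _ _ ha hb => intro v hv; rw [cmp_add]; exact K.add_mem (ha v hv) (hb v hv)
    | smul r a _ ha =>
      intro v hv
      obtain ⟨s, -, hs⟩ := cmp_smul_sum 𝒜 ℳ hsmul r
      rw [hs]
      refine K.sum_mem fun i _ => ?_
      by_cases hi : i < 0
      · have := cmp_mem 𝒜 r i
        rw [hA i hi, AddSubgroup.mem_bot] at this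
        rw [this, zero_smul]; exact K.zero_mem
      · exact K.smul_mem _ (ha _ (by omega))
  have := key x hxZ u le_rfl
  rwa [cmp_same ℳ hxu] at this

end Graded

section Noeth

variable {R M : Type*} [CommRing R] [AddCommGroup M] [Module R M]

lemma pow_span_le {c : ℕ} (y : Fin c → R) (k : ℕ) :
    (Ideal.span (Set.range y)) ^ k ≤
      Ideal.span {z | ∃ α : Fin c → ℕ, ∑ j, α j = k ∧ z = ∏ j, y j ^ α j} := by
  induction k with
  | zero =>
    rw [pow_zero, Ideal.one_eq_top, top_le_iff, Ideal.eq_top_iff_one]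
    exact Ideal.subset_span ⟨0, by simp, by simp⟩
  | succ k ih =>
    rw [pow_succ]
    refine (Ideal.mul_mono_left ih).trans ?_
    rw [Ideal.span_mul_span', Ideal.span_le]
    rintro _ ⟨_, ⟨α, hα, rfl⟩, _, ⟨j, rfl⟩, rfl⟩
    refine Ideal.subset_span ⟨α + Pi.single j 1, ?_, ?_⟩
    · simp [Finset.sum_add_distrib, hα]
    · simp only [Pi.add_apply, pow_add, Finset.prod_mul_distrib]
      congr 1
      rw [Finset.prod_eq_single j]
      · simp
      · intro i _ hi; simp [hi]
      · simp

lemma exists_finite [IsNoetherianRing R] [Module.Finite R M] (I J : Ideal R) (hJI : J ≤ I)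
    (m0 : ℕ) (hred : J * I ^ m0 = I ^ (m0 + 1)) {c : ℕ} (y : Fin c → R)
    (hJgen : J = Ideal.span (Set.range y)) (P : Set (ℕ × ℤ × M))
    (hP : ∀ t ∈ P, t.2.2 ∈ (I ^ t.1 • ⊤ : Submodule R M)) :
    ∃ T ⊆ P, T.Finite ∧ ∀ t ∈ P, t.2.2 ∈ Submodule.span R
      {z | ∃ q ∈ T, ∃ α : Fin c → ℕ, q.1 + ∑ j, α j = t.1 ∧ z = (∏ j, y j ^ α j) • q.2.2} := by
  classical
  let F : J.Filtration M :=
    { N := fun n => I ^ n • ⊤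
      mono := fun n => Submodule.smul_mono_left (Ideal.pow_le_pow_right (Nat.le_succ n))
      smul_le := fun n => by
        rw [smul_smul, pow_succ']
        exact Submodule.smul_mono_left (Ideal.mul_mono_left hJI) }
  have hst : F.Stable := by
    refine ⟨m0, fun n hn => ?_⟩
    change J • (I ^ n • (⊤ : Submodule R M)) = I ^ (n + 1) • ⊤
    rw [smul_smul]
    obtain ⟨k, rfl⟩ := Nat.exists_eq_add_of_le hn
    rw [pow_add, ← mul_assoc, hred, ← pow_add]
    congr 2; omega
  have hfg : F.submodule.FG :=
    (F.submodule_fg_iff_stable (fun i => IsNoetherian.noetherian _)).2 hst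
  let S : Set (PolynomialModule R M) := (fun t : ℕ × ℤ × M => PolynomialModule.single R t.1 t.2.2) '' P
  have hSle : Submodule.span (reesAlgebra J) S ≤ F.submodule := by
    rw [Submodule.span_le]
    rintro _ ⟨t, ht, rfl⟩ i
    rw [PolynomialModule.coeff_single, Finsupp.single_apply]
    split_ifs with h
    · rw [← h]; exact hP t ht
    · exact Submodule.zero_mem _
  have : IsNoetherian (reesAlgebra J) F.submodule := isNoetherian_of_fg_of_noetherian _ hfg
  have hSfg : (Submodule.span (reesAlgebra J) S).FG := isNoetherian_submodule.1 this _ hSle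
  obtain ⟨T', hT'S, hT'⟩ := (Submodule.fg_span_iff_fg_span_finset_subset S).1 hSfg
  obtain ⟨T, hTP, hTim⟩ := Finset.subset_set_image_iff.1 hT'S
  refine ⟨T, hTP, T.finite_toSet, fun t ht => ?_⟩
  have hmem : PolynomialModule.single R t.1 t.2.2 ∈ Submodule.span (reesAlgebra J) (T' : Set _) := by
    rw [← hT']; exact Submodule.subset_span ⟨t, ht, rfl⟩
  obtain ⟨l, hl⟩ := (Finsupp.mem_span_iff_linearCombination _ _ _).mp hmem
  replace hl := congr_arg (fun f : PolynomialModule R M => f.coeff t.1) hl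
  rw [PolynomialModule.coeff_single, Finsupp.single_apply, if_pos rfl] at hl
  rw [← hl, Finsupp.linearCombination_apply, PolynomialModule.coeff_finsuppSum, Finsupp.sum_apply]
  apply Submodule.sum_mem _ _
  rintro ⟨w, hw⟩ -
  have hw' := hw
  rw [← hTim, Finset.coe_image] at hw'
  obtain ⟨q, hq, rfl⟩ := hw'
  dsimp only
  rw [Subalgebra.smul_def, PolynomialModule.smul_single_apply]
  split_ifs with hle
  · have h1 := (l ⟨_, hw⟩).2 (t.1 - q.1)
    have h2 := pow_span_le y _ (hJgen.le.trans_eq rfl |> fun hle' => Ideal.pow_right_mono hle' _ h1)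
    dsimp only at h2
    generalize (Polynomial.coeff _ _ : R) = g at h2 ⊢
    induction h2 using Submodule.span_induction with
    | mem z hz =>
      obtain ⟨α, hα, rfl⟩ := hz
      exact Submodule.subset_span ⟨q, hq, α, by omega, rfl⟩
    | zero => rw [zero_smul]; exact Submodule.zero_mem _
    | add a b _ _ ha hb => rw [add_smul]; exact Submodule.add_mem _ ha hb
    | smul r a _ ha => rw [smul_assoc]; exact Submodule.smul_mem _ _ ha
  · exact Submodule.zero_mem _

end Noeth

section Comb

variable {M : Type*} {c : ℕ} (d : Fin c → ℤ) (Good : Set (ℕ × ℤ × M))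
  (A : Fin c → ℕ → (ℕ × ℤ × M) → Prop)

/-- Finite generation with divisibility control. -/
def FinGen : Prop := ∀ P ⊆ Good, ∃ T ⊆ P, T.Finite ∧ ∀ t ∈ P, ∃ q ∈ T, ∃ α : Fin c → ℕ,
  q.1 + ∑ j, α j = t.1 ∧ q.2.1 + ∑ j, (α j : ℤ) * d j ≤ t.2.1 ∧ ∀ j, ∀ k ≤ α j, A j k q

variable {d Good A}

lemma finGen_bound (h : FinGen d Good A) (P : Set (ℕ × ℤ × M)) (hP : P ⊆ Good) :
    ∃ T ⊆ P, T.Finite ∧ ∃ K : ℕ, ∀ t ∈ P, ∃ q ∈ T, ∃ α : Fin c → ℕ,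
  q.1 + ∑ j, α j = t.1 ∧ q.2.1 + ∑ j, (α j : ℤ) * d j ≤ t.2.1 ∧
    ∀ j, (¬ ∀ k, A j k q) → α j ≤ K := by
  classical
  obtain ⟨T, hTP, hT, H⟩ := h P hP
  have : ∀ q : ℕ × ℤ × M, ∀ j, ∃ k, (¬ ∀ k, A j k q) → ¬ A j k q := by
    intro q j
    by_cases hq : ∀ k, A j k q
    · exact ⟨0, fun h => absurd hq h⟩
    · push Not at hq
      obtain ⟨k, hk⟩ := hq
      exact ⟨k, fun _ => hk⟩
  choose k hk using this
  refine ⟨T, hTP, hT, ∑ q ∈ hT.toFinset, ∑ j, k q j, fun t ht => ?_⟩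
  obtain ⟨q, hq, α, h1, h2, h3⟩ := H t ht
  refine ⟨q, hq, α, h1, h2, fun j hj => ?_⟩
  have h4 : α j < k q j := by
    by_contra hcon
    exact hk q j hj (h3 j _ (not_lt.1 hcon))
  have h5 : k q j ≤ ∑ j, k q j :=
    Finset.single_le_sum (f := fun j => k q j) (fun _ _ => Nat.zero_le _) (Finset.mem_univ j)
  have h6 : ∑ j, k q j ≤ ∑ q ∈ hT.toFinset, ∑ j, k q j :=
    Finset.single_le_sum (f := fun q => ∑ j, k q j) (fun _ _ => Nat.zero_le _)
      (hT.mem_toFinset.2 hq)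
  omega

lemma lower_bound (h : FinGen d Good A) (P : Set (ℕ × ℤ × M)) (hP : P ⊆ Good) (a : ℤ)
    (ha : ∀ q ∈ P, ∀ j, d j < a → ¬ ∀ k, A j k q) :
    ∃ C : ℤ, ∀ t ∈ P, a * t.1 - C ≤ t.2.1 := by
  obtain ⟨T, hTP, hT, K, H⟩ := finGen_bound h P hP
  refine ⟨∑ q ∈ hT.toFinset, |q.2.1 - a * q.1| + ∑ j, (K : ℤ) * |d j - a|, fun t ht => ?_⟩
  obtain ⟨q, hq, α, h1, h2, h3⟩ := H t ht
  have h4 : |q.2.1 - a * q.1| ≤ ∑ q ∈ hT.toFinset, |q.2.1 - a * q.1| :=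
    Finset.single_le_sum (f := fun q : ℕ × ℤ × M => |q.2.1 - a * q.1|)
      (fun _ _ => abs_nonneg _) (hT.mem_toFinset.2 hq)
  have h5 : ∑ j, (a * (α j : ℤ) - K * |d j - a|) ≤ ∑ j, (α j : ℤ) * d j := by
    refine Finset.sum_le_sum fun j _ => ?_
    by_cases hj : d j < a
    · have h6 : (α j : ℤ) ≤ K := by exact_mod_cast h3 j (ha q (hTP hq) j hj)
      have h7 : |d j - a| = a - d j := by rw [abs_of_neg (by omega)]; ring
      rw [h7]
      nlinarith
    · have h7 : |d j - a| = d j - a := abs_of_nonneg (by omega)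
      have h8 : (0 : ℤ) ≤ α j := by positivity
      have h9 : (0 : ℤ) ≤ K := by positivity
      rw [h7]
      nlinarith
  rw [Finset.sum_sub_distrib, ← Finset.mul_sum] at h5
  have h6 : (q.1 : ℤ) + ∑ j, (α j : ℤ) = t.1 := by exact_mod_cast h1
  rw [← h6]
  have := neg_abs_le (q.2.1 - a * q.1)
  rw [mul_add]
  linarith

theorem comb (h : FinGen d Good A)
    (H2 : ∀ q ∈ Good, ∀ j k, A j k q → ∃ x, (q.1 + k, q.2.1 + k * d j, x) ∈ Good)
    (n₀ : ℕ) (H3 : ∀ n ≥ n₀, ∃ u x, (n, u, x) ∈ Good) :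
    ∃ j : Fin c, ∃ b : ℤ, ∃ n₁ : ℕ, ∀ n ≥ n₁,
      IsLeast {u : ℤ | ∃ x, (n, u, x) ∈ Good} (d j * (n : ℤ) + b) := by
  classical
  -- persistent indices
  have hex : ∃ j, ∃ q ∈ Good, ∀ k, A j k q := by
    by_contra hcon
    push Not at hcon
    obtain ⟨T, hTP, hT, K, H⟩ := finGen_bound h Good subset_rfl
    obtain ⟨u, x, hx⟩ := H3 (n₀ + ∑ q ∈ hT.toFinset, q.1 + c * K + 1) (by omega)
    obtain ⟨q, hq, α, h1, h2, h3⟩ := H _ hx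
    have h4 : q.1 ≤ ∑ q ∈ hT.toFinset, q.1 :=
      Finset.single_le_sum (f := fun q : ℕ × ℤ × M => q.1)
        (fun _ _ => Nat.zero_le _) (hT.mem_toFinset.2 hq)
    have h5 : ∑ j, α j ≤ ∑ _j : Fin c, K := by
      refine Finset.sum_le_sum fun j _ => h3 j ?_
      push Not
      exact hcon j q (hTP hq)
    simp at h5 h1
    omega
  obtain ⟨j0, hj0, hmin⟩ : ∃ j, (∃ q ∈ Good, ∀ k, A j k q) ∧
      ∀ i, (∃ q ∈ Good, ∀ k, A i k q) → d j ≤ d i := by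
    obtain ⟨j, hj⟩ := hex
    obtain ⟨i, hi, him⟩ := Finset.exists_min_image
      (Finset.univ.filter fun j => ∃ q ∈ Good, ∀ k, A j k q) d ⟨j, by simpa using hj⟩
    refine ⟨i, by simpa using hi, fun i' hi' => him i' (by simpa using hi')⟩
  set a := d j0 with ha
  obtain ⟨C, hC⟩ := lower_bound h Good subset_rfl a (by
    intro q hq j hj hcon
    exact absurd (hmin j ⟨q, hq, hcon⟩) (not_le.2 hj))
  -- values of the intercept occurring infinitely often
  let Inf : ℤ → Prop := fun b => ∀ n1 : ℕ, ∃ n ≥ n1, ∃ x, (n, a * (n : ℤ) + b, x) ∈ Good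
  have hInfne : ∃ b, Inf b := by
    obtain ⟨q, hq, hqk⟩ := hj0
    refine ⟨q.2.1 - a * q.1, fun n1 => ⟨q.1 + n1, by omega, ?_⟩⟩
    obtain ⟨x, hx⟩ := H2 q hq j0 n1 (hqk n1)
    refine ⟨x, ?_⟩
    convert hx using 3
    push_cast; rw [← ha]; ring
  have hInfbd : ∀ b, Inf b → -C ≤ b := by
    intro b hb
    obtain ⟨n, -, x, hx⟩ := hb 0
    have := hC _ hx
    simp only at this
    linarith
  obtain ⟨b, hb, hbmin⟩ := Int.exists_least_of_bdd ⟨-C, hInfbd⟩ hInfne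
  -- a persistent generator on the line of intercept b
  let P : Set (ℕ × ℤ × M) := {t | t ∈ Good ∧ t.2.1 = a * t.1 + b}
  have hPG : P ⊆ Good := fun t ht => ht.1
  obtain ⟨q, hq, j, hj, hqk⟩ : ∃ q ∈ P, ∃ j, d j < a + 1 ∧ ∀ k, A j k q := by
    by_contra hcon
    push Not at hcon
    obtain ⟨C', hC'⟩ := lower_bound h P hPG (a + 1) (by
      intro q hq j hj
      push Not
      exact hcon q hq j hj)
    obtain ⟨n, hn, x, hx⟩ := hb (C' + b + 1).toNat
    have := hC' (n, a * (n : ℤ) + b, x) ⟨hx, rfl⟩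
    simp only at this
    have h1 : C' + b + 1 ≤ (n : ℤ) := by omega
    linarith
  have hdj : d j = a := le_antisymm (by omega) (hmin j ⟨q, hPG hq, hqk⟩)
  -- eventually nothing below
  have hbelow : ∃ n2 : ℕ, ∀ n ≥ n2, ∀ b' < b, ¬ ∃ x, (n, a * (n : ℤ) + b', x) ∈ Good := by
    have h1 : ∀ b', ∃ n1 : ℕ, b' < b → ∀ n ≥ n1, ¬ ∃ x, (n, a * (n : ℤ) + b', x) ∈ Good := by
      intro b'
      by_cases hb' : b' < b
      · have : ¬ Inf b' := fun hcon => absurd (hbmin b' hcon) (not_le.2 hb')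
        simp only [Inf] at this
        push Not at this
        obtain ⟨n1, hn1⟩ := this
        exact ⟨n1, fun _ n hn ⟨x, hx⟩ => hn1 n hn x hx⟩
      · exact ⟨0, fun h => absurd h hb'⟩
    choose n1 hn1 using h1
    refine ⟨∑ b' ∈ Finset.Icc (-C) b, n1 b', fun n hn b' hb' hx => ?_⟩
    have hbC : -C ≤ b' := by
      obtain ⟨x, hx⟩ := hx
      have := hC _ hx
      simp only at this
      linarith
    have h2 : n1 b' ≤ ∑ b' ∈ Finset.Icc (-C) b, n1 b' :=
      Finset.single_le_sum (fun _ _ => Nat.zero_le _) (Finset.mem_Icc.2 ⟨hbC, hb'.le⟩)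
    exact hn1 b' hb' n (h2.trans hn) hx
  obtain ⟨n2, hn2⟩ := hbelow
  refine ⟨j, b, q.1 + n2, fun n hn => ⟨?_, ?_⟩⟩
  · obtain ⟨x, hx⟩ := H2 q hq.1 j (n - q.1) (hqk _)
    refine ⟨x, ?_⟩
    convert hx using 2
    · omega
    · congr 1
      have h1 : q.2.1 = a * q.1 + b := hq.2
      rw [h1, hdj, Nat.cast_sub (by omega)]
      ring
  · rintro u ⟨x, hx⟩
    by_contra hcon
    refine hn2 n (by omega) (u - a * n) ?_ ⟨x, ?_⟩
    · rw [hdj] at hcon; linarith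
    · convert hx using 3
      ring

end Comb

section Final

variable {R M : Type*} [CommRing R] [AddCommGroup M] [Module R M]

lemma prod_pow_mem (𝒜 : ℤ → AddSubgroup R) [GradedRing 𝒜] {c : ℕ} (y : Fin c → R)
    (d : Fin c → ℤ) (hy : ∀ j, y j ∈ 𝒜 (d j)) (α : Fin c → ℕ) (s : Finset (Fin c)) :
    ∏ j ∈ s, y j ^ α j ∈ 𝒜 (∑ j ∈ s, (α j : ℤ) * d j) := by
  classical
  induction s using Finset.induction_on with
  | empty => simpa using SetLike.GradedOne.one_mem (A := 𝒜)
  | insert i s hi ih =>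
    rw [Finset.prod_insert hi, Finset.sum_insert hi]
    refine SetLike.GradedMul.mul_mem ?_ ih
    have := SetLike.pow_mem_graded (A := 𝒜) (α i) (hy i)
    simpa using this

lemma smul_mem_pow {I : Ideal R} {W : Submodule R M} {n k : ℕ} {r : R} (hr : r ∈ I ^ k)
    {x : M} (hx : x ∈ I ^ n • W) : r • x ∈ I ^ (n + k) • W := by
  rw [add_comm, pow_add, ← smul_smul]
  exact Submodule.smul_mem_smul hr hx

lemma smul_mem_KK {I : Ideal R} {W : Submodule R M} {p : Ideal R} {hp : p.IsPrime} {n k : ℕ}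
    {r : R} (hr : r ∈ I ^ k)
    {x : M} (hx : x ∈ KK p hp (I ^ n • W)) : r • x ∈ KK p hp (I ^ (n + k) • W) := by
  obtain ⟨s, hs, hsx⟩ := hx
  exact ⟨s, hs, by rw [smul_comm]; exact smul_mem_pow hr hsx⟩

lemma prod_mem_pow {I : Ideal R} {c : ℕ} {y : Fin c → R} (hyI : ∀ j, y j ∈ I) (α : Fin c → ℕ)
    (s : Finset (Fin c)) : ∏ j ∈ s, y j ^ α j ∈ I ^ (∑ j ∈ s, α j) := by
  rw [← Finset.prod_pow_eq_pow_sum]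
  exact Ideal.prod_mem_prod fun j _ => Ideal.pow_mem_pow (hyI j) _

end Final

end VNum

/-- Setup: `R` is a commutative Noetherian ℕ-graded ring (encoded as a
ℤ-graded ring with vanishing negative components), `M` a finitely generated ℤ-graded
`R`-module, `I` a homogeneous ideal, `N` a graded submodule of `M`, and `J ≤ I` a reduction
of `I` (`J * I^m0 = I^(m0+1)`) generated by homogeneous elements `y j` of monotone degrees
`d j`.  If `p` is a prime ideal with `p ∈ Ass_R(I^n M / I^n N)` for all sufficiently large
`n` (i.e. `p = (I^n N :_R x)` for some `x ∈ I^n M`), then there are `a ∈ {d 1, …, d c}` and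
`b ∈ ℤ` such that `v_p(I^n M / I^n N) = a * n + b` for all sufficiently large `n`, where
`v_p` is the least degree of a homogeneous `x ∈ I^n M` with `p = (I^n N :_R x)`. -/
theorem v_number_at_prime_of_InM_mod_InN_eventually_linear
    {R M : Type*} [CommRing R] [IsNoetherianRing R]
    [AddCommGroup M] [Module R M] [Module.Finite R M]
    (𝒜 : ℤ → AddSubgroup R) (ℳ : ℤ → AddSubgroup M)
    [GradedRing 𝒜] [DirectSum.Decomposition ℳ]
    (hsmul : ∀ (i j : ℤ), ∀ r ∈ 𝒜 i, ∀ x ∈ ℳ j, r • x ∈ ℳ (i + j))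
    (hA : ∀ i : ℤ, i < 0 → 𝒜 i = ⊥)
    (I : Ideal R) (hI : Ideal.IsHomogeneous 𝒜 I)
    (N : Submodule R M) (hN : ∀ x ∈ N, ∀ i : ℤ, (DirectSum.decompose ℳ x i : M) ∈ N)
    (c : ℕ) (y : Fin c → R) (d : Fin c → ℤ) (hdmono : Monotone d)
    (hy : ∀ j, y j ∈ 𝒜 (d j))
    (J : Ideal R) (hJgen : J = Ideal.span (Set.range y)) (hJI : J ≤ I)
    (m0 : ℕ) (hred : J * I ^ m0 = I ^ (m0 + 1))
    (p : Ideal R) (hp : p.IsPrime)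
    (hass : ∃ n₀ : ℕ, ∀ n ≥ n₀, ∃ x ∈ (I ^ n • ⊤ : Submodule R M),
      ∀ r : R, r ∈ p ↔ r • x ∈ (I ^ n • N : Submodule R M)) :
    ∃ j : Fin c, ∃ b : ℤ, ∃ n₁ : ℕ, ∀ n ≥ n₁,
      sInf {u : ℤ | ∃ x ∈ ℳ u, x ∈ (I ^ n • ⊤ : Submodule R M) ∧
        ∀ r : R, r ∈ p ↔ r • x ∈ (I ^ n • N : Submodule R M)} = d j * (n : ℤ) + b := by
  classical
  obtain ⟨n₀, hass⟩ := hass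
  have hyI : ∀ j, y j ∈ I := fun j => hJI (by rw [hJgen]; exact Ideal.subset_span ⟨j, rfl⟩)
  have hI' : ∀ r ∈ I, ∀ i, VNum.cmp 𝒜 r i ∈ I := fun r hr i => hI i hr
  have hWN : ∀ n, ∀ x ∈ I ^ n • N, ∀ u, VNum.cmp ℳ x u ∈ I ^ n • N := fun n =>
    VNum.pow_smul_homog 𝒜 ℳ hsmul I hI' N hN n
  have hWM : ∀ n, ∀ x ∈ (I ^ n • ⊤ : Submodule R M), ∀ u,
      VNum.cmp ℳ x u ∈ (I ^ n • ⊤ : Submodule R M) := fun n =>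
    VNum.pow_smul_homog 𝒜 ℳ hsmul I hI' ⊤ (fun _ _ _ => trivial) n
  let Good : Set (ℕ × ℤ × M) := {t | t.2.2 ∈ ℳ t.2.1 ∧ t.2.2 ∈ (I ^ t.1 • ⊤ : Submodule R M) ∧
    (∀ r ∈ p, r • t.2.2 ∈ I ^ t.1 • N) ∧ t.2.2 ∉ VNum.KK p hp (I ^ t.1 • N)}
  let A : Fin c → ℕ → (ℕ × ℤ × M) → Prop := fun j k t =>
    y j ^ k • t.2.2 ∉ VNum.KK p hp (I ^ (t.1 + k) • N)
  have H1 : VNum.FinGen d Good A := by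
    intro P hP
    obtain ⟨T, hTP, hT, H⟩ := VNum.exists_finite I J hJI m0 hred y hJgen P
      (fun t ht => (hP ht).2.1)
    refine ⟨T, hTP, hT, fun t ht => ?_⟩
    obtain ⟨htu, -, -, htK⟩ := hP ht
    have hdeg : ∀ q ∈ T, ∀ α : Fin c → ℕ, (∏ j, y j ^ α j) • q.2.2 ∈
        ℳ (q.2.1 + ∑ j, (α j : ℤ) * d j) := by
      intro q hq α
      rw [add_comm]
      exact hsmul _ _ _ (VNum.prod_pow_mem 𝒜 y d hy α _) _ (hP (hTP hq)).1
    obtain ⟨z, ⟨q, hq, α, hα, rfl⟩, hzK, v, hv, hzv⟩ := VNum.span_homog 𝒜 ℳ hsmul hA _ _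
      (by
        rintro z ⟨q, hq, α, -, rfl⟩
        exact ⟨_, hdeg q hq α⟩) _ _ htu (H t ht) htK
    refine ⟨q, hq, α, hα, ?_, ?_⟩
    · have hz0 : (∏ j, y j ^ α j) • q.2.2 ≠ 0 := fun h0 => hzK (by
        rw [h0]; exact Submodule.zero_mem _)
      rw [DirectSum.degree_eq_of_mem_mem ℳ (hdeg q hq α) hzv hz0]
      exact hv
    · intro j k hk hmem
      apply hzK
      have e1 : ∏ i, y i ^ α i =
          (y j ^ (α j - k) * ∏ i ∈ Finset.univ.erase j, y i ^ α i) * y j ^ k := by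
        rw [← Finset.mul_prod_erase Finset.univ _ (Finset.mem_univ j)]
        conv_lhs => rw [← Nat.sub_add_cancel hk, pow_add]
        ring
      have e2 : t.1 = q.1 + k + ((α j - k) + ∑ i ∈ Finset.univ.erase j, α i) := by
        rw [← Finset.add_sum_erase Finset.univ _ (Finset.mem_univ j)] at hα
        omega
      rw [e1, mul_smul, e2]
      refine VNum.smul_mem_KK ?_ hmem
      rw [pow_add]
      exact Ideal.mul_mem_mul (Ideal.pow_mem_pow (hyI j) _) (VNum.prod_mem_pow hyI α _)
  have H2 : ∀ q ∈ Good, ∀ j k, A j k q →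
      ∃ x, (q.1 + k, q.2.1 + k * d j, x) ∈ Good := by
    rintro q ⟨hq1, hq2, hq3, hq4⟩ j k hA'
    refine ⟨y j ^ k • q.2.2, ?_, ?_, ?_, hA'⟩
    · have h1 := SetLike.pow_mem_graded (A := 𝒜) k (hy j)
      have h2 := hsmul _ _ _ h1 _ hq1
      rw [add_comm] at h2
      simpa using h2
    · exact VNum.smul_mem_pow (Ideal.pow_mem_pow (hyI j) k) hq2
    · intro r hr
      dsimp only
      rw [smul_comm]
      exact VNum.smul_mem_pow (Ideal.pow_mem_pow (hyI j) k) (hq3 r hr)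
  have H3 : ∀ n ≥ n₀, ∃ u x, (n, u, x) ∈ Good := by
    intro n hn
    obtain ⟨x, hxM, hx⟩ := hass n hn
    obtain ⟨u, z, hz⟩ := VNum.exists_homog 𝒜 ℳ hsmul p hp _ (hWN n) _ (hWM n) x hxM hx
    exact ⟨u, z, hz⟩
  obtain ⟨j, b, n₁, hmain⟩ := VNum.comb H1 H2 n₀ H3
  refine ⟨j, b, n₁, fun n hn => ?_⟩
  rw [← (hmain n hn).csInf_eq]
  congr 1
  ext u
  simp only [Set.mem_ofPred_eq, Good]
  refine exists_congr fun x => ?_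
  rw [VNum.good_iff p hp]
end

section
/- Assume I^n M ⊄ I^n N (i.e. I^n M / I^n N ≠ 0) for all sufficiently large n. Then there exist a ∈ {d_1, …, d_c} and b, b' ∈ ℤ such that indeg(I^n M / I^n N) = a·n + b and v(I^n M / I^n N) = a·n + b' for all sufficiently large n; that is, both functions are eventually linear in n with the same leading coefficient a, which belongs to {d_1, …, d_c}. -/
section VNum

set_option linter.unusedSectionVars false

/-- A submodule closed under taking homogeneous components. -/
def HomSub {R M : Type*} [CommRing R] [AddCommGroup M] [Module R M]
    (ℳ : ℤ → AddSubgroup M) [DirectSum.Decomposition ℳ] (N : Submodule R M) : Prop :=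
  ∀ x ∈ N, ∀ i : ℤ, (DirectSum.decompose ℳ x i : M) ∈ N

/-- Degrees of homogeneous elements of `L` outside `U`. -/
def degSet {R M : Type*} [CommRing R] [AddCommGroup M] [Module R M]
    (ℳ : ℤ → AddSubgroup M) (L U : Submodule R M) : Set ℤ :=
  {u | ∃ x ∈ ℳ u, x ∈ L ∧ x ∉ U}

/-- Eventually empty, or with eventually linear least element. -/
def EvLin {c : ℕ} (d : Fin c → ℤ) (P : Fin c → Prop) (s : ℕ → Set ℤ) : Prop :=
  (∃ n₁ : ℕ, ∀ n ≥ n₁, s n = ∅) ∨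
  ∃ j, P j ∧ ∃ b : ℤ, ∃ n₁ : ℕ, ∀ n ≥ n₁, IsLeast (s n) (d j * (n : ℤ) + b)

theorem EvLin.mono {c : ℕ} {d : Fin c → ℤ} {P Q : Fin c → Prop} {s : ℕ → Set ℤ}
    (h : EvLin d P s) (hPQ : ∀ j, P j → Q j) : EvLin d Q s := by
  rcases h with h | ⟨j, hj, h⟩
  · exact Or.inl h
  · exact Or.inr ⟨j, hPQ j hj, h⟩

theorem EvLin.congr {c : ℕ} {d : Fin c → ℤ} {P : Fin c → Prop} {s t : ℕ → Set ℤ}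
    (h : EvLin d P s) (n₀ : ℕ) (hst : ∀ n ≥ n₀, s n = t n) : EvLin d P t := by
  rcases h with ⟨n₁, h⟩ | ⟨j, hj, b, n₁, h⟩
  · refine Or.inl ⟨max n₀ n₁, fun n hn => ?_⟩
    rw [← hst n (le_trans (le_max_left _ _) hn)]
    exact h n (le_trans (le_max_right _ _) hn)
  · refine Or.inr ⟨j, hj, b, max n₀ n₁, fun n hn => ?_⟩
    rw [← hst n (le_trans (le_max_left _ _) hn)]
    exact h n (le_trans (le_max_right _ _) hn)

theorem ev_le_of_slope_lt (a a' b b' : ℤ) (h : a < a') :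
    ∃ n₀ : ℕ, ∀ n : ℕ, n ≥ n₀ → a * (n : ℤ) + b ≤ a' * (n : ℤ) + b' := by
  refine ⟨(b - b').toNat, fun n hn => ?_⟩
  have h1 : b - b' ≤ (n : ℤ) := by omega
  have h2 : (a' - a) * (n : ℤ) ≥ 1 * (n : ℤ) :=
    mul_le_mul_of_nonneg_right (by omega) (by omega)
  nlinarith

theorem slope_le (a a' b b' : ℤ) (n₁ : ℕ)
    (h : ∀ n : ℕ, n ≥ n₁ → a * (n : ℤ) + b ≤ a' * (n : ℤ) + b') : a ≤ a' := by
  by_contra hlt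
  push Not at hlt
  obtain ⟨n₀, h0⟩ := ev_le_of_slope_lt a' a b' (b - 1) hlt
  have := h (max n₀ n₁) (le_max_right _ _)
  have := h0 (max n₀ n₁) (le_max_left _ _)
  omega

theorem EvLin.union_aux {s t : Set ℤ} {a b : ℤ} (hs : IsLeast s a) (ht : IsLeast t b)
    (h : a ≤ b) : IsLeast (s ∪ t) a := by
  have := hs.union ht
  rwa [min_eq_left h] at this

theorem EvLin.union {c : ℕ} {d : Fin c → ℤ} {P : Fin c → Prop} {s t : ℕ → Set ℤ}
    (hs : EvLin d P s) (ht : EvLin d P t) : EvLin d P (fun n => s n ∪ t n) := by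
  rcases hs with ⟨n₁, hs⟩ | hs'
  · exact ht.congr n₁ (fun n hn => by rw [hs n hn, Set.empty_union])
  rcases ht with ⟨n₁, ht⟩ | ht'
  · exact EvLin.congr (Or.inr hs') n₁ (fun n hn => by rw [ht n hn, Set.union_empty])
  obtain ⟨j, hj, b, n₁, hs⟩ := hs'
  obtain ⟨j', hj', b', n₂, ht⟩ := ht'
  right
  have key : (∃ n₀ : ℕ, ∀ n : ℕ, n ≥ n₀ → d j * (n : ℤ) + b ≤ d j' * (n : ℤ) + b') ∨
      (∃ n₀ : ℕ, ∀ n : ℕ, n ≥ n₀ → d j' * (n : ℤ) + b' ≤ d j * (n : ℤ) + b) := by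
    rcases lt_trichotomy (d j) (d j') with h | h | h
    · exact Or.inl (ev_le_of_slope_lt _ _ _ _ h)
    · rcases le_total b b' with h' | h'
      · exact Or.inl ⟨0, fun n _ => by rw [h]; omega⟩
      · exact Or.inr ⟨0, fun n _ => by rw [h]; omega⟩
    · exact Or.inr (ev_le_of_slope_lt _ _ _ _ h)
  rcases key with ⟨n₀, h⟩ | ⟨n₀, h⟩
  · refine ⟨j, hj, b, n₀ + n₁ + n₂, fun n hn => ?_⟩
    exact EvLin.union_aux (hs n (by omega)) (ht n (by omega)) (h n (by omega))
  · refine ⟨j', hj', b', n₀ + n₁ + n₂, fun n hn => ?_⟩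
    change IsLeast (s n ∪ t n) _
    rw [Set.union_comm]
    exact EvLin.union_aux (ht n (by omega)) (hs n (by omega)) (h n (by omega))

theorem EvLin.biUnion {c : ℕ} {d : Fin c → ℤ} {P : Fin c → Prop} {ι : Type*}
    (F : Finset ι) (s : ι → ℕ → Set ℤ) (h : ∀ i ∈ F, EvLin d P (s i)) :
    EvLin d P (fun n => {u | ∃ i ∈ F, u ∈ s i n}) := by
  classical
  induction F using Finset.induction_on with
  | empty => exact Or.inl ⟨0, fun n _ => by simp⟩
  | insert a F ha ih =>
    have h1 := (h a (by simp)).union (ih (fun i hi => h i (by simp [hi])))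
    refine h1.congr 0 (fun n _ => ?_)
    ext u
    simp

section graded

variable {R M : Type*} [CommRing R] [AddCommGroup M] [Module R M]
    (𝒜 : ℤ → AddSubgroup R) (ℳ : ℤ → AddSubgroup M)
    [GradedRing 𝒜] [DirectSum.Decomposition ℳ]

theorem comp_smul (hsmul : ∀ (i j : ℤ), ∀ r ∈ 𝒜 i, ∀ x ∈ ℳ j, r • x ∈ ℳ (i + j))
    {i : ℤ} {r : R} (hr : r ∈ 𝒜 i) (x : M) (u : ℤ) :
    (DirectSum.decompose ℳ (r • x) u : M) = r • (DirectSum.decompose ℳ x (u - i) : M) := by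
  induction x using DirectSum.Decomposition.inductionOn ℳ with
  | zero => simp
  | @homogeneous l m =>
    have h := hsmul i l r hr m m.2
    by_cases hl : l = u - i
    · have : i + l = u := by omega
      subst this
      rw [DirectSum.decompose_of_mem_same ℳ h, ← hl, DirectSum.decompose_of_mem_same ℳ m.2]
    · rw [DirectSum.decompose_of_mem_ne ℳ h (by omega), DirectSum.decompose_of_mem_ne ℳ m.2 hl,
        smul_zero]
  | add x x' h h' => simp [smul_add, DirectSum.decompose_add, h, h']

theorem comp_smul' (hsmul : ∀ (i j : ℤ), ∀ r ∈ 𝒜 i, ∀ x ∈ ℳ j, r • x ∈ ℳ (i + j))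
    {i : ℤ} {x : M} (hx : x ∈ ℳ i) (r : R) (u : ℤ) :
    (DirectSum.decompose ℳ (r • x) u : M) = (DirectSum.decompose 𝒜 r (u - i) : R) • x := by
  induction r using DirectSum.Decomposition.inductionOn 𝒜 with
  | zero => simp
  | @homogeneous l m =>
    have h := hsmul l i m m.2 x hx
    by_cases hl : l = u - i
    · have : l + i = u := by omega
      subst this
      rw [DirectSum.decompose_of_mem_same ℳ h, ← hl, DirectSum.decompose_of_mem_same 𝒜 m.2]
    · rw [DirectSum.decompose_of_mem_ne ℳ h (by omega), DirectSum.decompose_of_mem_ne 𝒜 m.2 hl,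
        zero_smul]
  | add x x' h h' => simp [add_smul, DirectSum.decompose_add, h, h']

theorem mem_of_comp {N : Submodule R M} {x : M}
    (h : ∀ i, (DirectSum.decompose ℳ x i : M) ∈ N) : x ∈ N := by
  classical
  rw [← DirectSum.sum_support_decompose ℳ x]
  exact Submodule.sum_mem _ (fun i _ => h i)

theorem homSub_top : HomSub ℳ (⊤ : Submodule R M) := fun _ _ _ => trivial

theorem homSub_smul (hsmul : ∀ (i j : ℤ), ∀ r ∈ 𝒜 i, ∀ x ∈ ℳ j, r • x ∈ ℳ (i + j))
    {I : Ideal R} (hI : Ideal.IsHomogeneous 𝒜 I) {N : Submodule R M} (hN : HomSub ℳ N) :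
    HomSub ℳ (I • N) := by
  classical
  intro x hx u
  induction hx using Submodule.smul_induction_on' with
  | smul r hr n hn =>
    rw [← DirectSum.sum_support_decompose 𝒜 r, Finset.sum_smul, DirectSum.decompose_sum,
      DFinsupp.finsetSum_apply, AddSubmonoidClass.coe_finsetSum]
    refine Submodule.sum_mem _ (fun i _ => ?_)
    rw [comp_smul 𝒜 ℳ hsmul (SetLike.coe_mem _)]
    exact Submodule.smul_mem_smul (hI i hr) (hN n hn _)
  | add x hx y hy h h' =>
    rw [DirectSum.decompose_add]
    exact Submodule.add_mem _ h h'

theorem homSub_pow_smul (hsmul : ∀ (i j : ℤ), ∀ r ∈ 𝒜 i, ∀ x ∈ ℳ j, r • x ∈ ℳ (i + j))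
    {I : Ideal R} (hI : Ideal.IsHomogeneous 𝒜 I) {N : Submodule R M} (hN : HomSub ℳ N)
    (n : ℕ) : HomSub ℳ (I ^ n • N) := by
  induction n with
  | zero => simpa using hN
  | succ n ih =>
    rw [pow_succ', mul_smul]
    exact homSub_smul 𝒜 ℳ hsmul hI ih

theorem bdd_degrees [Module.Finite R M]
    (hsmul : ∀ (i j : ℤ), ∀ r ∈ 𝒜 i, ∀ x ∈ ℳ j, r • x ∈ ℳ (i + j))
    (hA : ∀ i : ℤ, i < 0 → 𝒜 i = ⊥) :
    ∃ u₀ : ℤ, ∀ u < u₀, ∀ x ∈ ℳ u, x = 0 := by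
  classical
  have h1 : ∀ x : M, ∃ u₀ : ℤ, ∀ u < u₀, (DirectSum.decompose ℳ x u : M) = 0 := by
    intro x
    induction x using DirectSum.Decomposition.inductionOn ℳ with
    | zero => exact ⟨0, fun u _ => by simp⟩
    | @homogeneous l m =>
      exact ⟨l, fun u hu => DirectSum.decompose_of_mem_ne ℳ m.2 (by omega)⟩
    | add x x' h h' =>
      obtain ⟨a, ha⟩ := h
      obtain ⟨b, hb⟩ := h'
      refine ⟨min a b, fun u hu => ?_⟩
      rw [DirectSum.decompose_add, DirectSum.add_apply, AddSubgroup.coe_add,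
        ha u (by omega), hb u (by omega), add_zero]
  choose f hf using h1
  obtain ⟨s, hs⟩ := (Module.Finite.fg_top : (⊤ : Submodule R M).FG)
  obtain ⟨v₀, hv₀⟩ := (s.image (fun x => -f x)).exists_le
  obtain ⟨u₀, rfl⟩ : ∃ u₀, v₀ = -u₀ := ⟨-v₀, by simp⟩
  have hu₀ : ∀ x ∈ s, u₀ ≤ f x := fun x hx => by
    have := hv₀ _ (Finset.mem_image_of_mem (fun x => -f x) hx)
    omega
  refine ⟨u₀, fun u hu x hx => ?_⟩
  have key : ∀ x : M, ∀ u < u₀, (DirectSum.decompose ℳ x u : M) = 0 := by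
    intro x
    have hx : x ∈ Submodule.span R (s : Set M) := by rw [hs]; trivial
    induction hx using Submodule.span_induction with
    | mem x hx => exact fun u hu => hf x u (lt_of_lt_of_le hu (hu₀ x hx))
    | zero => simp
    | add x y _ _ hx hy =>
      intro u hu
      rw [DirectSum.decompose_add, DirectSum.add_apply, AddSubgroup.coe_add, hx u hu, hy u hu,
        add_zero]
    | smul r x _ hx =>
      induction r using DirectSum.Decomposition.inductionOn 𝒜 with
      | zero => simp
      | @homogeneous l m =>
        intro u hu
        by_cases hl : l < 0
        · have : (m : R) ∈ (⊥ : AddSubgroup R) := (hA l hl).le m.2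
          rw [AddSubgroup.mem_bot] at this
          rw [this]; simp
        · rw [comp_smul 𝒜 ℳ hsmul m.2, hx _ (by omega), smul_zero]
      | add r r' h h' =>
        intro u hu
        rw [add_smul, DirectSum.decompose_add, DirectSum.add_apply, AddSubgroup.coe_add, h u hu,
          h' u hu, add_zero]
  have := key x u hu
  rwa [DirectSum.decompose_of_mem_same ℳ hx] at this

theorem degSet_union {U K L : Submodule R M} (hUK : U ≤ K) (hKL : K ≤ L) :
    degSet ℳ L U = degSet ℳ K U ∪ degSet ℳ L K := by
  ext u
  constructor
  · rintro ⟨x, hx, hL, hU⟩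
    by_cases hK : x ∈ K
    · exact Or.inl ⟨x, hx, hK, hU⟩
    · exact Or.inr ⟨x, hx, hL, hK⟩
  · rintro (⟨x, hx, h1, h2⟩ | ⟨x, hx, h1, h2⟩)
    · exact ⟨x, hx, hKL h1, h2⟩
    · exact ⟨x, hx, h1, fun h => h2 (hUK h)⟩

theorem degSet_empty {U L : Submodule R M} (h : L ≤ U) : degSet ℳ L U = ∅ := by
  ext u
  simp only [Set.mem_empty_iff_false, iff_false]
  rintro ⟨x, _, h1, h2⟩
  exact h2 (h h1)

end graded

section filt

variable {R M : Type*} [CommRing R] [AddCommGroup M] [Module R M] {J : Ideal R}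

theorem Filt.smul_mem (F : J.Filtration M) {a : R} (ha : a ∈ J) {n : ℕ} {x : M}
    (hx : x ∈ F.N n) : a • x ∈ F.N (n + 1) :=
  F.smul_le n (Submodule.smul_mem_smul ha hx)

theorem Filt.pow_smul_mem (F : J.Filtration M) {a : R} (ha : a ∈ J) {n : ℕ} {x : M}
    (hx : x ∈ F.N n) (k : ℕ) : a ^ k • x ∈ F.N (n + k) := by
  have := F.pow_smul_le k n (Submodule.smul_mem_smul (Ideal.pow_mem_pow ha k) hx)
  rwa [add_comm] at this

/-- Elements of `L` sent to `U` by `a ^ i`. -/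
def torsI (L U : J.Filtration M) (a : R) (i : ℕ) : J.Filtration M where
  N n := L.N n ⊓ (U.N (n + i)).comap (LinearMap.lsmul R M (a ^ i))
  mono n := by
    rintro x ⟨h1, h2⟩
    refine ⟨L.mono n h1, ?_⟩
    have h2' : a ^ i • x ∈ U.N (n + 1 + i) := h2
    rw [show n + 1 + i = n + i + 1 by omega] at h2'
    exact U.mono _ h2'
  smul_le n := by
    rw [Submodule.smul_le]
    rintro r hr x ⟨h1, h2⟩
    refine ⟨Filt.smul_mem L hr h1, ?_⟩
    have h2' : a ^ i • x ∈ U.N (n + i) := h2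
    change a ^ i • r • x ∈ U.N (n + 1 + i)
    rw [show n + 1 + i = n + i + 1 by omega, smul_comm]
    exact Filt.smul_mem U hr h2'

theorem mem_torsI {L U : J.Filtration M} {a : R} {i n : ℕ} {x : M} :
    x ∈ (torsI L U a i).N n ↔ x ∈ L.N n ∧ a ^ i • x ∈ U.N (n + i) := Iff.rfl

theorem torsI_mono {L U : J.Filtration M} {a : R} (ha : a ∈ J) {i k : ℕ} (hik : i ≤ k) (n : ℕ) :
    (torsI L U a i).N n ≤ (torsI L U a k).N n := by
  rintro x ⟨h1, h2⟩
  refine ⟨h1, ?_⟩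
  obtain ⟨l, rfl⟩ := Nat.exists_eq_add_of_le hik
  have hpow : a ^ i • x ∈ U.N (n + i) := h2
  change a ^ (i + l) • x ∈ U.N (n + (i + l))
  rw [← add_assoc, add_comm i l, pow_add, mul_smul]
  exact Filt.pow_smul_mem U ha hpow l

/-- Elements of `L` sent to `U` by some power of `a`. -/
def torsU (L U : J.Filtration M) (a : R) (ha : a ∈ J) : J.Filtration M where
  N n :=
    { carrier := {x | ∃ i, x ∈ (torsI L U a i).N n}
      zero_mem' := ⟨0, Submodule.zero_mem _⟩
      add_mem' := by
        rintro x z ⟨i, hi⟩ ⟨k, hk⟩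
        exact ⟨max i k, Submodule.add_mem _ (torsI_mono ha (le_max_left _ _) n hi)
          (torsI_mono ha (le_max_right _ _) n hk)⟩
      smul_mem' := by
        rintro r x ⟨i, hi⟩
        exact ⟨i, Submodule.smul_mem _ r hi⟩ }
  mono n := by
    rintro x ⟨i, hi⟩
    exact ⟨i, (torsI L U a i).mono n hi⟩
  smul_le n := by
    rw [Submodule.smul_le]
    rintro r hr x ⟨i, hi⟩
    exact ⟨i, Filt.smul_mem _ hr hi⟩

theorem mem_torsU {L U : J.Filtration M} {a : R} {ha : a ∈ J} {n : ℕ} {x : M} :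
    x ∈ (torsU L U a ha).N n ↔ ∃ i, x ∈ (torsI L U a i).N n := Iff.rfl

theorem torsI_le (L U : J.Filtration M) (a : R) (i n : ℕ) : (torsI L U a i).N n ≤ L.N n :=
  fun _ h => h.1

theorem torsU_le (L U : J.Filtration M) (a : R) (ha : a ∈ J) (n : ℕ) :
    (torsU L U a ha).N n ≤ L.N n := fun _ ⟨_, h⟩ => h.1

theorem le_torsI {L U : J.Filtration M} (hUL : U ≤ L) {a : R} (ha : a ∈ J) (i n : ℕ) :
    U.N n ≤ (torsI L U a i).N n :=
  fun _ h => ⟨hUL n h, Filt.pow_smul_mem U ha h i⟩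

theorem le_torsU {L U : J.Filtration M} (hUL : U ≤ L) {a : R} (ha : a ∈ J) (n : ℕ) :
    U.N n ≤ (torsU L U a ha).N n :=
  fun _ h => ⟨0, le_torsI hUL ha 0 n h⟩

theorem torsI_zero_le (L U : J.Filtration M) (a : R) (n : ℕ) :
    (torsI L U a 0).N n ≤ U.N n := by
  rintro x ⟨_, h⟩
  have h' : a ^ 0 • x ∈ U.N (n + 0) := h
  simpa using h'

theorem smul_torsI_succ {L U : J.Filtration M} {a : R} (ha : a ∈ J) {i n : ℕ} {x : M}
    (hx : x ∈ (torsI L U a (i + 1)).N n) : a • x ∈ (torsI L U a i).N (n + 1) := by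
  obtain ⟨h1, h2⟩ := mem_torsI.1 hx
  refine ⟨Filt.smul_mem L ha h1, ?_⟩
  change a ^ i • a • x ∈ U.N (n + 1 + i)
  rw [smul_smul, ← pow_succ, show n + 1 + i = n + (i + 1) by omega]
  exact h2

theorem mem_torsU_of_smul {L U : J.Filtration M} {a : R} {ha : a ∈ J} {n : ℕ} {x : M}
    (hx : x ∈ L.N n) (h : a • x ∈ (torsU L U a ha).N (n + 1)) : x ∈ (torsU L U a ha).N n := by
  obtain ⟨i, hi⟩ := h
  obtain ⟨h1, h2⟩ := mem_torsI.1 hi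
  refine ⟨i + 1, hx, ?_⟩
  change a ^ (i + 1) • x ∈ U.N (n + (i + 1))
  rwa [pow_succ, mul_smul, show n + (i + 1) = n + 1 + i by omega]

theorem torsU_stab [IsNoetherianRing R] [Module.Finite R M] {L U : J.Filtration M}
    (hL : L.Stable) {a : R} (ha : a ∈ J) :
    ∃ i n₀ : ℕ, ∀ n ≥ n₀, (torsU L U a ha).N n = (torsI L U a i).N n := by
  have hst : (torsU L U a ha).Stable := hL.of_le (fun n => torsU_le L U a ha n)
  obtain ⟨n₀, hn₀⟩ := hst.exists_pow_smul_eq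
  obtain ⟨i, hi⟩ := monotone_stabilizes_iff_noetherian.2 (inferInstance : IsNoetherian R M)
    ⟨fun i => (torsI L U a i).N n₀, fun i k hik => torsI_mono ha hik n₀⟩
  refine ⟨i, n₀, fun n hn => le_antisymm ?_ (fun x hx => ⟨i, hx⟩)⟩
  obtain ⟨k, rfl⟩ := Nat.exists_eq_add_of_le hn
  have h1 : (torsU L U a ha).N n₀ ≤ (torsI L U a i).N n₀ := by
    rintro x ⟨l, hl⟩
    have h2 := torsI_mono ha (le_max_right i l) n₀ hl
    have h3 := hi (max i l) (le_max_left _ _)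
    change (torsI L U a i).N n₀ = (torsI L U a (max i l)).N n₀ at h3
    rwa [h3]
  rw [hn₀ k, add_comm n₀ k]
  exact le_trans (smul_mono_right _ h1) ((torsI L U a i).pow_smul_le k n₀)

theorem mem_span_smul {c : ℕ} {y : Fin c → R} {N : Submodule R M} {x : M}
    (hx : x ∈ Ideal.span (Set.range y) • N) :
    ∃ f : Fin c → M, (∀ i, f i ∈ N) ∧ x = ∑ i, y i • f i := by
  induction hx using Submodule.smul_induction_on' with
  | smul r hr n hn =>
    obtain ⟨g, rfl⟩ := Ideal.mem_span_range_iff_exists_fun.1 hr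
    refine ⟨fun i => g i • n, fun i => Submodule.smul_mem _ _ hn, ?_⟩
    rw [Finset.sum_smul]
    refine Finset.sum_congr rfl (fun i _ => ?_)
    rw [mul_comm, mul_smul]
  | add x hx y hy h h' =>
    obtain ⟨f, hf, rfl⟩ := h
    obtain ⟨g, hg, rfl⟩ := h'
    refine ⟨f + g, fun i => Submodule.add_mem _ (hf i) (hg i), ?_⟩
    simp [smul_add, Finset.sum_add_distrib]

end filt

section main

variable {R M : Type*} [CommRing R] [IsNoetherianRing R]
    [AddCommGroup M] [Module R M] [Module.Finite R M]

/-- `y j` acts without nilpotency on some homogeneous element of `L / U`. -/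
def Wit {J : Ideal R} (ℳ : ℤ → AddSubgroup M) {c : ℕ} (y : Fin c → R)
    (L U : J.Filtration M) (j : Fin c) : Prop :=
  ∃ (n : ℕ) (u : ℤ) (x : M), x ∈ ℳ u ∧ x ∈ L.N n ∧ ∀ k : ℕ, y j ^ k • x ∉ U.N (n + k)

theorem homSub_torsI (𝒜 : ℤ → AddSubgroup R) (ℳ : ℤ → AddSubgroup M)
    [GradedRing 𝒜] [DirectSum.Decomposition ℳ]
    (hsmul : ∀ (i j : ℤ), ∀ r ∈ 𝒜 i, ∀ x ∈ ℳ j, r • x ∈ ℳ (i + j))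
    {J : Ideal R} {L U : J.Filtration M}
    (hL : ∀ n, HomSub ℳ (L.N n)) (hU : ∀ n, HomSub ℳ (U.N n)) {a : R} {e : ℤ} (ha : a ∈ 𝒜 e)
    (i n : ℕ) : HomSub ℳ ((torsI L U a i).N n) := by
  intro x hx u
  obtain ⟨h1, h2⟩ := mem_torsI.1 hx
  refine ⟨hL n x h1 u, ?_⟩
  change a ^ i • (DirectSum.decompose ℳ x u : M) ∈ U.N (n + i)
  have h3 := hU _ _ h2 (u + i • e)
  rwa [comp_smul 𝒜 ℳ hsmul (SetLike.pow_mem_graded i ha), add_sub_cancel_right] at h3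

theorem evLin_inj (𝒜 : ℤ → AddSubgroup R) (ℳ : ℤ → AddSubgroup M)
    [GradedRing 𝒜] [DirectSum.Decomposition ℳ]
    (hsmul : ∀ (i j : ℤ), ∀ r ∈ 𝒜 i, ∀ x ∈ ℳ j, r • x ∈ ℳ (i + j))
    (hA : ∀ i : ℤ, i < 0 → 𝒜 i = ⊥)
    {c : ℕ} (y : Fin c → R) (d : Fin c → ℤ) (hy : ∀ j, y j ∈ 𝒜 (d j))
    {J : Ideal R} (hJ : J = Ideal.span (Set.range y)) (T : Finset (Fin c))
    (L U : J.Filtration M) (hLs : L.Stable) (hUL : U ≤ L)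
    (hLh : ∀ n, HomSub ℳ (L.N n))
    (hT : ∃ n₁ : ℕ, ∀ n ≥ n₁, ∀ i ∉ T, ∀ x ∈ L.N n, y i • x ∈ U.N (n + 1))
    (j : Fin c) (hjJ : y j ∈ J) (hj : ∀ i ∈ T, d j ≤ d i) :
    EvLin d (Wit ℳ y L U) (fun n => degSet ℳ (L.N n) ((torsU L U (y j) hjJ).N n)) := by
  have hyJ : ∀ i, y i ∈ J := fun i => by rw [hJ]; exact Ideal.subset_span ⟨i, rfl⟩
  obtain ⟨n₁, hn₁⟩ := hT
  obtain ⟨n₂, hn₂⟩ := hLs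
  set s : ℕ → Set ℤ := fun n => degSet ℳ (L.N n) ((torsU L U (y j) hjJ).N n) with hs
  have ha : ∀ n, ∀ u ∈ s n, u + d j ∈ s (n + 1) := by
    rintro n u ⟨x, hx, h1, h2⟩
    refine ⟨y j • x, ?_, Filt.smul_mem L hjJ h1, fun h => h2 (mem_torsU_of_smul h1 h)⟩
    rw [add_comm]
    exact hsmul _ _ _ (hy j) _ hx
  have hb : ∀ n ≥ n₁ + n₂, ∀ u ∈ s (n + 1), ∃ u' ∈ s n, u' + d j ≤ u := by
    rintro n hn u ⟨x, hx, h1, h2⟩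
    rw [← hn₂ n (by omega)] at h1
    nth_rw 1 [hJ] at h1
    obtain ⟨f, hf, rfl⟩ := mem_span_smul h1
    have h3 : ∑ i, y i • f i = ∑ i, y i • (DirectSum.decompose ℳ (f i) (u - d i) : M) := by
      conv_lhs => rw [← DirectSum.decompose_of_mem_same ℳ hx]
      rw [DirectSum.decompose_sum, DFinsupp.finsetSum_apply, AddSubmonoidClass.coe_finsetSum]
      exact Finset.sum_congr rfl (fun i _ => comp_smul 𝒜 ℳ hsmul (hy i) _ _)
    rw [h3] at h2
    have h4 : ∃ i, y i • (DirectSum.decompose ℳ (f i) (u - d i) : M) ∉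
        (torsU L U (y j) hjJ).N (n + 1) := by
      by_contra hcon
      push Not at hcon
      exact h2 (Submodule.sum_mem _ (fun i _ => hcon i))
    obtain ⟨i, hi⟩ := h4
    have hfi := hLh n _ (hf i) (u - d i)
    have hiT : i ∈ T := by
      by_contra hiT
      exact hi (le_torsU hUL hjJ _ (hn₁ n (by omega) i hiT _ hfi))
    refine ⟨u - d i, ⟨_, SetLike.coe_mem _, hfi, fun h => hi (Filt.smul_mem _ (hyJ i) h)⟩, ?_⟩
    have := hj i hiT
    omega
  obtain ⟨u₀, hu₀⟩ := bdd_degrees 𝒜 ℳ hsmul hA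
  have hc : ∀ n, ∀ u ∈ s n, u₀ ≤ u := by
    rintro n u ⟨x, hx, h1, h2⟩
    by_contra hlt
    rw [hu₀ u (by omega) x hx] at h2
    exact h2 (Submodule.zero_mem _)
  rcases Set.eq_empty_or_nonempty (s (n₁ + n₂)) with hemp | hne
  · left
    refine ⟨n₁ + n₂, fun n hn => ?_⟩
    induction n, hn using Nat.le_induction with
    | base => exact hemp
    | succ n hn ih =>
      change s n = ∅ at ih
      by_contra hne
      obtain ⟨u, hu⟩ := Set.nonempty_iff_ne_empty.2 hne
      obtain ⟨u', hu', _⟩ := hb n hn u hu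
      rw [ih] at hu'
      exact hu'
  · right
    obtain ⟨v, hv⟩ : ∃ v, IsLeast (s (n₁ + n₂)) v :=
      ⟨sInf (s (n₁ + n₂)), Int.csInf_mem hne ⟨u₀, hc _⟩, fun u hu => csInf_le ⟨u₀, hc _⟩ hu⟩
    refine ⟨j, ?_, v - d j * ((n₁ + n₂ : ℕ) : ℤ), n₁ + n₂, fun n hn => ?_⟩
    · obtain ⟨x, hx, h1, h2⟩ := hv.1
      exact ⟨_, v, x, hx, h1, fun k hk => h2 ⟨k, h1, hk⟩⟩
    · induction n, hn using Nat.le_induction with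
      | base => simpa using hv
      | succ n hn ih =>
        have e : d j * ((n + 1 : ℕ) : ℤ) + (v - d j * ((n₁ + n₂ : ℕ) : ℤ)) =
          d j * (n : ℤ) + (v - d j * ((n₁ + n₂ : ℕ) : ℤ)) + d j := by push_cast; ring
        rw [e]
        refine ⟨ha n _ ih.1, fun u hu => ?_⟩
        obtain ⟨u', hu', h⟩ := hb n hn u hu
        have := ih.2 hu'
        omega

theorem evLin_main (𝒜 : ℤ → AddSubgroup R) (ℳ : ℤ → AddSubgroup M)
    [GradedRing 𝒜] [DirectSum.Decomposition ℳ]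
    (hsmul : ∀ (i j : ℤ), ∀ r ∈ 𝒜 i, ∀ x ∈ ℳ j, r • x ∈ ℳ (i + j))
    (hA : ∀ i : ℤ, i < 0 → 𝒜 i = ⊥)
    {c : ℕ} (y : Fin c → R) (d : Fin c → ℤ) (hy : ∀ j, y j ∈ 𝒜 (d j))
    {J : Ideal R} (hJ : J = Ideal.span (Set.range y)) (T : Finset (Fin c)) :
    ∀ (L U : J.Filtration M), L.Stable → U ≤ L →
    (∀ n, HomSub ℳ (L.N n)) → (∀ n, HomSub ℳ (U.N n)) →
    (∃ n₁ : ℕ, ∀ n ≥ n₁, ∀ i ∉ T, ∀ x ∈ L.N n, y i • x ∈ U.N (n + 1)) →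
    EvLin d (Wit ℳ y L U) (fun n => degSet ℳ (L.N n) (U.N n)) := by
  have hyJ : ∀ i, y i ∈ J := fun i => by rw [hJ]; exact Ideal.subset_span ⟨i, rfl⟩
  induction T using Finset.strongInduction with
  | H T ih =>
  intro L U hLs hUL hLh hUh hT
  rcases T.eq_empty_or_nonempty with rfl | hne
  · left
    obtain ⟨n₁, hn₁⟩ := hT
    obtain ⟨n₂, hn₂⟩ := hLs
    refine ⟨n₁ + n₂ + 1, fun n hn => degSet_empty ℳ ?_⟩
    obtain ⟨k, rfl⟩ : ∃ k, n = k + 1 := ⟨n - 1, by omega⟩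
    rw [← hn₂ k (by omega)]
    intro x hx
    nth_rw 1 [hJ] at hx
    obtain ⟨f, hf, rfl⟩ := mem_span_smul hx
    exact Submodule.sum_mem _ (fun i _ => hn₁ k (by omega) i (by simp) _ (hf i))
  obtain ⟨j, hjT, hj⟩ := T.exists_min_image d hne
  have h1 := evLin_inj 𝒜 ℳ hsmul hA y d hy hJ T L U hLs hUL hLh hT j (hyJ j) hj
  have h2 : ∀ i, EvLin d (Wit ℳ y L U)
      (fun n => degSet ℳ ((torsI L U (y j) i).N n) (U.N n)) := by
    intro i
    induction i with
    | zero => exact Or.inl ⟨0, fun n _ => degSet_empty ℳ (torsI_zero_le L U (y j) n)⟩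
    | succ i ihi =>
      have h3 := ih (T.erase j) (Finset.erase_ssubset hjT) (torsI L U (y j) (i + 1))
        (torsI L U (y j) i) (hLs.of_le (fun n => torsI_le L U _ _ n))
        (fun n => torsI_mono (hyJ j) (Nat.le_succ i) n)
        (fun n => homSub_torsI 𝒜 ℳ hsmul hLh hUh (hy j) _ n)
        (fun n => homSub_torsI 𝒜 ℳ hsmul hLh hUh (hy j) _ n)
        (by
          obtain ⟨n₁, hn₁⟩ := hT
          refine ⟨n₁, fun n hn k hk x hx => ?_⟩
          by_cases hkj : k = j
          · subst hkj
            exact smul_torsI_succ (hyJ k) hx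
          · exact le_torsI hUL (hyJ j) _ _ (hn₁ n hn k
              (fun h => hk (Finset.mem_erase.2 ⟨hkj, h⟩)) x (torsI_le L U _ _ n hx)))
      have h4 := h3.mono (Q := Wit ℳ y L U) (by
        rintro k ⟨n, u, x, hx, h5, h6⟩
        exact ⟨n, u, x, hx, torsI_le L U _ _ n h5,
          fun l hl => h6 l (le_torsI hUL (hyJ j) _ _ hl)⟩)
      refine (ihi.union h4).congr 0 (fun n _ => ?_)
      exact (degSet_union ℳ (le_torsI hUL (hyJ j) _ _)
        (torsI_mono (hyJ j) (Nat.le_succ i) n)).symm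
  obtain ⟨i, n₀, hi⟩ := torsU_stab (U := U) hLs (hyJ j)
  refine ((h2 i).union h1).congr n₀ (fun n hn => ?_)
  rw [← hi n hn]
  exact (degSet_union ℳ (le_torsU hUL (hyJ j) n) (torsU_le L U _ _ n)).symm

/-- Primes of the form `(U : x)` with `x ∈ L`. -/
def assSet (L U : Submodule R M) : Set (Ideal R) :=
  {q | q.IsPrime ∧ ∃ x ∈ L, ∀ r : R, r ∈ q ↔ r • x ∈ U}

theorem assSet_union {U K L : Submodule R M} (hUK : U ≤ K) :
    assSet L U ⊆ assSet K U ∪ assSet L K := by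
  rintro q ⟨hq, x, hx, h⟩
  by_cases hr : ∃ r, r ∉ q ∧ r • x ∈ K
  · obtain ⟨r, hr, hrK⟩ := hr
    refine Or.inl ⟨hq, r • x, hrK, fun s => ?_⟩
    rw [smul_smul, ← h, hq.mul_mem_iff_mem_or_mem]
    exact ⟨Or.inl, fun h => h.resolve_right hr⟩
  · push Not at hr
    refine Or.inr ⟨hq, x, hx, fun s => ⟨fun hs => hUK ((h s).1 hs), fun hs => ?_⟩⟩
    by_contra hsq
    exact hr s hsq hs

theorem assSet_empty {U L : Submodule R M} (h : L ≤ U) : assSet L U = ∅ := by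
  ext q
  simp only [Set.mem_empty_iff_false, iff_false]
  rintro ⟨hq, x, hx, h'⟩
  exact hq.ne_top ((Ideal.eq_top_iff_one q).2 ((h' 1).2 (by simpa using h hx)))

theorem assSet_finite (L U : Submodule R M) : (assSet L U).Finite := by
  refine (associatedPrimes.finite R (M ⧸ U)).subset ?_
  rintro q ⟨hq, x, hx, h⟩
  rw [AssociatedPrimes.mem_iff, isAssociatedPrime_iff]
  refine ⟨hq, U.mkQ x, ?_⟩
  ext r
  rw [Submodule.mem_colon_singleton, ← map_smul, Submodule.mem_bot, Submodule.mkQ_apply,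
    Submodule.Quotient.mk_eq_zero, h]

/-- The union of the sets `assSet` is eventually finite. -/
def EvFin (s : ℕ → Set (Ideal R)) : Prop := ∃ n₁ : ℕ, {q | ∃ n ≥ n₁, q ∈ s n}.Finite

theorem EvFin.sub {s t : ℕ → Set (Ideal R)} (ht : EvFin t) (n₀ : ℕ)
    (h : ∀ n ≥ n₀, s n ⊆ t n) : EvFin s := by
  obtain ⟨n₁, h1⟩ := ht
  refine ⟨n₀ + n₁, h1.subset ?_⟩
  rintro q ⟨n, hn, hq⟩
  exact ⟨n, by omega, h n (by omega) hq⟩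

theorem EvFin.union {s t : ℕ → Set (Ideal R)} (hs : EvFin s) (ht : EvFin t) :
    EvFin (fun n => s n ∪ t n) := by
  obtain ⟨n₁, h1⟩ := hs
  obtain ⟨n₂, h2⟩ := ht
  refine ⟨n₁ + n₂, (h1.union h2).subset ?_⟩
  rintro q ⟨n, hn, hq | hq⟩
  · exact Or.inl ⟨n, by omega, hq⟩
  · exact Or.inr ⟨n, by omega, hq⟩

/-- The filtration `a L_{n-1} + K_n`. -/
def shiftF {J : Ideal R} (L K : J.Filtration M) (a : R) : J.Filtration M where
  N n := (L.N (n - 1)).map (LinearMap.lsmul R M a) ⊔ K.N n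
  mono n := by
    refine sup_le_sup (Submodule.map_mono (L.antitone (by omega))) (K.mono n)
  smul_le n := by
    rw [Submodule.smul_le]
    intro r hr x hx
    obtain ⟨z, ⟨w, hw, rfl⟩, k, hk, rfl⟩ := Submodule.mem_sup.1 hx
    rw [smul_add]
    refine Submodule.add_mem_sup ⟨r • w, ?_, ?_⟩ (Filt.smul_mem K hr hk)
    · rcases n with _ | n
      · exact Submodule.smul_mem _ _ hw
      · exact Filt.smul_mem L hr hw
    · simp

theorem evFin_main {c : ℕ} (y : Fin c → R)
    {J : Ideal R} (hJ : J = Ideal.span (Set.range y)) (T : Finset (Fin c)) :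
    ∀ (L U : J.Filtration M), L.Stable → U ≤ L →
    (∃ n₁ : ℕ, ∀ n ≥ n₁, ∀ i ∉ T, ∀ x ∈ L.N n, y i • x ∈ U.N (n + 1)) →
    EvFin (fun n => assSet (L.N n) (U.N n)) := by
  have hyJ : ∀ i, y i ∈ J := fun i => by rw [hJ]; exact Ideal.subset_span ⟨i, rfl⟩
  induction T using Finset.strongInduction with
  | H T ih =>
  intro L U hLs hUL hT
  rcases T.eq_empty_or_nonempty with rfl | ⟨j, hjT⟩
  · obtain ⟨n₁, hn₁⟩ := hT
    obtain ⟨n₂, hn₂⟩ := hLs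
    refine ⟨n₁ + n₂ + 1, Set.finite_empty.subset ?_⟩
    rintro q ⟨n, hn, hq⟩
    change q ∈ assSet _ _ at hq
    rw [assSet_empty] at hq
    · exact hq
    obtain ⟨k, rfl⟩ : ∃ k, n = k + 1 := ⟨n - 1, by omega⟩
    rw [← hn₂ k (by omega)]
    intro x hx
    nth_rw 1 [hJ] at hx
    obtain ⟨f, hf, rfl⟩ := mem_span_smul hx
    exact Submodule.sum_mem _ (fun i _ => hn₁ k (by omega) i (by simp) _ (hf i))
  have h2 : ∀ i, EvFin (fun n => assSet ((torsI L U (y j) i).N n) (U.N n)) := by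
    intro i
    induction i with
    | zero =>
      refine ⟨0, Set.finite_empty.subset ?_⟩
      rintro q ⟨n, hn, hq⟩
      change q ∈ assSet _ _ at hq
      rw [assSet_empty (torsI_zero_le L U (y j) n)] at hq
      exact hq
    | succ i ihi =>
      have h3 := ih (T.erase j) (Finset.erase_ssubset hjT) (torsI L U (y j) (i + 1))
        (torsI L U (y j) i) (hLs.of_le (fun n => torsI_le L U _ _ n))
        (fun n => torsI_mono (hyJ j) (Nat.le_succ i) n)
        (by
          obtain ⟨n₁, hn₁⟩ := hT
          refine ⟨n₁, fun n hn k hk x hx => ?_⟩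
          by_cases hkj : k = j
          · subst hkj
            exact smul_torsI_succ (hyJ k) hx
          · exact le_torsI hUL (hyJ j) _ _ (hn₁ n hn k
              (fun h => hk (Finset.mem_erase.2 ⟨hkj, h⟩)) x (torsI_le L U _ _ n hx)))
      exact (ihi.union h3).sub 0 (fun n _ => assSet_union (le_torsI hUL (hyJ j) _ _))
  have h1 : EvFin (fun n => assSet (L.N n) ((torsU L U (y j) (hyJ j)).N n)) := by
    set K := torsU L U (y j) (hyJ j) with hK
    have hKL : ∀ n, K.N n ≤ L.N n := fun n => torsU_le L U _ _ n
    have hSL : shiftF L K (y j) ≤ L := by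
      intro n
      refine sup_le ?_ (hKL n)
      rintro _ ⟨w, hw, rfl⟩
      rcases n with _ | n
      · exact Submodule.smul_mem _ _ hw
      · exact Filt.smul_mem L (hyJ j) hw
    have h3 := ih (T.erase j) (Finset.erase_ssubset hjT) L (shiftF L K (y j)) hLs hSL
      (by
        obtain ⟨n₁, hn₁⟩ := hT
        refine ⟨n₁, fun n hn k hk x hx => ?_⟩
        by_cases hkj : k = j
        · subst hkj
          exact Submodule.mem_sup_left ⟨x, hx, rfl⟩
        · exact Submodule.mem_sup_right (le_torsU hUL (hyJ j) _ (hn₁ n hn k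
              (fun h => hk (Finset.mem_erase.2 ⟨hkj, h⟩)) x hx)))
    obtain ⟨n₁, h4⟩ := h3
    refine ⟨n₁, (h4.union (assSet_finite (L.N n₁) (K.N n₁))).subset ?_⟩
    rintro q ⟨n, hn, hq⟩
    induction n, hn using Nat.le_induction with
    | base => exact Or.inr hq
    | succ n hn ihn =>
      rcases assSet_union (K := (shiftF L K (y j)).N (n + 1)) le_sup_right hq with h | h
      · apply ihn
        obtain ⟨hqp, x, hx, h⟩ := h
        obtain ⟨z, ⟨w, hw, rfl⟩, k, hk, rfl⟩ := Submodule.mem_sup.1 hx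
        have hw' : w ∈ L.N n := hw
        refine ⟨hqp, w, hw', fun r => ?_⟩
        rw [h, smul_add, Submodule.add_mem_iff_left _ (Submodule.smul_mem _ r hk)]
        change r • y j • w ∈ _ ↔ _
        rw [smul_comm]
        exact ⟨fun h => mem_torsU_of_smul (Submodule.smul_mem _ _ hw') h,
          fun h => Filt.smul_mem K (hyJ j) h⟩
      · exact Or.inl ⟨n + 1, by omega, h⟩
  obtain ⟨i, n₀, hi⟩ := torsU_stab (U := U) hLs (hyJ j)
  refine ((h2 i).union h1).sub n₀ (fun n hn => ?_)
  change _ ⊆ assSet _ _ ∪ assSet _ _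
  rw [← hi n hn]
  exact assSet_union (le_torsU hUL (hyJ j) n)

end main

section vnumber

variable {R M : Type*} [CommRing R] [IsNoetherianRing R]
    [AddCommGroup M] [Module R M] [Module.Finite R M]

/-- The filtration `I ^ n N`, as a `J`-filtration. -/
def powF {I J : Ideal R} (hJI : J ≤ I) (N : Submodule R M) : J.Filtration M where
  N n := I ^ n • N
  mono n := Submodule.smul_mono_left (Ideal.pow_le_pow_right (Nat.le_succ n))
  smul_le n := by
    rw [pow_succ', mul_smul]
    exact Submodule.smul_mono_left hJI

theorem powF_stable {I J : Ideal R} (hJI : J ≤ I) (N : Submodule R M) (m0 : ℕ)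
    (hred : J * I ^ m0 = I ^ (m0 + 1)) : (powF hJI N).Stable := by
  refine ⟨m0, fun n hn => ?_⟩
  change J • (I ^ n • N) = I ^ (n + 1) • N
  obtain ⟨k, rfl⟩ := Nat.exists_eq_add_of_le hn
  rw [← mul_smul, pow_add, ← mul_assoc, hred, ← pow_add, show m0 + 1 + k = m0 + k + 1 by omega]

/-- Elements of `F` sent into `G` by `p`. -/
def primeL {J : Ideal R} (F G : J.Filtration M) (p : Ideal R) : J.Filtration M where
  N n :=
    { carrier := {x | x ∈ F.N n ∧ ∀ r ∈ p, r • x ∈ G.N n}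
      zero_mem' := ⟨Submodule.zero_mem _, fun r _ => by simp⟩
      add_mem' := by
        rintro x z ⟨h1, h2⟩ ⟨h3, h4⟩
        refine ⟨Submodule.add_mem _ h1 h3, fun r hr => ?_⟩
        rw [smul_add]
        exact Submodule.add_mem _ (h2 r hr) (h4 r hr)
      smul_mem' := by
        rintro s x ⟨h1, h2⟩
        refine ⟨Submodule.smul_mem _ _ h1, fun r hr => ?_⟩
        rw [smul_comm]
        exact Submodule.smul_mem _ _ (h2 r hr) }
  mono n := fun x hx => ⟨F.mono n hx.1, fun r hr => G.mono n (hx.2 r hr)⟩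
  smul_le n := by
    rw [Submodule.smul_le]
    rintro s hs x ⟨h1, h2⟩
    refine ⟨Filt.smul_mem F hs h1, fun r hr => ?_⟩
    rw [smul_comm]
    exact Filt.smul_mem G hs (h2 r hr)

/-- Elements of `primeL` killed by a homogeneous element outside `p`. -/
def primeU {J : Ideal R} (𝒜 : ℤ → AddSubgroup R) [GradedRing 𝒜] (F G : J.Filtration M)
    (p : Ideal R) (hp : p.IsPrime) : J.Filtration M where
  N n :=
    { carrier := {x | x ∈ (primeL F G p).N n ∧ ∃ e, ∃ s ∈ 𝒜 e, s ∉ p ∧ s • x ∈ G.N n}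
      zero_mem' := ⟨Submodule.zero_mem _, 0, 1, SetLike.GradedOne.one_mem,
        fun h => hp.ne_top ((Ideal.eq_top_iff_one p).2 h), by simp⟩
      add_mem' := by
        rintro x z ⟨h1, e, s, hs, hsp, h2⟩ ⟨h3, e', s', hs', hsp', h4⟩
        refine ⟨Submodule.add_mem _ h1 h3, e + e', s * s', SetLike.GradedMul.mul_mem hs hs',
          fun h => (hp.mem_or_mem h).elim hsp hsp', ?_⟩
        rw [smul_add]
        refine Submodule.add_mem _ ?_ ?_
        · rw [mul_comm, mul_smul]
          exact Submodule.smul_mem _ _ h2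
        · rw [mul_smul]
          exact Submodule.smul_mem _ _ h4
      smul_mem' := by
        rintro r x ⟨h1, e, s, hs, hsp, h2⟩
        refine ⟨Submodule.smul_mem _ _ h1, e, s, hs, hsp, ?_⟩
        rw [smul_comm]
        exact Submodule.smul_mem _ _ h2 }
  mono n := by
    rintro x ⟨h1, e, s, hs, hsp, h2⟩
    exact ⟨(primeL F G p).mono n h1, e, s, hs, hsp, G.mono n h2⟩
  smul_le n := by
    rw [Submodule.smul_le]
    rintro r hr x ⟨h1, e, s, hs, hsp, h2⟩
    refine ⟨Filt.smul_mem _ hr h1, e, s, hs, hsp, ?_⟩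
    rw [smul_comm]
    exact Filt.smul_mem G hr h2

variable (𝒜 : ℤ → AddSubgroup R) (ℳ : ℤ → AddSubgroup M)
    [GradedRing 𝒜] [DirectSum.Decomposition ℳ]

theorem homSub_primeL (hsmul : ∀ (i j : ℤ), ∀ r ∈ 𝒜 i, ∀ x ∈ ℳ j, r • x ∈ ℳ (i + j))
    {J : Ideal R} {F G : J.Filtration M} (hF : ∀ n, HomSub ℳ (F.N n))
    (hG : ∀ n, HomSub ℳ (G.N n)) {p : Ideal R} (hp : Ideal.IsHomogeneous 𝒜 p) (n : ℕ) :
    HomSub ℳ ((primeL F G p).N n) := by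
  classical
  rintro x ⟨h1, h2⟩ u
  refine ⟨hF n x h1 u, fun r hr => ?_⟩
  rw [← DirectSum.sum_support_decompose 𝒜 r, Finset.sum_smul]
  refine Submodule.sum_mem _ (fun i _ => ?_)
  have h3 := hG n _ (h2 _ (hp i hr)) (u + i)
  rwa [comp_smul 𝒜 ℳ hsmul (SetLike.coe_mem _), add_sub_cancel_right] at h3

theorem homSub_primeU (hsmul : ∀ (i j : ℤ), ∀ r ∈ 𝒜 i, ∀ x ∈ ℳ j, r • x ∈ ℳ (i + j))
    {J : Ideal R} {F G : J.Filtration M} (hF : ∀ n, HomSub ℳ (F.N n))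
    (hG : ∀ n, HomSub ℳ (G.N n)) {p : Ideal R} (hp : Ideal.IsHomogeneous 𝒜 p)
    (hpp : p.IsPrime) (n : ℕ) :
    HomSub ℳ ((primeU 𝒜 F G p hpp).N n) := by
  rintro x ⟨h1, e, s, hs, hsp, h2⟩ u
  refine ⟨homSub_primeL 𝒜 ℳ hsmul hF hG hp n x h1 u, e, s, hs, hsp, ?_⟩
  have h3 := hG n _ h2 (u + e)
  rwa [comp_smul 𝒜 ℳ hsmul hs, add_sub_cancel_right] at h3

theorem colon_homogeneous (hsmul : ∀ (i j : ℤ), ∀ r ∈ 𝒜 i, ∀ x ∈ ℳ j, r • x ∈ ℳ (i + j))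
    {N : Submodule R M} (hN : HomSub ℳ N) {u : ℤ} {x : M} (hx : x ∈ ℳ u) {q : Ideal R}
    (hq : ∀ r, r ∈ q ↔ r • x ∈ N) : Ideal.IsHomogeneous 𝒜 q := by
  intro i r hr
  rw [hq] at hr ⊢
  have := hN _ hr (i + u)
  rwa [comp_smul' 𝒜 ℳ hsmul hx, add_sub_cancel_right] at this

theorem degSet_prime (hsmul : ∀ (i j : ℤ), ∀ r ∈ 𝒜 i, ∀ x ∈ ℳ j, r • x ∈ ℳ (i + j))
    {J : Ideal R} {F G : J.Filtration M}
    (hG : ∀ n, HomSub ℳ (G.N n)) {p : Ideal R} (hpp : p.IsPrime) (n : ℕ) (u : ℤ) :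
    u ∈ degSet ℳ ((primeL F G p).N n) ((primeU 𝒜 F G p hpp).N n) ↔
    ∃ x ∈ ℳ u, x ∈ F.N n ∧ ∀ r, r ∈ p ↔ r • x ∈ G.N n := by
  classical
  constructor
  · rintro ⟨x, hx, h1, h2⟩
    refine ⟨x, hx, h1.1, fun r => ⟨h1.2 r, fun hr => ?_⟩⟩
    rw [← DirectSum.sum_support_decompose 𝒜 r]
    refine Submodule.sum_mem _ (fun i _ => ?_)
    by_contra hcon
    refine h2 ⟨h1, i, _, SetLike.coe_mem _, hcon, ?_⟩
    have := hG n _ hr (i + u)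
    rwa [comp_smul' 𝒜 ℳ hsmul hx, add_sub_cancel_right] at this
  · rintro ⟨x, hx, h1, h2⟩
    refine ⟨x, hx, ⟨h1, fun r hr => (h2 r).1 hr⟩, ?_⟩
    rintro ⟨_, e, s, _, hsp, hs⟩
    exact hsp ((h2 s).2 hs)

/-- The set of degrees defining the v-number. -/
def vSet (L U : Submodule R M) : Set ℤ :=
  {u : ℤ | ∃ x ∈ ℳ u, x ∈ L ∧ ∃ q : Ideal R, q.IsPrime ∧ ∀ r : R, r ∈ q ↔ r • x ∈ U}

theorem evLin_v (hsmul : ∀ (i j : ℤ), ∀ r ∈ 𝒜 i, ∀ x ∈ ℳ j, r • x ∈ ℳ (i + j))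
    (hA : ∀ i : ℤ, i < 0 → 𝒜 i = ⊥)
    {c : ℕ} (y : Fin c → R) (d : Fin c → ℤ) (hy : ∀ j, y j ∈ 𝒜 (d j))
    {J : Ideal R} (hJ : J = Ideal.span (Set.range y))
    (F G : J.Filtration M) (hFs : F.Stable) (hGF : G ≤ F)
    (hF : ∀ n, HomSub ℳ (F.N n)) (hG : ∀ n, HomSub ℳ (G.N n)) :
    EvLin d (fun _ => True) (fun n => vSet ℳ (F.N n) (G.N n)) := by
  classical
  obtain ⟨n₁, hfin⟩ := evFin_main y hJ Finset.univ F G hFs hGF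
    ⟨0, fun n _ i hi => absurd (Finset.mem_univ i) hi⟩
  let s : Ideal R → ℕ → Set ℤ := fun p n =>
    {u | p.IsPrime ∧ Ideal.IsHomogeneous 𝒜 p ∧
      ∃ x ∈ ℳ u, x ∈ F.N n ∧ ∀ r, r ∈ p ↔ r • x ∈ G.N n}
  have hs : ∀ p ∈ hfin.toFinset, EvLin d (fun _ => True) (s p) := by
    intro p _
    by_cases hp : p.IsPrime ∧ Ideal.IsHomogeneous 𝒜 p
    · have h1 := evLin_main 𝒜 ℳ hsmul hA y d hy hJ Finset.univ (primeL F G p)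
        (primeU 𝒜 F G p hp.1) (hFs.of_le (fun n x hx => hx.1)) (fun n x hx => hx.1)
        (homSub_primeL 𝒜 ℳ hsmul hF hG hp.2) (homSub_primeU 𝒜 ℳ hsmul hF hG hp.2 hp.1)
        ⟨0, fun n _ i hi => absurd (Finset.mem_univ i) hi⟩
      refine (h1.mono (fun _ _ => trivial)).congr 0 (fun n _ => ?_)
      ext u
      exact (degSet_prime 𝒜 ℳ hsmul hG hp.1 n u).trans
        ⟨fun h => ⟨hp.1, hp.2, h⟩, fun h => h.2.2⟩
    · refine Or.inl ⟨0, fun n _ => ?_⟩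
      ext u
      simp only [Set.mem_empty_iff_false, iff_false]
      exact fun h => hp ⟨h.1, h.2.1⟩
  refine (EvLin.biUnion hfin.toFinset s hs).congr n₁ (fun n hn => ?_)
  ext u
  constructor
  · rintro ⟨p, _, hp, _, x, hx, h1, h2⟩
    exact ⟨x, hx, h1, p, hp, h2⟩
  · rintro ⟨x, hx, h1, p, hp, h2⟩
    exact ⟨p, hfin.mem_toFinset.2 ⟨n, hn, hp, x, h1, h2⟩, hp,
      colon_homogeneous 𝒜 ℳ hsmul (hG n) hx h2, x, hx, h1, h2⟩

/-- The ideal `(N : x)`. -/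
def colonI (N : Submodule R M) (x : M) : Ideal R := N.comap (LinearMap.toSpanSingleton R M x)

theorem mem_colonI {N : Submodule R M} {x : M} {r : R} : r ∈ colonI N x ↔ r • x ∈ N := Iff.rfl

theorem exists_hom_prime (hsmul : ∀ (i j : ℤ), ∀ r ∈ 𝒜 i, ∀ x ∈ ℳ j, r • x ∈ ℳ (i + j))
    {N : Submodule R M} (hN : HomSub ℳ N) {u : ℤ} {z : M} (hz : z ∈ ℳ u) (hzN : z ∉ N) :
    ∃ e, ∃ r ∈ 𝒜 e, (colonI N (r • z)).IsPrime := by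
  let S : Set (Ideal R) := {A | ∃ e, ∃ r ∈ 𝒜 e, r • z ∉ N ∧ A = colonI N (r • z)}
  have hS : S.Nonempty := ⟨_, 0, 1, SetLike.GradedOne.one_mem, by simpa using hzN, rfl⟩
  obtain ⟨A, ⟨e, r, hr, hrz, rfl⟩, hmax⟩ := set_has_maximal_iff_noetherian.2
    (inferInstance : IsNoetherian R R) S hS
  refine ⟨e, r, hr, ?_⟩
  refine Ideal.IsHomogeneous.isPrime_of_homogeneous_mem_or_mem (𝒜 := 𝒜)
    (colon_homogeneous 𝒜 ℳ hsmul hN (hsmul _ _ _ hr _ hz) (fun _ => mem_colonI)) ?_ ?_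
  · intro h
    rw [Ideal.eq_top_iff_one, mem_colonI, one_smul] at h
    exact hrz h
  · rintro a b ⟨i, ha⟩ ⟨k, hb⟩ hab
    by_contra hcon
    push Not at hcon
    obtain ⟨ha', hb'⟩ := hcon
    refine hmax (colonI N ((b * r) • z)) ⟨k + e, b * r, SetLike.GradedMul.mul_mem hb hr, ?_, rfl⟩ ?_
    · rwa [mul_smul]
    · refine lt_of_le_of_ne ?_ ?_
      · intro s hs
        rw [mem_colonI] at hs ⊢
        rw [mul_smul, smul_comm]
        exact Submodule.smul_mem _ _ hs
      · intro h
        apply ha'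
        rw [h, mem_colonI, mul_smul, smul_smul]
        exact hab

theorem v_upper (hsmul : ∀ (i j : ℤ), ∀ r ∈ 𝒜 i, ∀ x ∈ ℳ j, r • x ∈ ℳ (i + j))
    {c : ℕ} (y : Fin c → R) (d : Fin c → ℤ) (hy : ∀ j, y j ∈ 𝒜 (d j))
    {J : Ideal R} (hJ : J = Ideal.span (Set.range y))
    (F G : J.Filtration M)
    (hG : ∀ n, HomSub ℳ (G.N n)) (j : Fin c) (hW : Wit ℳ y F G j) :
    ∃ b : ℤ, ∃ n₁ : ℕ, ∀ n ≥ n₁, d j * (n : ℤ) + b ∈ vSet ℳ (F.N n) (G.N n) := by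
  have hyJ : y j ∈ J := by rw [hJ]; exact Ideal.subset_span ⟨j, rfl⟩
  obtain ⟨n₀, u, x, hx, hxF, hk⟩ := hW
  have hmono : Monotone (fun k : ℕ => colonI (G.N (n₀ + k)) (y j ^ k • x)) := by
    refine monotone_nat_of_le_succ (fun k r hr => ?_)
    rw [mem_colonI] at hr ⊢
    rw [pow_succ', mul_smul, smul_comm]
    exact Filt.smul_mem G hyJ hr
  obtain ⟨k₀, hk₀⟩ := monotone_stabilizes_iff_noetherian.2 (inferInstance : IsNoetherian R R)
    ⟨_, hmono⟩
  have hdeg : ∀ k : ℕ, y j ^ k • x ∈ ℳ (k • d j + u) := fun k =>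
    hsmul _ _ _ (SetLike.pow_mem_graded k (hy j)) _ hx
  obtain ⟨e, r, hr, hprime⟩ := exists_hom_prime 𝒜 ℳ hsmul (hG (n₀ + k₀)) (hdeg k₀) (hk k₀)
  refine ⟨e + u - d j * (n₀ : ℤ), n₀ + k₀, fun n hn => ?_⟩
  obtain ⟨k, rfl⟩ : ∃ k, n = n₀ + k := ⟨n - n₀, by omega⟩
  have h1 := hk₀ k (by omega)
  change colonI (G.N (n₀ + k₀)) (y j ^ k₀ • x) = colonI (G.N (n₀ + k)) (y j ^ k • x) at h1
  refine ⟨r • y j ^ k • x, ?_, Submodule.smul_mem _ _ (Filt.pow_smul_mem F hyJ hxF k),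
    colonI (G.N (n₀ + k₀)) (r • y j ^ k₀ • x), hprime, fun s => ?_⟩
  · have h2 := hsmul _ _ _ hr _ (hdeg k)
    have h3 : d j * ((n₀ + k : ℕ) : ℤ) + (e + u - d j * (n₀ : ℤ)) = e + (k • d j + u) := by
      rw [nsmul_eq_mul]; push_cast; ring
    rwa [h3]
  · have h4 : s * r ∈ colonI (G.N (n₀ + k₀)) (y j ^ k₀ • x) ↔
        s * r ∈ colonI (G.N (n₀ + k)) (y j ^ k • x) := by rw [h1]
    rw [mem_colonI, mem_colonI, mul_smul, mul_smul] at h4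
    exact h4

end vnumber

end VNum

/-- Same setup as Statement 9.  If `I^n M ⊄ I^n N` for all sufficiently
large `n`, then there are `a ∈ {d 1, …, d c}` and `b, b' ∈ ℤ` such that, for all sufficiently
large `n`, `indeg(I^n M / I^n N) = a * n + b` and `v(I^n M / I^n N) = a * n + b'`; i.e. both
functions are eventually linear with the same leading coefficient `a ∈ {d 1, …, d c}`.
Here `indeg(I^n M / I^n N)` is the least degree `u` whose component of `I^n M` is not
contained in `I^n N`, and `v(I^n M / I^n N)` is the least degree of a homogeneous
`x ∈ I^n M` such that `(I^n N :_R x)` is prime. -/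
theorem indeg_and_v_number_of_InM_mod_InN_eventually_linear
    {R M : Type*} [CommRing R] [IsNoetherianRing R]
    [AddCommGroup M] [Module R M] [Module.Finite R M]
    (𝒜 : ℤ → AddSubgroup R) (ℳ : ℤ → AddSubgroup M)
    [GradedRing 𝒜] [DirectSum.Decomposition ℳ]
    (hsmul : ∀ (i j : ℤ), ∀ r ∈ 𝒜 i, ∀ x ∈ ℳ j, r • x ∈ ℳ (i + j))
    (hA : ∀ i : ℤ, i < 0 → 𝒜 i = ⊥)
    (I : Ideal R) (hI : Ideal.IsHomogeneous 𝒜 I)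
    (N : Submodule R M) (hN : ∀ x ∈ N, ∀ i : ℤ, (DirectSum.decompose ℳ x i : M) ∈ N)
    (c : ℕ) (y : Fin c → R) (d : Fin c → ℤ) (hdmono : Monotone d)
    (hy : ∀ j, y j ∈ 𝒜 (d j))
    (J : Ideal R) (hJgen : J = Ideal.span (Set.range y)) (hJI : J ≤ I)
    (m0 : ℕ) (hred : J * I ^ m0 = I ^ (m0 + 1))
    (hnz : ∃ n₀ : ℕ, ∀ n ≥ n₀, ¬ (I ^ n • ⊤ : Submodule R M) ≤ (I ^ n • N : Submodule R M)) :
    ∃ j : Fin c, ∃ b b' : ℤ, ∃ n₁ : ℕ, ∀ n ≥ n₁,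
      sInf {u : ℤ | ∃ x ∈ ℳ u, x ∈ (I ^ n • ⊤ : Submodule R M) ∧
          x ∉ (I ^ n • N : Submodule R M)} = d j * (n : ℤ) + b ∧
      sInf {u : ℤ | ∃ x ∈ ℳ u, x ∈ (I ^ n • ⊤ : Submodule R M) ∧
          ∃ q : Ideal R, q.IsPrime ∧ ∀ r : R, r ∈ q ↔ r • x ∈ (I ^ n • N : Submodule R M)}
        = d j * (n : ℤ) + b' := by
  classical
  set F : J.Filtration M := powF hJI ⊤ with hFdef
  set G : J.Filtration M := powF hJI N with hGdef
  have hF : ∀ n, HomSub ℳ (F.N n) := fun n =>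
    homSub_pow_smul 𝒜 ℳ hsmul hI (homSub_top ℳ) n
  have hG : ∀ n, HomSub ℳ (G.N n) := fun n => homSub_pow_smul 𝒜 ℳ hsmul hI hN n
  have hGF : G ≤ F := fun n => smul_mono_right _ le_top
  have hFs : F.Stable := powF_stable hJI ⊤ m0 hred
  have h1 := evLin_main 𝒜 ℳ hsmul hA y d hy hJgen Finset.univ F G hFs hGF hF hG
    ⟨0, fun n _ i hi => absurd (Finset.mem_univ i) hi⟩
  have h2 := evLin_v 𝒜 ℳ hsmul hA y d hy hJgen F G hFs hGF hF hG
  rcases h1 with ⟨n₁, h1⟩ | ⟨j, hW, b, n₁, h1⟩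
  · exfalso
    obtain ⟨n₀, hn₀⟩ := hnz
    apply hn₀ (n₀ + n₁) (by omega)
    intro x hx
    refine mem_of_comp ℳ (fun i => ?_)
    by_contra hcon
    have h3 : i ∈ degSet ℳ (F.N (n₀ + n₁)) (G.N (n₀ + n₁)) :=
      ⟨_, SetLike.coe_mem _, hF _ x hx i, hcon⟩
    rw [show degSet ℳ (F.N (n₀ + n₁)) (G.N (n₀ + n₁)) = ∅ from h1 _ (by omega)] at h3
    exact h3
  obtain ⟨b₂, n₂, hv⟩ := v_upper 𝒜 ℳ hsmul y d hy hJgen F G hG j hW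
  rcases h2 with ⟨n₃, h2⟩ | ⟨j', _, b', n₃, h2⟩
  · exfalso
    have h3 := hv (n₂ + n₃) (by omega)
    rw [show vSet ℳ (F.N (n₂ + n₃)) (G.N (n₂ + n₃)) = ∅ from h2 _ (by omega)] at h3
    exact h3
  have hsub : ∀ n, vSet ℳ (F.N n) (G.N n) ⊆ degSet ℳ (F.N n) (G.N n) := by
    rintro n u ⟨x, hx, hxF, q, hq, hqx⟩
    refine ⟨x, hx, hxF, fun hxG => hq.ne_top ((Ideal.eq_top_iff_one q).2 ((hqx 1).2 ?_))⟩
    rwa [one_smul]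
  have hle : d j' ≤ d j := slope_le _ _ b' b₂ (n₂ + n₃)
    (fun n hn => (h2 n (by omega)).2 (hv n (by omega)))
  have hge : d j ≤ d j' := slope_le _ _ b b' (n₁ + n₃)
    (fun n hn => (h1 n (by omega)).2 (hsub n (h2 n (by omega)).1))
  have hdd : d j' = d j := le_antisymm hle hge
  refine ⟨j, b, b', n₁ + n₃, fun n hn => ⟨(h1 n (by omega)).csInf_eq, ?_⟩⟩
  rw [← hdd]
  exact (h2 n (by omega)).csInf_eq
end

section
/- Assume Ass_R(I^n M / I^n N) is nonempty for all sufficiently large n. Then there exist a ∈ {d_1, …, d_c}, b' ∈ ℤ and e ∈ ℤ such that v(I^n M / I^n N) = a·n + b' for all sufficiently large n, and v(M / I^n N) ≤ a·n + e for all n ≥ 1. -/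
set_option linter.unusedSectionVars false

namespace VNum

open DirectSum

section Graded

variable {R M : Type*} [CommRing R] [AddCommGroup M] [Module R M]
  (𝒜 : ℤ → AddSubgroup R) (ℳ : ℤ → AddSubgroup M)
  [GradedRing 𝒜] [DirectSum.Decomposition ℳ]

/-- A graded submodule. -/
def Gr (L : Submodule R M) : Prop := ∀ x ∈ L, ∀ i : ℤ, (decompose ℳ x i : M) ∈ L

theorem comp_add (x y : M) (u : ℤ) :
    (decompose ℳ (x + y) u : M) = decompose ℳ x u + decompose ℳ y u := by
  rw [decompose_add]; rfl

theorem comp_sum {ι : Type*} (s : Finset ι) (f : ι → M) (u : ℤ) :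
    (decompose ℳ (∑ i ∈ s, f i) u : M) = ∑ i ∈ s, (decompose ℳ (f i) u : M) := by
  classical
  induction s using Finset.induction_on with
  | empty => simp
  | insert a s ha ih => rw [Finset.sum_insert ha, Finset.sum_insert ha, comp_add, ih]

/-- Components of `r • m` with `m` homogeneous. -/
theorem comp_smul_hom (hsmul : ∀ (i j : ℤ), ∀ r ∈ 𝒜 i, ∀ x ∈ ℳ j, r • x ∈ ℳ (i + j))
    (r : R) {m : M} {k : ℤ} (hm : m ∈ ℳ k) (u : ℤ) :
    (decompose ℳ (r • m) u : M) = (decompose 𝒜 r (u - k) : R) • m := by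
  induction r using DirectSum.Decomposition.inductionOn 𝒜 with
  | zero => simp
  | @homogeneous i a =>
    have h := hsmul i k a a.2 m hm
    by_cases hu : i + k = u
    · subst hu
      rw [decompose_of_mem_same ℳ h, add_sub_cancel_right, decompose_of_mem_same 𝒜 a.2]
    · rw [decompose_of_mem_ne ℳ h hu, decompose_of_mem_ne 𝒜 a.2 (by omega), zero_smul]
  | add a b ha hb =>
    rw [add_smul, comp_add, ha, hb, comp_add 𝒜, add_smul]

/-- Components of `r • m` with `r` homogeneous. -/
theorem comp_hom_smul (hsmul : ∀ (i j : ℤ), ∀ r ∈ 𝒜 i, ∀ x ∈ ℳ j, r • x ∈ ℳ (i + j))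
    {r : R} (m : M) {i : ℤ} (hr : r ∈ 𝒜 i) (u : ℤ) :
    (decompose ℳ (r • m) u : M) = r • (decompose ℳ m (u - i) : M) := by
  induction m using DirectSum.Decomposition.inductionOn ℳ with
  | zero => simp
  | @homogeneous k a =>
    have h := hsmul i k r hr a a.2
    by_cases hu : i + k = u
    · subst hu
      rw [decompose_of_mem_same ℳ h, add_sub_cancel_left, decompose_of_mem_same ℳ a.2]
    · rw [decompose_of_mem_ne ℳ h hu, decompose_of_mem_ne ℳ a.2 (by omega), smul_zero]
  | add a b ha hb =>
    rw [smul_add, comp_add, ha, hb, comp_add, smul_add]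

theorem gr_smul (hsmul : ∀ (i j : ℤ), ∀ r ∈ 𝒜 i, ∀ x ∈ ℳ j, r • x ∈ ℳ (i + j))
    {I : Ideal R} (hI : I.IsHomogeneous 𝒜) {N : Submodule R M} (hN : Gr ℳ N) :
    Gr ℳ (I • N) := by
  classical
  intro x hx u
  induction hx using Submodule.smul_induction_on' with
  | smul r hr n hn =>
    rw [← sum_support_decompose ℳ n, Finset.smul_sum, comp_sum]
    refine Submodule.sum_mem _ fun k _ => ?_
    rw [comp_smul_hom 𝒜 ℳ hsmul r (decompose ℳ n k).2]
    exact Submodule.smul_mem_smul (hI _ hr) (hN n hn k)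
  | add x hx y hy ihx ihy =>
    rw [comp_add]; exact Submodule.add_mem _ ihx ihy

theorem gr_pow_smul (hsmul : ∀ (i j : ℤ), ∀ r ∈ 𝒜 i, ∀ x ∈ ℳ j, r • x ∈ ℳ (i + j))
    {I : Ideal R} (hI : I.IsHomogeneous 𝒜) {N : Submodule R M} (hN : Gr ℳ N) (n : ℕ) :
    Gr ℳ (I ^ n • N) := by
  induction n with
  | zero => simpa using hN
  | succ n ih => rw [pow_succ', Submodule.mul_smul]; exact gr_smul 𝒜 ℳ hsmul hI ih

theorem bounded (hsmul : ∀ (i j : ℤ), ∀ r ∈ 𝒜 i, ∀ x ∈ ℳ j, r • x ∈ ℳ (i + j))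
    (hA : ∀ i : ℤ, i < 0 → 𝒜 i = ⊥) [Module.Finite R M] :
    ∃ B : ℤ, ∀ u < B, ∀ x ∈ ℳ u, x = 0 := by
  classical
  obtain ⟨s, hs⟩ := Module.Finite.fg_top (R := R) (M := M)
  let T : Finset ℤ := s.biUnion fun m => (decompose ℳ m).support
  obtain ⟨B, hB⟩ := T.bddBelow
  refine ⟨B, fun u hu x hx => ?_⟩
  have key : ∀ x ∈ Submodule.span R (s : Set M), ∀ u < B, (decompose ℳ x u : M) = 0 := by
    intro x hx
    induction hx using Submodule.span_induction with
    | zero => simp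
    | add x y _ _ hx hy => intro u hu; rw [comp_add, hx u hu, hy u hu, add_zero]
    | mem x hx =>
      intro u hu
      by_contra h
      have : u ∈ T := Finset.mem_biUnion.2 ⟨x, hx, by
        rw [DFinsupp.mem_support_iff]; intro h0; exact h (by rw [h0]; rfl)⟩
      exact absurd (hB this) (by omega)
    | smul r x _ hx =>
      intro u hu
      rw [← sum_support_decompose ℳ x, Finset.smul_sum, comp_sum]
      refine Finset.sum_eq_zero fun k _ => ?_
      rw [comp_smul_hom 𝒜 ℳ hsmul r (decompose ℳ x k).2]
      by_cases hk : k < B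
      · rw [hx k hk, smul_zero]
      · have h0 := (decompose 𝒜 r (u - k)).2
        have h1 : (decompose 𝒜 r (u - k) : R) ∈ (⊥ : AddSubgroup R) :=
          (hA (u - k) (by omega)) ▸ h0
        rw [AddSubgroup.mem_bot.1 h1, zero_smul]
  have := key x (by rw [hs]; trivial) u hu
  rwa [decompose_of_mem_same ℳ hx] at this

end Graded

section EL

variable {c : ℕ} (d : Fin c → ℤ)

/-- Eventually empty or eventually has a least element which is linear in `n`. -/
def EL (S : ℕ → Set ℤ) : Prop :=
  (∃ n₀ : ℕ, ∀ n ≥ n₀, S n = ∅) ∨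
    ∃ j : Fin c, ∃ b : ℤ, ∃ n₀ : ℕ, ∀ n ≥ n₀, IsLeast (S n) (d j * n + b)

variable {d}

theorem EL.congr {S T : ℕ → Set ℤ} (h : EL d S) (n₁ : ℕ) (hST : ∀ n ≥ n₁, S n = T n) : EL d T := by
  rcases h with ⟨n₀, h⟩ | ⟨j, b, n₀, h⟩
  · exact .inl ⟨max n₀ n₁, fun n hn => by
      rw [← hST n (by omega)]; exact h n (by omega)⟩
  · exact .inr ⟨j, b, max n₀ n₁, fun n hn => by
      rw [← hST n (by omega)]; exact h n (by omega)⟩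

theorem lin_cmp (a b a' b' : ℤ) :
    (∃ n₀ : ℕ, ∀ n ≥ n₀, a * (n : ℤ) + b ≤ a' * n + b') ∨
    (∃ n₀ : ℕ, ∀ n ≥ n₀, a' * (n : ℤ) + b' ≤ a * n + b) := by
  rcases lt_trichotomy a a' with h | h | h
  · left
    refine ⟨(b - b').toNat, fun n hn => ?_⟩
    have : b - b' ≤ n := by omega
    nlinarith
  · subst h
    rcases le_total b b' with h | h
    · exact .inl ⟨0, fun n _ => by linarith⟩
    · exact .inr ⟨0, fun n _ => by linarith⟩
  · right
    refine ⟨(b' - b).toNat, fun n hn => ?_⟩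
    have : b' - b ≤ n := by omega
    nlinarith

theorem EL.union {S T : ℕ → Set ℤ} (hS : EL d S) (hT : EL d T) : EL d (fun n => S n ∪ T n) := by
  rcases id hS with ⟨n₀, h⟩ | ⟨j, b, n₀, h⟩
  · exact hT.congr n₀ fun n hn => by simp [h n hn]
  rcases id hT with ⟨n₁, h'⟩ | ⟨j', b', n₁, h'⟩
  · exact hS.congr n₁ fun n hn => by simp [h' n hn]
  rcases lin_cmp (d j) b (d j') b' with ⟨n₂, h2⟩ | ⟨n₂, h2⟩
  · refine .inr ⟨j, b, max n₀ (max n₁ n₂), fun n hn => ?_⟩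
    have := (h n (by omega)).union (h' n (by omega))
    rwa [min_eq_left (h2 n (by omega))] at this
  · refine .inr ⟨j', b', max n₀ (max n₁ n₂), fun n hn => ?_⟩
    have := (h n (by omega)).union (h' n (by omega))
    rwa [min_eq_right (h2 n (by omega))] at this

theorem EL.biUnion {ι : Type*} {P : Set ι} (hP : P.Finite) (S : ι → ℕ → Set ℤ)
    (h : ∀ p ∈ P, EL d (S p)) : EL d (fun n => ⋃ p ∈ P, S p n) := by
  induction P, hP using Set.Finite.induction_on with
  | empty => exact .inl ⟨0, fun n _ => by simp⟩
  | @insert a s ha hs ih =>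
    have := (h a (by simp)).union (ih fun p hp => h p (by simp [hp]))
    exact this.congr 0 fun n _ => by simp

end EL

section Filt

variable {R M : Type*} [CommRing R] [IsNoetherianRing R] [AddCommGroup M] [Module R M]
  [Module.Finite R M] {I : Ideal R}

theorem stable_of_le {F : I.Filtration M} (h : ∀ n, F.N n ≤ I ^ n • ⊤) : F.Stable :=
  (Ideal.stableFiltration_stable I (⊤ : Submodule R M)).of_le h

theorem chain_stab (C : ℕ → I.Filtration M) (hC : ∀ k n, (C k).N n ≤ (C (k + 1)).N n)
    (hb : ∀ k n, (C k).N n ≤ I ^ n • ⊤) : ∃ k, ∀ l, k ≤ l → ∀ n, (C l).N n ≤ (C k).N n := by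
  have hmono : ∀ n, Monotone fun k => (C k).N n := fun n => monotone_nat_of_le_succ (hC · n)
  have hstab : (⨆ k, C k).Stable := by
    apply stable_of_le
    intro n
    rw [Ideal.Filtration.iSup_N, iSup_apply]
    exact iSup_le (hb · n)
  obtain ⟨n₀, h0⟩ := hstab
  have hN : ∀ n, (⨆ k, C k).N n = ⨆ k, (C k).N n := fun n => by
    rw [Ideal.Filtration.iSup_N, iSup_apply]
  have h1 : ∀ n, ∃ k, ∀ l ≥ k, (⨆ k, C k).N n ≤ (C l).N n := by
    intro n
    obtain ⟨k, hk⟩ := monotone_stabilizes_iff_noetherian.mpr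
      (inferInstance : IsNoetherian R M) ⟨_, hmono n⟩
    refine ⟨k, fun l hl => ?_⟩
    rw [hN]
    refine iSup_le fun i => ?_
    refine (hmono n (le_max_left i l)).trans ?_
    have e1 := hk (max i l) (by omega)
    have e2 := hk l hl
    exact (e1.symm.trans e2).le
  choose κ hκ using h1
  refine ⟨(Finset.range (n₀ + 1)).sup κ, fun l _ n => ?_⟩
  have h2 : ∀ n, (⨆ k, C k).N n ≤ (C ((Finset.range (n₀ + 1)).sup κ)).N n := by
    intro n
    induction n with
    | zero => exact hκ 0 _ (Finset.le_sup (f := κ) (by simp))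
    | succ n ih =>
      by_cases hn : n + 1 ≤ n₀
      · exact hκ _ _ (Finset.le_sup (f := κ) (by simp; omega))
      · rw [← h0 n (by omega)]
        exact (smul_mono_right _ ih).trans ((C _).smul_le n)
  refine le_trans ?_ (h2 n)
  rw [hN]
  exact le_iSup (fun k => (C k).N n) l

theorem red_stable {F : I.Filtration M} (h : ∀ n, F.N n ≤ I ^ n • ⊤) {J : Ideal R}
    {m0 : ℕ} (hred : J * I ^ m0 = I ^ (m0 + 1)) :
    ∃ n₀, ∀ n ≥ n₀, F.N (n + 1) = J • F.N n := by
  obtain ⟨n₀, h0⟩ := (stable_of_le h).exists_pow_smul_eq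
  refine ⟨n₀ + m0, fun n hn => ?_⟩
  obtain ⟨k, rfl⟩ := Nat.exists_eq_add_of_le hn
  have e1 := h0 (m0 + 1 + k)
  have e2 := h0 (m0 + k)
  rw [pow_add, ← hred, mul_assoc, ← pow_add, Submodule.mul_smul, ← e2] at e1
  rw [show n₀ + m0 + k + 1 = n₀ + (m0 + 1 + k) by omega, e1, add_assoc]

/-- `{x ∈ F_n : y^i x ∈ G_{n+i}}`. -/
def colF (F G : I.Filtration M) (y : R) (i : ℕ) : I.Filtration M where
  N n := F.N n ⊓ (G.N (n + i)).comap (LinearMap.lsmul R M (y ^ i))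
  mono n := inf_le_inf (F.mono n) (Submodule.comap_mono (by
    rw [show n + 1 + i = n + i + 1 by omega]; exact G.mono _))
  smul_le n := by
    rw [Submodule.smul_le]
    rintro r hr x ⟨hx1, hx2⟩
    refine ⟨F.smul_le n (Submodule.smul_mem_smul hr hx1), ?_⟩
    change y ^ i • r • x ∈ G.N (n + 1 + i)
    rw [smul_comm, show n + 1 + i = n + i + 1 by omega]
    exact G.smul_le _ (Submodule.smul_mem_smul hr hx2)

theorem mem_colF {F G : I.Filtration M} {y : R} {i n : ℕ} {x : M} :
    x ∈ (colF F G y i).N n ↔ x ∈ F.N n ∧ y ^ i • x ∈ G.N (n + i) := Iff.rfl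

end Filt

section Main

variable {R M : Type*} [CommRing R] [IsNoetherianRing R] [AddCommGroup M] [Module R M]
  [Module.Finite R M] {I : Ideal R}
  (𝒜 : ℤ → AddSubgroup R) (ℳ : ℤ → AddSubgroup M)
  [GradedRing 𝒜] [DirectSum.Decomposition ℳ]

def SS (F G : I.Filtration M) (n : ℕ) : Set ℤ :=
  {u | ∃ x ∈ ℳ u, x ∈ F.N n ∧ x ∉ G.N n}

theorem gr_colF (hsmul : ∀ (i j : ℤ), ∀ r ∈ 𝒜 i, ∀ x ∈ ℳ j, r • x ∈ ℳ (i + j))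
    {F G : I.Filtration M} (hF : ∀ n, Gr ℳ (F.N n)) (hG : ∀ n, Gr ℳ (G.N n))
    {y : R} {e : ℤ} (hy : y ∈ 𝒜 e) (i n : ℕ) : Gr ℳ ((colF F G y i).N n) := by
  intro x hx u
  rw [mem_colF] at hx ⊢
  refine ⟨hF n x hx.1 u, ?_⟩
  have hyi : y ^ i ∈ 𝒜 (i • e) := SetLike.pow_mem_graded i hy
  have := comp_hom_smul 𝒜 ℳ hsmul x hyi (u + i • e)
  rw [add_sub_cancel_right] at this
  rw [← this]
  exact hG _ _ hx.2 _

theorem el_main (hsmul : ∀ (i j : ℤ), ∀ r ∈ 𝒜 i, ∀ x ∈ ℳ j, r • x ∈ ℳ (i + j))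
    (hA : ∀ i : ℤ, i < 0 → 𝒜 i = ⊥)
    {c : ℕ} (y : Fin c → R) (d : Fin c → ℤ) (hy : ∀ j, y j ∈ 𝒜 (d j))
    (hyI : ∀ j, y j ∈ I)
    {m0 : ℕ} (hred : Ideal.span (Set.range y) * I ^ m0 = I ^ (m0 + 1)) (A : Finset (Fin c)) :
    ∀ (F G : I.Filtration M), (∀ n, Gr ℳ (F.N n)) → (∀ n, Gr ℳ (G.N n)) →
      (∀ n, F.N n ≤ I ^ n • ⊤) →
      (∀ j ∉ A, ∀ n, ∀ x ∈ F.N n, y j • x ∈ G.N (n + 1)) → EL d (SS ℳ F G) := by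
  obtain ⟨B, hB⟩ := bounded 𝒜 ℳ hsmul hA
  -- decomposition of homogeneous elements
  have hdec : ∀ (F G : I.Filtration M), (∀ n, Gr ℳ (F.N n)) → (∀ n, F.N n ≤ I ^ n • ⊤) →
      ∃ n₀, ∀ n ≥ n₀, ∀ u ∈ SS ℳ F G (n + 1), ∃ j, ∃ x ∈ ℳ (u - d j), x ∈ F.N n ∧
        y j • x ∉ G.N (n + 1) := by
    intro F G hF hb
    obtain ⟨n₀, h0⟩ := red_stable hb hred
    refine ⟨n₀, fun n hn u ⟨x, hxu, hxF, hxG⟩ => ?_⟩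
    by_contra! hcon
    rw [h0 n hn] at hxF
    have key : ∀ z ∈ Ideal.span (Set.range y) • F.N n, (decompose ℳ z u : M) ∈ G.N (n + 1) := by
      intro z hz
      induction hz using Submodule.smul_induction_on' with
      | add a _ b _ ha hb => rw [comp_add]; exact Submodule.add_mem _ ha hb
      | smul r hr z hz =>
        induction hr using Submodule.span_induction generalizing z with
        | zero => simp
        | add a b _ _ ha hb =>
          rw [add_smul, comp_add]; exact Submodule.add_mem _ (ha z hz) (hb z hz)
        | smul a b _ hb =>
          rw [smul_eq_mul, mul_comm, mul_smul]
          exact hb _ (Submodule.smul_mem _ _ hz)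
        | mem a ha =>
          obtain ⟨j, rfl⟩ := ha
          rw [comp_hom_smul 𝒜 ℳ hsmul z (hy j)]
          exact hcon j _ (decompose ℳ z (u - d j)).2 (hF n z hz _)
    have := key x hxF
    rw [decompose_of_mem_same ℳ hxu] at this
    exact hxG this
  induction A using Finset.strongInduction with
  | H A ih =>
  intro F G hF hG hb hA'
  rcases A.eq_empty_or_nonempty with rfl | hne
  · left
    obtain ⟨n₀, h0⟩ := hdec F G hF hb
    refine ⟨n₀ + 1, fun n hn => Set.eq_empty_iff_forall_notMem.2 fun u hu => ?_⟩
    obtain ⟨n, rfl⟩ : ∃ k, n = k + 1 := ⟨n - 1, by omega⟩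
    obtain ⟨j, x, -, hx, hx2⟩ := h0 n (by omega) u hu
    exact hx2 (hA' j (by simp) n x hx)
  obtain ⟨j, hj, hjmin⟩ := A.exists_min_image d hne
  let C : ℕ → I.Filtration M := colF F G (y j)
  have hCb : ∀ k n, (C k).N n ≤ I ^ n • ⊤ := fun k n => inf_le_left.trans (hb n)
  have hCmono : ∀ k n, (C k).N n ≤ (C (k + 1)).N n := by
    rintro k n x ⟨hx1, hx2⟩
    refine ⟨hx1, ?_⟩
    change y j ^ (k + 1) • x ∈ G.N (n + k + 1)
    rw [pow_succ', mul_smul]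
    exact G.smul_le _ (Submodule.smul_mem_smul (hyI j) hx2)
  have hCgr : ∀ k n, Gr ℳ ((C k).N n) := fun k n => gr_colF 𝒜 ℳ hsmul hF hG (hy j) k n
  have hCG : ∀ k n x, x ∈ F.N n → x ∈ G.N n → x ∈ (C k).N n := by
    intro k n x h1 h2
    induction k with
    | zero => exact ⟨h1, by simpa using h2⟩
    | succ k ih => exact hCmono k n ih
  obtain ⟨k, hk⟩ := chain_stab C hCmono hCb
  -- each (C i, G) is fine
  have hC : ∀ i, EL d (SS ℳ (C i) G) := by
    intro i
    induction i with
    | zero =>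
      refine .inl ⟨0, fun n _ => Set.eq_empty_iff_forall_notMem.2 ?_⟩
      rintro u ⟨x, -, hx, hx2⟩
      exact hx2 (by simpa using hx.2)
    | succ i ihi =>
      have h1 := ih (A.erase j) (Finset.erase_ssubset hj) (C (i + 1)) (C i) (hCgr _) (hCgr _)
        (hCb _) (by
          intro l hl n x hx
          by_cases hlj : l = j
          · subst hlj
            refine ⟨F.smul_le n (Submodule.smul_mem_smul (hyI l) hx.1), ?_⟩
            change y l ^ i • y l • x ∈ G.N (n + 1 + i)
            rw [smul_smul, ← pow_succ, show n + 1 + i = n + (i + 1) by omega]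
            exact hx.2
          · have hlA : l ∉ A := fun h => hl (Finset.mem_erase.2 ⟨hlj, h⟩)
            exact hCG _ _ _ (F.smul_le n (Submodule.smul_mem_smul (hyI l) hx.1))
              (hA' l hlA n x hx.1))
      refine (h1.union ihi).congr 0 fun n _ => ?_
      ext u
      constructor
      · rintro (⟨x, hx, h2, h3⟩ | ⟨x, hx, h2, h3⟩)
        · exact ⟨x, hx, h2, fun h => h3 (hCG _ _ _ h2.1 h)⟩
        · exact ⟨x, hx, hCmono _ _ h2, h3⟩
      · rintro ⟨x, hx, h2, h3⟩
        by_cases h4 : x ∈ (C i).N n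
        · exact .inr ⟨x, hx, h4, h3⟩
        · exact .inl ⟨x, hx, h2, h4⟩
  have hFH : EL d (SS ℳ F (C k)) := by
    obtain ⟨n₀, h0⟩ := hdec F (C k) hF hb
    by_cases hem : ∀ n ≥ n₀, SS ℳ F (C k) n = ∅
    · exact .inl ⟨n₀, hem⟩
    push Not at hem
    obtain ⟨n₁, hn₁, hne1⟩ := hem
    have hbdd : BddBelow (SS ℳ F (C k) n₁) := by
      refine ⟨B, ?_⟩
      rintro u ⟨x, hx, -, hx2⟩
      by_contra! hlt
      rw [hB u hlt x hx] at hx2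
      exact hx2 (Submodule.zero_mem _)
    have hl : IsLeast (SS ℳ F (C k) n₁) (sInf (SS ℳ F (C k) n₁)) :=
      ⟨Int.csInf_mem hne1 hbdd, fun u hu => csInf_le hbdd hu⟩
    refine .inr ⟨j, sInf (SS ℳ F (C k) n₁) - d j * n₁, n₁, fun n hn => ?_⟩
    induction n, hn using Nat.le_induction with
    | base => convert hl using 1; ring
    | succ n hn ihn =>
      set b := sInf (SS ℳ F (C k) n₁) - d j * n₁
      have e : d j * ((n + 1 : ℕ) : ℤ) + b = d j + (d j * n + b) := by push_cast; ring
      rw [e]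
      constructor
      · obtain ⟨x, hx, hxF, hxH⟩ := ihn.1
        refine ⟨y j • x, hsmul _ _ _ (hy j) _ hx,
          F.smul_le n (Submodule.smul_mem_smul (hyI j) hxF), fun h => hxH ?_⟩
        refine hk (k + 1) (by omega) n ⟨hxF, ?_⟩
        have := h.2
        change y j ^ k • y j • x ∈ G.N (n + 1 + k) at this
        rw [smul_smul, ← pow_succ, show n + 1 + k = n + (k + 1) by omega] at this
        exact this
      · intro u hu
        obtain ⟨i, x, hx, hxF, hxH⟩ := h0 n (by omega) u hu
        have hiA : i ∈ A := by
          by_contra hi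
          exact hxH (hCG _ _ _ (F.smul_le n (Submodule.smul_mem_smul (hyI i) hxF))
            (hA' i hi n x hxF))
        have h5 : u - d i ∈ SS ℳ F (C k) n :=
          ⟨x, hx, hxF, fun h => hxH ((C k).smul_le n (Submodule.smul_mem_smul (hyI i) h))⟩
        have h6 := ihn.2 h5
        have h7 := hjmin i hiA
        linarith
  refine (hFH.union (hC k)).congr 0 fun n _ => ?_
  ext u
  constructor
  · rintro (⟨x, hx, h2, h3⟩ | ⟨x, hx, h2, h3⟩)
    · exact ⟨x, hx, h2, fun h => h3 (hCG _ _ _ h2 h)⟩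
    · exact ⟨x, hx, h2.1, h3⟩
  · rintro ⟨x, hx, h2, h3⟩
    by_cases h4 : x ∈ (C k).N n
    · exact .inr ⟨x, hx, h4, h3⟩
    · exact .inl ⟨x, hx, h2, h4⟩


/-- `{x ∈ I^n M : a x ⊆ I^n N}`. -/
def wF (I : Ideal R) (N : Submodule R M) (a : Ideal R) : I.Filtration M where
  N n :=
    { carrier := {x | x ∈ (I ^ n • ⊤ : Submodule R M) ∧ ∀ r ∈ a, r • x ∈ (I ^ n • N : Submodule R M)}
      zero_mem' := ⟨Submodule.zero_mem _, fun r _ => by rw [smul_zero]; exact Submodule.zero_mem _⟩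
      add_mem' := fun {x z} hx hz => ⟨Submodule.add_mem _ hx.1 hz.1, fun r hr => by
        rw [smul_add]; exact Submodule.add_mem _ (hx.2 r hr) (hz.2 r hr)⟩
      smul_mem' := fun t x hx => ⟨Submodule.smul_mem _ _ hx.1, fun r hr => by
        rw [smul_comm]; exact Submodule.smul_mem _ _ (hx.2 r hr)⟩ }
  mono n := by
    rintro x ⟨h1, h2⟩
    exact ⟨(I.stableFiltration ⊤).mono n h1, fun r hr => (I.stableFiltration N).mono n (h2 r hr)⟩
  smul_le n := by
    rw [Submodule.smul_le]
    rintro t ht x ⟨h1, h2⟩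
    refine ⟨(I.stableFiltration ⊤).smul_le n (Submodule.smul_mem_smul ht h1), fun r hr => ?_⟩
    rw [smul_comm]
    exact (I.stableFiltration N).smul_le n (Submodule.smul_mem_smul ht (h2 r hr))

theorem mem_wF {N : Submodule R M} {a : Ideal R} {n : ℕ} {x : M} :
    x ∈ (wF I N a).N n ↔ x ∈ (I ^ n • ⊤ : Submodule R M) ∧
      ∀ r ∈ a, r • x ∈ (I ^ n • N : Submodule R M) := Iff.rfl

/-- Elements killed into `I^n N` by a homogeneous element outside `p`. -/
def gF (I : Ideal R) (N : Submodule R M) (p : Ideal R) (hp : p.IsPrime) : I.Filtration M where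
  N n :=
    { carrier := {x | ∃ i : ℤ, ∃ s ∈ 𝒜 i, s ∉ p ∧ s • x ∈ (I ^ n • N : Submodule R M)}
      zero_mem' := ⟨0, 1, SetLike.one_mem_graded 𝒜, fun h => hp.ne_top (p.eq_top_iff_one.2 h), by
        rw [smul_zero]; exact Submodule.zero_mem _⟩
      add_mem' := by
        rintro x z ⟨i, s, hs, hsp, hsx⟩ ⟨k, t, ht, htp, htz⟩
        refine ⟨i + k, s * t, SetLike.mul_mem_graded hs ht, fun h =>
          (hp.mem_or_mem h).elim hsp htp, ?_⟩
        rw [smul_add]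
        refine Submodule.add_mem _ ?_ ?_
        · rw [mul_comm, mul_smul]; exact Submodule.smul_mem _ _ hsx
        · rw [mul_smul]; exact Submodule.smul_mem _ _ htz
      smul_mem' := by
        rintro r x ⟨i, s, hs, hsp, hsx⟩
        refine ⟨i, s, hs, hsp, ?_⟩
        rw [smul_comm]; exact Submodule.smul_mem _ _ hsx }
  mono n := by
    rintro x ⟨i, s, hs, hsp, hsx⟩
    exact ⟨i, s, hs, hsp, (I.stableFiltration N).mono n hsx⟩
  smul_le n := by
    rw [Submodule.smul_le]
    rintro r hr x ⟨i, s, hs, hsp, hsx⟩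
    refine ⟨i, s, hs, hsp, ?_⟩
    rw [smul_comm]
    exact (I.stableFiltration N).smul_le n (Submodule.smul_mem_smul hr hsx)

theorem mem_gF {N : Submodule R M} {p : Ideal R} {hp : p.IsPrime} {n : ℕ} {x : M} :
    x ∈ (gF 𝒜 I N p hp).N n ↔
      ∃ i : ℤ, ∃ s ∈ 𝒜 i, s ∉ p ∧ s • x ∈ (I ^ n • N : Submodule R M) := Iff.rfl

/-- The colon ideal of an element. -/
def col (L : Submodule R M) (x : M) : Ideal R := L.comap (LinearMap.toSpanSingleton R M x)

theorem mem_col {L : Submodule R M} {x : M} {r : R} : r ∈ col L x ↔ r • x ∈ L := by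
  simp [col]

theorem col_hom (hsmul : ∀ (i j : ℤ), ∀ r ∈ 𝒜 i, ∀ x ∈ ℳ j, r • x ∈ ℳ (i + j))
    {L : Submodule R M} (hL : Gr ℳ L) {x : M} {u : ℤ} (hx : x ∈ ℳ u) :
    (col L x).IsHomogeneous 𝒜 := by
  intro i r hr
  replace hr : r ∈ col L x := hr
  change _ ∈ col L x
  rw [mem_col] at hr ⊢
  have := comp_smul_hom 𝒜 ℳ hsmul r hx (i + u)
  rw [add_sub_cancel_right] at this
  rw [← this]
  exact hL _ hr _

theorem gr_wF (hsmul : ∀ (i j : ℤ), ∀ r ∈ 𝒜 i, ∀ x ∈ ℳ j, r • x ∈ ℳ (i + j))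
    (hI : I.IsHomogeneous 𝒜) {N : Submodule R M} (hN : Gr ℳ N) {p : Ideal R}
    (hp : p.IsHomogeneous 𝒜) (n : ℕ) : Gr ℳ ((wF I N p).N n) := by
  classical
  rintro x ⟨h1, h2⟩ u
  refine ⟨gr_pow_smul 𝒜 ℳ hsmul hI (fun _ _ _ => Submodule.mem_top) n x h1 u, fun r hr => ?_⟩
  rw [← sum_support_decompose 𝒜 r, Finset.sum_smul]
  refine Submodule.sum_mem _ fun i _ => ?_
  have := comp_hom_smul 𝒜 ℳ hsmul x (decompose 𝒜 r i).2 (u + i)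
  rw [add_sub_cancel_right] at this
  rw [← this]
  exact gr_pow_smul 𝒜 ℳ hsmul hI hN n _ (h2 _ (hp i hr)) _

theorem gr_gF (hsmul : ∀ (i j : ℤ), ∀ r ∈ 𝒜 i, ∀ x ∈ ℳ j, r • x ∈ ℳ (i + j))
    (hI : I.IsHomogeneous 𝒜) {N : Submodule R M} (hN : Gr ℳ N) {p : Ideal R}
    (hp : p.IsPrime) (n : ℕ) : Gr ℳ ((gF 𝒜 I N p hp).N n) := by
  rintro x ⟨i, s, hs, hsp, hsx⟩ u
  refine ⟨i, s, hs, hsp, ?_⟩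
  have := comp_hom_smul 𝒜 ℳ hsmul x hs (u + i)
  rw [add_sub_cancel_right] at this
  rw [← this]
  exact gr_pow_smul 𝒜 ℳ hsmul hI hN n _ hsx _

/-- Finiteness of the set of primes. -/
theorem fin_primes (I : Ideal R) (N : Submodule R M) :
    {p : Ideal R | p.IsPrime ∧ ∃ n : ℕ, ∃ x ∈ (I ^ n • ⊤ : Submodule R M),
      ∀ r : R, r ∈ p ↔ r • x ∈ (I ^ n • N : Submodule R M)}.Finite := by
  by_contra hinf
  set P := {p : Ideal R | p.IsPrime ∧ ∃ n : ℕ, ∃ x ∈ (I ^ n • ⊤ : Submodule R M),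
      ∀ r : R, r ∈ p ↔ r • x ∈ (I ^ n • N : Submodule R M)} with hP
  have hinf' : P.Infinite := hinf
  let f := hinf'.natEmbedding
  obtain ⟨g, hg | hg⟩ := exists_increasing_or_nonincreasing_subseq
    (fun a b : Ideal R => a < b) (fun n => (f n : Ideal R))
  · have hm : StrictMono fun n => (f (g n) : Ideal R) := fun m n h => hg m n h
    obtain ⟨k, hk⟩ := monotone_stabilizes_iff_noetherian.mpr
      (inferInstance : IsNoetherian R R) ⟨_, hm.monotone⟩
    exact (hm (Nat.lt_succ_self k)).ne (hk (k + 1) (by omega))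
  · let q : ℕ → Ideal R := fun n => (f (g n) : Ideal R)
    have hq : ∀ m n, m < n → ¬ q m ≤ q n := by
      intro m n hmn hle
      rcases hle.lt_or_eq with h | h
      · exact hg m n hmn h
      · have := f.injective (Subtype.ext h)
        have := g.injective this
        omega
    let b : ℕ → Ideal R := fun k => (Finset.range (k + 1)).inf q
    have hb : ∀ k l, k ≤ l → b l ≤ b k := fun k l h => Finset.inf_mono (by
      intro t; simp; omega)
    obtain ⟨k, hk⟩ := chain_stab (fun k => wF I N (b k))
      (fun k n x hx => ⟨hx.1, fun r hr => hx.2 r (hb k (k + 1) (by omega) hr)⟩)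
      (fun k n x hx => hx.1)
    obtain ⟨hpr, n, x, hx, hxr⟩ := (f (g (k + 1))).2
    have hxm : x ∈ (wF I N (b (k + 1))).N n :=
      ⟨hx, fun r hr => (hxr r).1 ((Finset.inf_le (f := q) (b := k + 1) (by simp)) hr)⟩
    have hxm' := hk (k + 1) (by omega) n hxm
    have hle : b k ≤ q (k + 1) := fun r hr => (hxr r).2 (hxm'.2 r hr)
    obtain ⟨i, hi, hle'⟩ := (Ideal.IsPrime.inf_le' hpr).1 hle
    exact hq i (k + 1) (by simpa using hi) hle'

/-- Degrees of homogeneous elements of `I^n M` with prime colon. -/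
def TT (I : Ideal R) (N : Submodule R M) (n : ℕ) : Set ℤ :=
  {u : ℤ | ∃ x ∈ ℳ u, x ∈ (I ^ n • ⊤ : Submodule R M) ∧
    ∃ q : Ideal R, q.IsPrime ∧ ∀ r : R, r ∈ q ↔ r • x ∈ (I ^ n • N : Submodule R M)}

theorem TT_nonempty (hsmul : ∀ (i j : ℤ), ∀ r ∈ 𝒜 i, ∀ x ∈ ℳ j, r • x ∈ ℳ (i + j))
    (hI : I.IsHomogeneous 𝒜) {N : Submodule R M} (hN : Gr ℳ N) (n : ℕ) {x : M}
    (hx : x ∈ (I ^ n • ⊤ : Submodule R M)) (hx' : x ∉ (I ^ n • N : Submodule R M)) :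
    (TT ℳ I N n).Nonempty := by
  classical
  have hT : Gr ℳ (I ^ n • ⊤ : Submodule R M) :=
    gr_pow_smul 𝒜 ℳ hsmul hI (fun _ _ _ => Submodule.mem_top) n
  have hL : Gr ℳ (I ^ n • N : Submodule R M) := gr_pow_smul 𝒜 ℳ hsmul hI hN n
  let Z : Set (Ideal R) := {a | ∃ u, ∃ z ∈ ℳ u, z ∈ (I ^ n • ⊤ : Submodule R M) ∧
    z ∉ (I ^ n • N : Submodule R M) ∧ a = col (I ^ n • N) z}
  have hZ : Z.Nonempty := by
    by_contra hcon
    rw [Set.not_nonempty_iff_eq_empty, Set.eq_empty_iff_forall_notMem] at hcon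
    apply hx'
    rw [← sum_support_decompose ℳ x]
    refine Submodule.sum_mem _ fun i _ => ?_
    by_contra h
    exact hcon _ ⟨i, _, (decompose ℳ x i).2, hT x hx i, h, rfl⟩
  obtain ⟨a, ⟨u, z, hz, hzT, hzN, rfl⟩, hmax⟩ := set_has_maximal_iff_noetherian.2
    (inferInstance : IsNoetherian R R) Z hZ
  refine ⟨u, z, hz, hzT, col (I ^ n • N) z, ?_, fun r => mem_col⟩
  refine (col_hom 𝒜 ℳ hsmul hL hz).isPrime_of_homogeneous_mem_or_mem ?_ ?_
  · rw [Ne, Ideal.eq_top_iff_one, mem_col, one_smul]; exact hzN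
  · rintro s t - ⟨i, ht⟩ hst
    by_contra! hcon
    obtain ⟨hs, ht'⟩ := hcon
    rw [mem_col] at hs ht' hst
    refine hmax (col (I ^ n • N) (t • z)) ⟨i + u, t • z, hsmul _ _ _ ht _ hz,
      Submodule.smul_mem _ _ hzT, ht', rfl⟩ (lt_of_le_of_ne ?_ ?_)
    · intro r hr
      rw [mem_col] at hr ⊢
      rw [smul_comm]; exact Submodule.smul_mem _ _ hr
    · intro h
      apply hs
      rw [← mem_col, h, mem_col, smul_smul]
      exact hst

theorem el_TT (hsmul : ∀ (i j : ℤ), ∀ r ∈ 𝒜 i, ∀ x ∈ ℳ j, r • x ∈ ℳ (i + j))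
    (hA : ∀ i : ℤ, i < 0 → 𝒜 i = ⊥)
    (hI : I.IsHomogeneous 𝒜) {N : Submodule R M} (hN : Gr ℳ N)
    {c : ℕ} (y : Fin c → R) (d : Fin c → ℤ) (hy : ∀ j, y j ∈ 𝒜 (d j))
    (hyI : ∀ j, y j ∈ I)
    {m0 : ℕ} (hred : Ideal.span (Set.range y) * I ^ m0 = I ^ (m0 + 1)) :
    EL d (TT ℳ I N) := by
  classical
  let P : Set (Ideal R) := {p | p.IsPrime ∧ p.IsHomogeneous 𝒜 ∧
    ∃ n : ℕ, ∃ x ∈ (I ^ n • ⊤ : Submodule R M),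
      ∀ r : R, r ∈ p ↔ r • x ∈ (I ^ n • N : Submodule R M)}
  have hP : P.Finite := (fin_primes I N).subset fun p hp => ⟨hp.1, hp.2.2⟩
  let S : Ideal R → ℕ → Set ℤ := fun p n =>
    {u | ∃ hp : p.IsPrime, u ∈ SS ℳ (wF I N p) (gF 𝒜 I N p hp) n}
  have hS : ∀ p ∈ P, EL d (S p) := by
    rintro p ⟨hp, hph, -⟩
    refine (el_main 𝒜 ℳ hsmul hA y d hy hyI hred Finset.univ (wF I N p) (gF 𝒜 I N p hp)
      (gr_wF 𝒜 ℳ hsmul hI hN hph) (gr_gF 𝒜 ℳ hsmul hI hN hp) (fun n x hx => hx.1)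
      (fun j hj => absurd (Finset.mem_univ j) hj)).congr 0 fun n _ => ?_
    ext u
    exact ⟨fun h => ⟨hp, h⟩, fun ⟨_, h⟩ => h⟩
  refine (EL.biUnion hP S hS).congr 0 fun n _ => ?_
  have hL : Gr ℳ (I ^ n • N : Submodule R M) := gr_pow_smul 𝒜 ℳ hsmul hI hN n
  ext u
  simp only [Set.mem_iUnion]
  constructor
  · rintro ⟨p, ⟨hp, hph, -⟩, hp2, x, hxu, hxF, hxG⟩
    refine ⟨x, hxu, hxF.1, p, hp, fun r => ⟨hxF.2 r, fun hr => ?_⟩⟩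
    rw [← sum_support_decompose 𝒜 r]
    refine Submodule.sum_mem _ fun i _ => ?_
    by_contra hri
    refine hxG ⟨i, _, (decompose 𝒜 r i).2, hri, ?_⟩
    have := col_hom 𝒜 ℳ hsmul hL hxu i (mem_col.2 hr)
    exact mem_col.1 this
  · rintro ⟨x, hxu, hxT, q, hq, hqx⟩
    have hqc : q = col (I ^ n • N) x := by ext r; rw [hqx, mem_col]
    refine ⟨q, ⟨hq, hqc ▸ col_hom 𝒜 ℳ hsmul hL hxu, n, x, hxT, hqx⟩, hq, x, hxu,
      ⟨hxT, fun r hr => (hqx r).1 hr⟩, ?_⟩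
    rintro ⟨i, s, -, hsq, hsx⟩
    exact hsq ((hqx s).2 hsx)

end Main

end VNum

/-- Same setup as Statement 9.  If `Ass_R(I^n M / I^n N)` is nonempty for
all sufficiently large `n`, then there are `a ∈ {d 1, …, d c}` and `b', e ∈ ℤ` such that
`v(I^n M / I^n N) = a * n + b'` for all sufficiently large `n`, and
`v(M / I^n N) ≤ a * n + e` for all `n ≥ 1`.  Here `v(Q/L)` is the least degree of a
homogeneous element `x` of `Q` such that `(L :_R x)` is prime. -/
theorem v_number_of_M_mod_InN_linearly_bounded
    {R M : Type*} [CommRing R] [IsNoetherianRing R]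
    [AddCommGroup M] [Module R M] [Module.Finite R M]
    (𝒜 : ℤ → AddSubgroup R) (ℳ : ℤ → AddSubgroup M)
    [GradedRing 𝒜] [DirectSum.Decomposition ℳ]
    (hsmul : ∀ (i j : ℤ), ∀ r ∈ 𝒜 i, ∀ x ∈ ℳ j, r • x ∈ ℳ (i + j))
    (hA : ∀ i : ℤ, i < 0 → 𝒜 i = ⊥)
    (I : Ideal R) (hI : Ideal.IsHomogeneous 𝒜 I)
    (N : Submodule R M) (hN : ∀ x ∈ N, ∀ i : ℤ, (DirectSum.decompose ℳ x i : M) ∈ N)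
    (c : ℕ) (y : Fin c → R) (d : Fin c → ℤ) (hdmono : Monotone d)
    (hy : ∀ j, y j ∈ 𝒜 (d j))
    (J : Ideal R) (hJgen : J = Ideal.span (Set.range y)) (hJI : J ≤ I)
    (m0 : ℕ) (hred : J * I ^ m0 = I ^ (m0 + 1))
    (hass : ∃ n₀ : ℕ, ∀ n ≥ n₀, ∃ q : Ideal R, q.IsPrime ∧
      ∃ x ∈ (I ^ n • ⊤ : Submodule R M),
        ∀ r : R, r ∈ q ↔ r • x ∈ (I ^ n • N : Submodule R M)) :
    ∃ j : Fin c, ∃ b' e : ℤ,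
      (∃ n₁ : ℕ, ∀ n ≥ n₁,
        sInf {u : ℤ | ∃ x ∈ ℳ u, x ∈ (I ^ n • ⊤ : Submodule R M) ∧
            ∃ q : Ideal R, q.IsPrime ∧ ∀ r : R, r ∈ q ↔ r • x ∈ (I ^ n • N : Submodule R M)}
          = d j * (n : ℤ) + b') ∧
      (∀ n : ℕ, 1 ≤ n →
        sInf {u : ℤ | ∃ x ∈ ℳ u,
            ∃ q : Ideal R, q.IsPrime ∧ ∀ r : R, r ∈ q ↔ r • x ∈ (I ^ n • N : Submodule R M)}
          ≤ d j * (n : ℤ) + e) := by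
  have hN' : VNum.Gr ℳ N := hN
  have hyI : ∀ j, y j ∈ I := fun j => hJI (hJgen ▸ Ideal.subset_span ⟨j, rfl⟩)
  obtain ⟨n₀, hn₀⟩ := hass
  have hne : ∀ n ≥ n₀, (VNum.TT ℳ I N n).Nonempty := by
    intro n hn
    obtain ⟨q, hq, x, hx, hqx⟩ := hn₀ n hn
    refine VNum.TT_nonempty 𝒜 ℳ hsmul hI hN' n hx fun h => hq.ne_top ?_
    rw [Ideal.eq_top_iff_one, hqx, one_smul]
    exact h
  obtain ⟨B, hB⟩ := VNum.bounded 𝒜 ℳ hsmul hA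
  rcases VNum.el_TT 𝒜 ℳ hsmul hA hI hN' y d hy hyI (hJgen ▸ hred) with ⟨n₁, h⟩ | ⟨j, b, n₁, h⟩
  · have h1 := hne (max n₀ n₁) (by omega)
    rw [h _ (by omega)] at h1
    exact absurd h1 Set.not_nonempty_empty
  let T' : ℕ → Set ℤ := fun n => {u : ℤ | ∃ x ∈ ℳ u,
    ∃ q : Ideal R, q.IsPrime ∧ ∀ r : R, r ∈ q ↔ r • x ∈ (I ^ n • N : Submodule R M)}
  have hbdd : ∀ n, BddBelow (T' n) := by
    intro n
    refine ⟨B, ?_⟩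
    rintro u ⟨x, hx, q, hq, hqx⟩
    by_contra! hlt
    apply hq.ne_top
    rw [Ideal.eq_top_iff_one, hqx, hB u hlt x hx, smul_zero]
    exact Submodule.zero_mem _
  obtain ⟨e, he⟩ := ((Finset.range n₁).image fun n : ℕ => sInf (T' n) - d j * n).bddAbove
  refine ⟨j, b, max b e, ⟨n₁, fun n hn => (h n hn).csInf_eq⟩, fun n _ => ?_⟩
  change sInf (T' n) ≤ _
  by_cases hn : n₁ ≤ n
  · obtain ⟨x, hx, -, hq⟩ := (h n hn).1
    have h1 : sInf (T' n) ≤ d j * n + b := csInf_le (hbdd n) ⟨x, hx, hq⟩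
    exact h1.trans (by gcongr; exact le_max_left _ _)
  · have h1 : sInf (T' n) - d j * n ≤ e := he (by
      simp only [Finset.coe_image, Set.mem_image, Finset.mem_coe, Finset.mem_range]
      exact ⟨n, by omega, rfl⟩)
    have := le_max_right b e
    linarith
end
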